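/- A 1-planar graph admits a crossing-augmented 1-planar embedding if and only if it is a 4-map graph. -/

import Mathlib

open Set

noncomputable section

/-- The Euclidean plane, where graphs are drawn. -/
abbrev Plane : Type := ℝ × ℝ

/-- A drawing of a multigraph on vertex type `V` with edges indexed by `E`,
`ends e` being the (unordered) pair of endpoints of `e`.  Vertices are distinct
points, edges are simple Jordan arcs joining their endpoints, arcs avoid vertices
in their interior, and edges sharing an endpoint do not cross. -/
structure MultiDrawing (V E : Type) (ends : E → Sym2 V) where
  pos : V → Plane
  pos_inj : Function.Injective pos
  arc : E → ℝ → Plane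
  arc_cont : ∀ e, ContinuousOn (arc e) (Icc (0:ℝ) 1)
  arc_inj : ∀ e, InjOn (arc e) (Icc (0:ℝ) 1)
  arc_ends : ∀ e, ∃ u v : V, ends e = s(u, v) ∧ arc e 0 = pos u ∧ arc e 1 = pos v
  arc_avoid : ∀ e, ∀ w : V, pos w ∉ arc e '' Ioo (0:ℝ) 1
  no_incident_cross : ∀ e f, e ≠ f →
    (arc e '' Ioo (0:ℝ) 1 ∩ arc f '' Ioo (0:ℝ) 1).Nonempty →
    ∀ x : V, ¬(x ∈ ends e ∧ x ∈ ends f)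

namespace MultiDrawing

variable {V E : Type} {ends : E → Sym2 V}

/-- The interior (open part) of the arc of edge `e`. -/
def inter (D : MultiDrawing V E ends) (e : E) : Set Plane := D.arc e '' Ioo (0:ℝ) 1

/-- The crossings of edge `e`: pairs of another edge and a common interior point. -/
def crossSet (D : MultiDrawing V E ends) (e : E) : Set (E × Plane) :=
  {fp | fp.1 ≠ e ∧ fp.2 ∈ D.inter e ∩ D.inter fp.1}

/-- A planar drawing: no edge is crossed. -/
def IsPlanarD (D : MultiDrawing V E ends) : Prop := ∀ e, D.crossSet e = ∅

/-- A 1-planar drawing: each edge is crossed at most once. -/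
def IsOnePlanarD (D : MultiDrawing V E ends) : Prop := ∀ e, (D.crossSet e).Subsingleton

/-- The point set occupied by the drawing. -/
def image (D : MultiDrawing V E ends) : Set Plane :=
  range D.pos ∪ ⋃ e, D.arc e '' Icc (0:ℝ) 1

/-- A face of a drawing: a connected component of the complement of its image. -/
def IsFace (D : MultiDrawing V E ends) (F : Set Plane) : Prop :=
  ∃ p, p ∉ D.image ∧ F = connectedComponentIn D.imageᶜ p

/-- A triangulated drawing: the boundary of each face meets (segments of) exactly
three edges. -/
def IsTriangulated (D : MultiDrawing V E ends) : Prop :=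
  ∀ F : Set Plane, D.IsFace F →
    {e : E | (frontier F ∩ D.arc e '' Icc (0:ℝ) 1).Nonempty}.ncard = 3

end MultiDrawing

/-- A drawing of a simple graph: arcs indexed by its edge set. -/
abbrev SimpleGraph.Drawing {V : Type} (G : SimpleGraph V) : Type :=
  MultiDrawing V ↥G.edgeSet (fun e => (e : Sym2 V))

/-- A graph is 1-planar if it has a drawing with at most one crossing per edge. -/
def SimpleGraph.IsOnePlanar {V : Type} (G : SimpleGraph V) : Prop :=
  ∃ D : G.Drawing, D.IsOnePlanarD

/-- A graph is planar if it has a crossing-free drawing. -/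
def SimpleGraph.IsPlanarGraph {V : Type} (G : SimpleGraph V) : Prop :=
  ∃ D : G.Drawing, D.IsPlanarD

/-- Points of the sphere. -/
abbrev SpherePt : Type := ↥(Metric.sphere (0 : EuclideanSpace ℝ (Fin 3)) 1)

/-- A subset of the sphere that is homeomorphic to a closed disk. -/
def IsClosedDisk (s : Set SpherePt) : Prop :=
  Nonempty (↥s ≃ₜ ↥(Metric.closedBall (0 : Plane) 1))

/-- A map: a partition of the sphere into closed-disk regions with pairwise
disjoint interiors, some of which are labeled as countries. -/
structure SphereMap (C : Type) where
  region : C → Set SpherePt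
  country : C → Prop
  disk : ∀ c, IsClosedDisk (region c)
  int_disjoint : ∀ c d : C, c ≠ d → interior (region c) ∩ interior (region d) = ∅
  cover : ⋃ c, region c = Set.univ

/-- A `k`-map: at most `k` regions meet at any point. -/
def SphereMap.IsKMap {C : Type} (M : SphereMap C) (k : ℕ) : Prop :=
  ∀ p : SpherePt, {c : C | p ∈ M.region c}.ncard ≤ k

/-- A hole-free map: every region is a country. -/
def SphereMap.HoleFree {C : Type} (M : SphereMap C) : Prop := ∀ c, M.country c

/-- `G` is the map graph of `M`: its vertices correspond to the countries of `M`,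
with edges given by touching countries. -/
def IsMapGraphOf {V C : Type} (G : SimpleGraph V) (M : SphereMap C) : Prop :=
  ∃ φ : V ≃ {c : C // M.country c},
    ∀ u v : V, G.Adj u v ↔ u ≠ v ∧ (M.region (φ u) ∩ M.region (φ v)).Nonempty

/-- `G` is a map graph. -/
def IsMapGraph {V : Type} (G : SimpleGraph V) : Prop :=
  ∃ (C : Type) (_ : Finite C) (M : SphereMap C), IsMapGraphOf G M

/-- `G` is a `k`-map graph. -/
def IsKMapGraph {V : Type} (G : SimpleGraph V) (k : ℕ) : Prop :=
  ∃ (C : Type) (_ : Finite C) (M : SphereMap C), M.IsKMap k ∧ IsMapGraphOf G M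

/-- `G` is a hole-free `k`-map graph. -/
def IsHoleFreeKMapGraph {V : Type} (G : SimpleGraph V) (k : ℕ) : Prop :=
  ∃ (C : Type) (_ : Finite C) (M : SphereMap C),
    M.HoleFree ∧ M.IsKMap k ∧ IsMapGraphOf G M

/-- A crossing-augmented 1-planar drawing: for every pair of crossing edges
`{a,b}` and `{c,d}`, all four kite edges between an endpoint of one and an
endpoint of the other are present in `G`. -/
def IsCrossingAugmentedD {V : Type} {G : SimpleGraph V} (D : G.Drawing) : Prop :=
  ∀ e f : G.edgeSet, e ≠ f → (D.inter e ∩ D.inter f).Nonempty →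
    ∀ a b c d : V, (e : Sym2 V) = s(a, b) → (f : Sym2 V) = s(c, d) → G.Adj a c

/-! ## Part 1: continuous logarithms and invariance of domain in dimension two -/

namespace Plan

open Filter Topology

/-- `f` has a continuous logarithm on `K`. -/
def HasLog {X : Type*} [TopologicalSpace X] (f : X → ℂ) (K : Set X) : Prop :=
  ∃ l : X → ℂ, ContinuousOn l K ∧ ∀ x ∈ K, Complex.exp (l x) = f x

lemma HasLog.mono {X : Type*} [TopologicalSpace X] {f : X → ℂ} {K L : Set X}
    (h : HasLog f K) (hL : L ⊆ K) : HasLog f L := by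
  obtain ⟨l, h1, h2⟩ := h
  exact ⟨l, h1.mono hL, fun x hx => h2 x (hL hx)⟩

lemma HasLog.close {X : Type*} [TopologicalSpace X] {f g : X → ℂ} {K : Set X}
    (hf : ContinuousOn f K) (hg : ContinuousOn g K) (h : HasLog f K)
    (hc : ∀ x ∈ K, ‖g x - f x‖ < ‖f x‖) : HasLog g K := by
  obtain ⟨l, h1, h2⟩ := h
  have hf0 : ∀ x ∈ K, f x ≠ 0 := fun x hx h0 => by
    have := hc x hx
    rw [h0, norm_zero] at this
    exact absurd this (not_lt.mpr (norm_nonneg _))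
  have hs : ∀ x ∈ K, g x / f x ∈ Complex.slitPlane := by
    intro x hx
    left
    have h3 : ‖g x / f x - 1‖ < 1 := by
      rw [div_sub_one (hf0 x hx), norm_div, div_lt_one (norm_pos_iff.mpr (hf0 x hx))]
      exact hc x hx
    have h4 := Complex.abs_re_le_norm (g x / f x - 1)
    have h5 := (abs_lt.mp (lt_of_le_of_lt h4 h3)).1
    simp only [Complex.sub_re, Complex.one_re] at h5
    linarith
  refine ⟨fun x => l x + Complex.log (g x / f x), ?_, ?_⟩
  · exact h1.add ((hg.div hf hf0).clog hs)
  · intro x hx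
    rw [Complex.exp_add, h2 x hx, Complex.exp_log (Complex.slitPlane_ne_zero (hs x hx))]
    field_simp [hf0 x hx]

lemma HasLog.homotopy {X : Type*} [PseudoMetricSpace X] {K : Set X} (hK : IsCompact K)
    (H : X → ℝ → ℂ) (hH : ContinuousOn (fun p : X × ℝ => H p.1 p.2) (K ×ˢ Icc (0:ℝ) 1))
    (h0 : ∀ x ∈ K, ∀ t ∈ Icc (0:ℝ) 1, H x t ≠ 0)
    (hl : HasLog (fun x => H x 0) K) : HasLog (fun x => H x 1) K := by
  have hc : IsCompact (K ×ˢ Icc (0:ℝ) 1) := hK.prod isCompact_Icc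
  obtain ⟨m, hm, hmin⟩ : ∃ m > 0, ∀ x ∈ K, ∀ t ∈ Icc (0:ℝ) 1, m ≤ ‖H x t‖ := by
    rcases (K ×ˢ Icc (0:ℝ) 1).eq_empty_or_nonempty with he | hne
    · refine ⟨1, one_pos, fun x hx t ht => ?_⟩
      have : (x, t) ∈ (K ×ˢ Icc (0:ℝ) 1) := ⟨hx, ht⟩
      rw [he] at this
      exact this.elim
    · obtain ⟨p, hp, hp2⟩ := hc.exists_isMinOn hne hH.norm
      exact ⟨‖H p.1 p.2‖, norm_pos_iff.mpr (h0 _ hp.1 _ hp.2),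
        fun x hx t ht => hp2 (show (x, t) ∈ _ from ⟨hx, ht⟩)⟩
  have hu := hc.uniformContinuousOn_of_continuous hH
  rw [Metric.uniformContinuousOn_iff] at hu
  obtain ⟨δ, hδ, hu⟩ := hu m hm
  obtain ⟨N, hN⟩ := exists_nat_one_div_lt hδ
  have hcont : ∀ t ∈ Icc (0:ℝ) 1, ContinuousOn (fun x => H x t) K := by
    intro t ht
    exact hH.comp (f := fun x => (x, t)) (by fun_prop) (fun x hx => ⟨hx, ht⟩)
  have hN0 : (0:ℝ) < N + 1 := by positivity
  have key : ∀ n : ℕ, n ≤ N + 1 → HasLog (fun x => H x (n / (N + 1))) K := by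
    intro n
    induction n with
    | zero => intro _; simpa using hl
    | succ n ih =>
      intro hn
      have hn' : ((n:ℝ) + 1) ≤ N + 1 := by exact_mod_cast hn
      have m1 : (n:ℝ) / (N + 1) ∈ Icc (0:ℝ) 1 :=
        ⟨by positivity, by rw [div_le_one hN0]; linarith⟩
      have m2 : ((n + 1 : ℕ):ℝ) / (N + 1) ∈ Icc (0:ℝ) 1 :=
        ⟨by positivity, by rw [div_le_one hN0]; push_cast; linarith⟩
      refine HasLog.close (hcont _ m1) (hcont _ m2) (ih (by omega)) ?_
      intro x hx
      refine lt_of_lt_of_le ?_ (hmin x hx _ m1)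
      have := hu (x, ((n + 1 : ℕ):ℝ) / (N + 1)) ⟨hx, m2⟩ (x, (n:ℝ) / (N + 1)) ⟨hx, m1⟩ ?_
      · rwa [dist_eq_norm] at this
      · rw [Prod.dist_eq]
        simp only [dist_self, Real.dist_eq]
        rw [max_eq_right (abs_nonneg _), ← sub_div]
        push_cast
        rw [add_sub_cancel_left, abs_of_pos (by positivity)]
        exact hN
  have := key (N + 1) le_rfl
  simpa [div_self hN0.ne'] using this

lemma hasLog_star {X : Type*} [NormedAddCommGroup X] [NormedSpace ℝ X] {K : Set X}
    (hK : IsCompact K) (hs : ∀ x ∈ K, ∀ t ∈ Icc (0:ℝ) 1, t • x ∈ K) {f : X → ℂ}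
    (hf : ContinuousOn f K) (h0 : ∀ x ∈ K, f x ≠ 0) : HasLog f K := by
  have := HasLog.homotopy hK (fun x t => f (t • x)) ?_ ?_ ?_
  · simpa using this
  · exact hf.comp (f := fun p : X × ℝ => p.2 • p.1) (by fun_prop) (fun p hp => hs _ hp.1 _ hp.2)
  · exact fun x hx t ht => h0 _ (hs x hx t ht)
  · rcases K.eq_empty_or_nonempty with he | ⟨y, hy⟩
    · exact ⟨fun _ => 0, continuousOn_const, by simp [he]⟩
    · have hz : (0:X) ∈ K := by simpa using hs y hy 0 (by simp)
      exact ⟨fun _ => Complex.log (f 0), continuousOn_const, fun x _ => by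
        simp [Complex.exp_log (h0 0 hz)]⟩

/-- An odd map on the circle has no continuous logarithm. -/
lemma not_hasLog_odd {k : ℂ → ℂ} (hk : ∀ u ∈ Metric.sphere (0:ℂ) 1, k (-u) = - k u) :
    ¬ HasLog k (Metric.sphere (0:ℂ) 1) := by
  rintro ⟨l, hl, he⟩
  have hneg : ∀ u ∈ Metric.sphere (0:ℂ) 1, -u ∈ Metric.sphere (0:ℂ) 1 := by
    intro u hu; simpa using hu
  have h1 : ∀ u ∈ Metric.sphere (0:ℂ) 1, Complex.exp (l (-u) - l u) = -1 := by
    intro u hu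
    have h3 := he u hu
    have h2 := Complex.exp_ne_zero (l u)
    rw [Complex.exp_sub, he _ (hneg u hu), hk u hu, ← h3, neg_div, div_self h2]
  have hconn : IsPreconnected (Metric.sphere (0:ℂ) 1) :=
    isPreconnected_sphere (by rw [Complex.rank_real_complex]; norm_num) 0 1
  have hc : ContinuousOn (fun u => (l (-u) - l u).im) (Metric.sphere (0:ℂ) 1) := by
    have : ContinuousOn (fun u => l (-u)) (Metric.sphere (0:ℂ) 1) :=
      hl.comp (f := fun u => -u) (by fun_prop) hneg
    exact Complex.continuous_im.comp_continuousOn (this.sub hl)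
  have h1m : (1:ℂ) ∈ Metric.sphere (0:ℂ) 1 := by simp
  have hz : ∃ u ∈ Metric.sphere (0:ℂ) 1, (l (-u) - l u).im = 0 := by
    have e1 : (l (-(-1)) - l (-1)).im = - (l (-1) - l 1).im := by
      simp
    rcases le_total 0 ((l (-1) - l 1).im) with h | h
    · exact hconn.intermediate_value (hneg _ h1m) h1m hc ⟨by rw [e1]; linarith, h⟩
    · exact hconn.intermediate_value h1m (hneg _ h1m) hc ⟨h, by rw [e1]; linarith⟩
  obtain ⟨u, hu, hz⟩ := hz
  have h2 := h1 u hu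
  have h3 : (l (-u) - l u).re = 0 := by
    have := congrArg norm h2
    rw [Complex.norm_exp] at this
    simpa using this
  have h4 : l (-u) - l u = 0 := Complex.ext h3 hz
  rw [h4, Complex.exp_zero] at h2
  norm_num at h2

lemma invDom0 {h : ℂ → ℂ} (hc : ContinuousOn h (Metric.closedBall 0 1))
    (hi : InjOn h (Metric.closedBall 0 1)) :
    h '' Metric.closedBall 0 1 ∈ 𝓝 (h 0) := by
  by_contra hn
  have h0m : (0:ℂ) ∈ Metric.closedBall (0:ℂ) 1 := by simp
  have hsub : Metric.sphere (0:ℂ) 1 ⊆ Metric.closedBall 0 1 := Metric.sphere_subset_closedBall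
  have hcs := hc.mono hsub
  obtain ⟨m, hm, hmin⟩ : ∃ m > 0, ∀ u ∈ Metric.sphere (0:ℂ) 1, m ≤ ‖h u - h 0‖ := by
    obtain ⟨p, hp, hp2⟩ := (isCompact_sphere (0:ℂ) 1).exists_isMinOn ⟨1, by simp⟩
      ((hcs.sub (continuousOn_const (c := h 0))).norm)
    refine ⟨‖h p - h 0‖, ?_, fun u hu => hp2 hu⟩
    refine norm_pos_iff.mpr (sub_ne_zero.mpr ?_)
    intro hh
    have := hi (hsub hp) h0m hh
    rw [this] at hp
    simp at hp
  obtain ⟨y, hy, hyn⟩ : ∃ y, dist y (h 0) < m / 2 ∧ y ∉ h '' Metric.closedBall 0 1 := by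
    by_contra hcon
    push Not at hcon
    exact hn (Filter.mem_of_superset (Metric.ball_mem_nhds _ (half_pos hm)) fun y hy => hcon y hy)
  have l1 : HasLog (fun u => h u - y) (Metric.closedBall (0:ℂ) 1) := by
    refine hasLog_star (isCompact_closedBall 0 1) ?_ (hc.sub continuousOn_const) ?_
    · intro x hx t ht
      simp only [mem_closedBall_zero_iff, norm_smul, Real.norm_eq_abs] at hx ⊢
      rw [abs_of_nonneg ht.1]
      exact mul_le_one₀ ht.2 (norm_nonneg _) hx
    · intro x hx hh
      exact hyn ⟨x, hx, sub_eq_zero.mp hh⟩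
  have l2 : HasLog (fun u => h u - h 0) (Metric.sphere (0:ℂ) 1) := by
    refine HasLog.close (f := fun u => h u - y) (hcs.sub continuousOn_const) (hcs.sub continuousOn_const)
      (l1.mono hsub) ?_
    intro u hu
    have e1 : h u - h 0 - (h u - y) = y - h 0 := by ring
    rw [e1, ← dist_eq_norm]
    have e2 := hmin u hu
    have e3 := dist_triangle (h u) y (h 0)
    rw [← dist_eq_norm] at e2 ⊢
    linarith
  have l3 := HasLog.homotopy (isCompact_sphere (0:ℂ) 1)
    (fun u t => h ((1 / (1 + t) : ℝ) • u) - h (-((t / (1 + t) : ℝ) • u))) ?_ ?_ ?_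
  · refine not_hasLog_odd ?_ l3
    intro u _
    norm_num
  · have c1 : ContinuousOn (fun p : ℂ × ℝ => ((1 / (1 + p.2) : ℝ)) • p.1)
        (Metric.sphere (0:ℂ) 1 ×ˢ Icc (0:ℝ) 1) := by
      have c0 : ContinuousOn (fun p : ℂ × ℝ => (1 / (1 + p.2) : ℝ))
          (Metric.sphere (0:ℂ) 1 ×ˢ Icc (0:ℝ) 1) := by
        refine ContinuousOn.div (by fun_prop) (by fun_prop) ?_
        intro p hp
        have := hp.2.1
        positivity
      exact c0.smul continuousOn_fst
    have c2 : ContinuousOn (fun p : ℂ × ℝ => -(((p.2 / (1 + p.2) : ℝ)) • p.1))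
        (Metric.sphere (0:ℂ) 1 ×ˢ Icc (0:ℝ) 1) := by
      have c0 : ContinuousOn (fun p : ℂ × ℝ => (p.2 / (1 + p.2) : ℝ))
          (Metric.sphere (0:ℂ) 1 ×ˢ Icc (0:ℝ) 1) := by
        refine ContinuousOn.div (by fun_prop) (by fun_prop) ?_
        intro p hp
        have := hp.2.1
        positivity
      exact (c0.smul continuousOn_fst).neg
    refine (hc.comp c1 ?_).sub (hc.comp c2 ?_)
    · rintro ⟨u, t⟩ ⟨hu, ht⟩
      have := ht.1
      simp only [mem_sphere_zero_iff_norm] at hu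
      simp only [mem_closedBall_zero_iff, norm_smul, Real.norm_eq_abs, hu, mul_one]
      rw [abs_of_nonneg (by positivity), div_le_one (by positivity)]
      simp only at this
      linarith
    · rintro ⟨u, t⟩ ⟨hu, ht⟩
      have := ht.1
      simp only [mem_sphere_zero_iff_norm] at hu
      simp only [mem_closedBall_zero_iff, norm_neg, norm_smul, Real.norm_eq_abs, hu, mul_one]
      rw [abs_of_nonneg (by positivity), div_le_one (by positivity)]
      linarith
  · intro u hu t ht hh
    have ht0 := ht.1
    simp only [mem_sphere_zero_iff_norm] at hu
    have := hi ?_ ?_ (sub_eq_zero.mp hh)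
    · rw [← neg_smul, ← sub_eq_zero, ← sub_smul, smul_eq_zero] at this
      rcases this with h1 | h1
      · have h2 : (0:ℝ) < 1 / (1 + t) := by positivity
        have h3 : (0:ℝ) ≤ t / (1 + t) := by positivity
        linarith
      · rw [h1] at hu; simp at hu
    · simp only [mem_closedBall_zero_iff, norm_smul, Real.norm_eq_abs, hu, mul_one]
      rw [abs_of_nonneg (by positivity), div_le_one (by positivity)]
      linarith
    · simp only [mem_closedBall_zero_iff, norm_neg, norm_smul, Real.norm_eq_abs, hu, mul_one]
      rw [abs_of_nonneg (by positivity), div_le_one (by positivity)]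
      linarith
  · simpa using l2

/-- Invariance of domain in the plane. -/
lemma invDom1 {h : ℂ → ℂ} {z : ℂ} {r : ℝ} (hr : 0 < r)
    (hc : ContinuousOn h (Metric.closedBall z r))
    (hi : InjOn h (Metric.closedBall z r)) :
    h '' Metric.closedBall z r ∈ 𝓝 (h z) := by
  have hm : ∀ u ∈ Metric.closedBall (0:ℂ) 1, z + (r:ℂ) * u ∈ Metric.closedBall z r := by
    intro u hu
    simp only [mem_closedBall_zero_iff] at hu
    simp only [Metric.mem_closedBall, dist_self_add_left, norm_mul, Complex.norm_real,
      Real.norm_eq_abs, abs_of_pos hr]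
    nlinarith
  have := invDom0 (h := fun u => h (z + (r:ℂ) * u)) (hc.comp (by fun_prop) hm) ?_
  · simp only [mul_zero, add_zero] at this
    refine Filter.mem_of_superset this ?_
    rintro _ ⟨u, hu, rfl⟩
    exact ⟨_, hm u hu, rfl⟩
  · intro u hu v hv huv
    have := hi (hm u hu) (hm v hv) huv
    have hr' : (r:ℂ) ≠ 0 := by exact_mod_cast hr.ne'
    exact mul_left_cancel₀ hr' (add_left_cancel this)

/-- A surface: every point lies in a chart with values in `ℂ`. -/
class Surf (Y : Type*) [TopologicalSpace Y] : Prop where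
  chart : ∀ y : Y, ∃ e : OpenPartialHomeomorph Y ℂ, y ∈ e.source

lemma invDom {Y : Type*} [TopologicalSpace Y] [Surf Y] {h : ℂ → Y} {z : ℂ} {s : Set ℂ}
    (hs : s ∈ 𝓝 z) (hc : ContinuousOn h s) (hi : InjOn h s) : h '' s ∈ 𝓝 (h z) := by
  obtain ⟨e, he⟩ := Surf.chart (h z)
  have h1 : h ⁻¹' e.source ∩ s ∈ 𝓝 z := by
    refine Filter.inter_mem ?_ hs
    exact (hc.continuousAt hs) (e.open_source.mem_nhds he)
  obtain ⟨r, hr, hsub⟩ := Metric.nhds_basis_closedBall.mem_iff.mp h1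
  have hb := invDom1 (h := fun u => e (h u)) (z := z) hr ?_ ?_
  · have h2 := e.symm.image_mem_nhds (x := e (h z)) (e.map_source he) hb
    rw [e.left_inv he] at h2
    refine Filter.mem_of_superset h2 ?_
    rintro _ ⟨_, ⟨u, hu, rfl⟩, rfl⟩
    have h3 := hsub hu
    refine ⟨u, h3.2, ?_⟩
    exact (e.left_inv h3.1).symm
  · exact e.continuousOn.comp (hc.mono fun u hu => (hsub hu).2) fun u hu => (hsub hu).1
  · intro u hu v hv huv
    exact hi (hsub hu).2 (hsub hv).2 (e.injOn (hsub hu).1 (hsub hv).1 huv)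

end Plan

/-! ## Part 2: closed disks and gluing -/

namespace Plan

open Filter Topology

/-- The closed unit disk in the complex plane. -/
abbrev DD : Set ℂ := Metric.closedBall (0:ℂ) 1

/-- `f` parametrizes `s` as a closed disk. -/
structure Par {Y : Type*} [TopologicalSpace Y] (f : ℂ → Y) (s : Set Y) : Prop where
  cont : ContinuousOn f DD
  inj : InjOn f DD
  img : f '' DD = s

def Dsk {Y : Type*} [TopologicalSpace Y] (s : Set Y) : Prop := ∃ f : ℂ → Y, Par f s

lemma isCompact_DD : IsCompact DD := isCompact_closedBall 0 1

lemma mem_DD {z : ℂ} : z ∈ DD ↔ ‖z‖ ≤ 1 := by simp [DD]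

lemma factor {X Y Z : Type*} [TopologicalSpace X] [TopologicalSpace Y] [T2Space Y]
    [TopologicalSpace Z] [Nonempty Z] {K : Set X} (hK : IsCompact K) {P : X → Y} {F : X → Z}
    (hP : ContinuousOn P K) (hF : ContinuousOn F K)
    (h : ∀ a ∈ K, ∀ b ∈ K, P a = P b → F a = F b) :
    ∃ E : Y → Z, ContinuousOn E (P '' K) ∧ ∀ a ∈ K, E (P a) = F a := by
  classical
  let E : Y → Z := fun y => if h : ∃ a ∈ K, P a = y then F h.choose else Classical.arbitrary Z
  have hE : ∀ a ∈ K, E (P a) = F a := by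
    intro a ha
    have hx : ∃ b ∈ K, P b = P a := ⟨a, ha, rfl⟩
    simp only [E, dif_pos hx]
    exact h _ hx.choose_spec.1 _ ha hx.choose_spec.2
  refine ⟨E, ?_, hE⟩
  rw [continuousOn_iff_isClosed]
  intro t ht
  obtain ⟨u, hu, hut⟩ := continuousOn_iff_isClosed.1 hF t ht
  refine ⟨P '' (K ∩ u), ((hK.inter_right hu).image_of_continuousOn
    (hP.mono inter_subset_left)).isClosed, ?_⟩
  ext y
  constructor
  · rintro ⟨hy, a, ha, rfl⟩
    refine ⟨⟨a, ⟨ha, ?_⟩, rfl⟩, a, ha, rfl⟩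
    have : a ∈ F ⁻¹' t ∩ K := ⟨by simpa [hE a ha] using hy, ha⟩
    rw [hut] at this; exact this.1
  · rintro ⟨⟨a, ⟨ha, hau⟩, rfl⟩, _⟩
    refine ⟨?_, a, ha, rfl⟩
    have : a ∈ F ⁻¹' t ∩ K := by rw [hut]; exact ⟨hau, ha⟩
    simpa [hE a ha] using this.1

instance : Surf ℂ := ⟨fun y => ⟨OpenPartialHomeomorph.refl ℂ, by simp⟩⟩

section
variable {Y : Type*} [TopologicalSpace Y] {f : ℂ → Y} {s : Set Y}

lemma Par.compact (h : Par f s) : IsCompact s := by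
  rw [← h.img]; exact isCompact_DD.image_of_continuousOn h.cont

lemma Par.mem (h : Par f s) {w : ℂ} (hw : ‖w‖ ≤ 1) : f w ∈ s := by
  rw [← h.img]; exact ⟨w, mem_DD.2 hw, rfl⟩

lemma Par.inv [T2Space Y] (h : Par f s) :
    ∃ g : Y → ℂ, ContinuousOn g s ∧ (∀ w ∈ DD, g (f w) = w) ∧ (∀ y ∈ s, g y ∈ DD ∧ f (g y) = y) := by
  obtain ⟨g, hg, hg'⟩ := factor isCompact_DD h.cont continuousOn_id (fun a ha b hb hab => h.inj ha hb hab)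
  rw [h.img] at hg
  refine ⟨g, hg, hg', ?_⟩
  intro y hy
  rw [← h.img] at hy
  obtain ⟨w, hw, rfl⟩ := hy
  rw [hg' w hw]; exact ⟨hw, rfl⟩

lemma Par.comp (h : Par f s) {E : ℂ → ℂ} (hE : Par E DD) : Par (f ∘ E) s where
  cont := h.cont.comp hE.cont (fun x hx => by rw [← hE.img]; exact ⟨x, hx, rfl⟩)
  inj := h.inj.comp hE.inj (fun x hx => by rw [← hE.img]; exact ⟨x, hx, rfl⟩)
  img := by rw [image_comp, hE.img, h.img]

lemma Par.map {Y' : Type*} [TopologicalSpace Y'] (h : Par f s) {φ : Y → Y'} (hc : ContinuousOn φ s)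
    (hi : InjOn φ s) : Par (φ ∘ f) (φ '' s) where
  cont := hc.comp h.cont (fun x hx => by rw [← h.img]; exact ⟨x, hx, rfl⟩)
  inj := hi.comp h.inj (fun x hx => by rw [← h.img]; exact ⟨x, hx, rfl⟩)
  img := by rw [image_comp, h.img]

lemma Dsk.map {Y' : Type*} [TopologicalSpace Y'] (h : Dsk s) {φ : Y → Y'} (hc : ContinuousOn φ s)
    (hi : InjOn φ s) : Dsk (φ '' s) := by
  obtain ⟨f, hf⟩ := h
  exact ⟨_, hf.map hc hi⟩

lemma Dsk.compact (h : Dsk s) : IsCompact s := by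
  obtain ⟨f, hf⟩ := h
  exact hf.compact

lemma Dsk.nonempty (h : Dsk s) : s.Nonempty := by
  obtain ⟨f, hf⟩ := h
  exact ⟨f 0, hf.mem (by simp)⟩

lemma Par.subset_closure (h : Par f s) : s ⊆ closure (f '' Metric.ball 0 1) := by
  rw [← h.img]
  have : DD = closure (Metric.ball (0:ℂ) 1) := (closure_ball 0 one_ne_zero).symm
  have h1 := h.cont
  rw [this] at h1
  rw [this]
  exact h1.image_closure

lemma Par.ball_nhds [Surf Y] (h : Par f s) {w : ℂ} (hw : ‖w‖ < 1) {t : Set ℂ} (ht : t ∈ 𝓝 w) :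
    f '' t ∈ 𝓝 (f w) := by
  have hb : Metric.ball (0:ℂ) 1 ∈ 𝓝 w := Metric.isOpen_ball.mem_nhds (by simpa using hw)
  refine mem_of_superset (invDom (inter_mem ht hb) (h.cont.mono ?_) (h.inj.mono ?_))
    (image_mono inter_subset_left)
  all_goals exact fun x hx => Metric.ball_subset_closedBall hx.2

lemma Par.isOpen_ball [Surf Y] (h : Par f s) : IsOpen (f '' Metric.ball 0 1) := by
  rw [isOpen_iff_mem_nhds]
  rintro _ ⟨w, hw, rfl⟩
  exact h.ball_nhds (by simpa using hw) (Metric.isOpen_ball.mem_nhds hw)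

lemma Par.ball_sub [Surf Y] (h : Par f s) : f '' Metric.ball 0 1 ⊆ interior s := by
  refine interior_maximal ?_ h.isOpen_ball
  rw [← h.img]; exact image_mono Metric.ball_subset_closedBall

lemma Par.bdry [Surf Y] (h : Par f s) {y : Y} (hy : y ∈ s) (hy' : y ∉ interior s) :
    ∃ u : ℂ, ‖u‖ = 1 ∧ f u = y := by
  rw [← h.img] at hy
  obtain ⟨w, hw, rfl⟩ := hy
  refine ⟨w, ?_, rfl⟩
  by_contra hne
  exact hy' (h.ball_sub ⟨w, by simpa using lt_of_le_of_ne (mem_DD.1 hw) hne, rfl⟩)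

lemma Par.sphere [T2Space Y] [Surf Y] (h : Par f s) {u : ℂ} (hu : ‖u‖ = 1) : f u ∉ interior s := by
  intro hi
  obtain ⟨g, hg, hg1, hg2⟩ := h.inv
  obtain ⟨e, he⟩ := Surf.chart (f u)
  set T : Set ℂ := e.target ∩ e.symm ⁻¹' (interior s) with hT
  have hTo : IsOpen T := e.isOpen_inter_preimage_symm isOpen_interior
  have hmem : e (f u) ∈ T := ⟨e.map_source he, by simpa [e.left_inv he] using hi⟩
  have hTs : ∀ x ∈ T, e.symm x ∈ s := fun x hx => interior_subset hx.2
  have := invDom (h := g ∘ e.symm) (hTo.mem_nhds hmem)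
    (hg.comp (e.symm.continuousOn.mono inter_subset_left) hTs) (by
      intro x hx y hy hxy
      have h1 := (hg2 _ (hTs x hx)).2
      have h2 := (hg2 _ (hTs y hy)).2
      simp only [Function.comp] at hxy
      rw [hxy, h2] at h1
      exact e.symm.injOn hx.1 hy.1 h1.symm)
  simp only [Function.comp, e.left_inv he, hg1 u (mem_DD.2 hu.le)] at this
  have h3 : DD ∈ 𝓝 u := by
    refine mem_of_superset this ?_
    rintro _ ⟨x, hx, rfl⟩
    exact (hg2 _ (hTs x hx)).1
  have h4 := mem_interior_iff_mem_nhds.2 h3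
  rw [interior_closedBall _ one_ne_zero] at h4
  simp [hu] at h4

lemma Par.interior_eq [T2Space Y] [Surf Y] (h : Par f s) : interior s = f '' Metric.ball 0 1 := by
  refine Subset.antisymm ?_ h.ball_sub
  intro y hy
  have := interior_subset hy
  rw [← h.img] at this
  obtain ⟨w, hw, rfl⟩ := this
  refine ⟨w, ?_, rfl⟩
  rcases lt_or_eq_of_le (mem_DD.1 hw) with h1 | h1
  · simpa using h1
  · exact (h.sphere h1 hy).elim

end

end Plan

namespace Plan

open Filter Topology

/-- polar coordinates -/
def pol (ρ α : ℝ) : ℂ := ρ * Complex.exp (α * Complex.I)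

lemma norm_pol {ρ : ℝ} (h : 0 ≤ ρ) (α : ℝ) : ‖pol ρ α‖ = ρ := by
  simp [pol, Complex.norm_exp_ofReal_mul_I, abs_of_nonneg h]

lemma continuous_pol : Continuous (fun p : ℝ × ℝ => pol p.1 p.2) := by
  unfold pol; fun_prop

lemma exp_eq_near {c α β : ℝ} (hα : α ∈ Icc c (c + 2 * Real.pi)) (hβ : β ∈ Icc c (c + 2 * Real.pi))
    (h : Complex.exp (α * Complex.I) = Complex.exp (β * Complex.I)) :
    α = β ∨ (α = c ∧ β = c + 2 * Real.pi) ∨ (β = c ∧ α = c + 2 * Real.pi) := by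
  obtain ⟨n, hn⟩ := Complex.exp_eq_exp_iff_exists_int.1 h
  have hn' : α = β + n * (2 * Real.pi) := by
    have := congrArg Complex.im hn
    simpa using this
  have hp := Real.pi_pos
  have h1 : n ≤ 1 := by
    by_contra hc
    have : (2:ℝ) ≤ n := by exact_mod_cast (by omega : (2:ℤ) ≤ n)
    nlinarith [hα.2, hβ.1]
  have h2 : -1 ≤ n := by
    by_contra hc
    have : (n:ℝ) ≤ -2 := by exact_mod_cast (by omega : n ≤ (-2:ℤ))
    nlinarith [hα.1, hβ.2]
  have : n = -1 ∨ n = 0 ∨ n = 1 := by omega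
  rcases this with rfl | rfl | rfl
  · right; left
    push_cast at hn'
    constructor <;> linarith [hα.1, hβ.2]
  · left; simpa using hn'
  · right; right
    push_cast at hn'
    constructor <;> linarith [hα.2, hβ.1]

lemma exists_pol (c : ℝ) (w : ℂ) : ∃ β ∈ Icc c (c + 2 * Real.pi), w = pol ‖w‖ β := by
  refine ⟨toIcoMod Real.two_pi_pos c (Complex.arg w), Ico_subset_Icc_self (toIcoMod_mem_Ico _ _ _), ?_⟩
  conv_lhs => rw [← Complex.norm_mul_exp_arg_mul_I w]
  unfold pol
  congr 1
  rw [Complex.exp_eq_exp_iff_exists_int]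
  refine ⟨toIcoDiv Real.two_pi_pos c (Complex.arg w), ?_⟩
  have := toIcoMod_add_toIcoDiv_zsmul Real.two_pi_pos c (Complex.arg w)
  have h2 : ((toIcoMod Real.two_pi_pos c w.arg + toIcoDiv Real.two_pi_pos c w.arg • (2 * Real.pi) : ℝ) : ℂ) = (w.arg : ℂ) := by
    rw [this]
  rw [← h2]; push_cast [zsmul_eq_mul]; ring

lemma exp_per (c : ℝ) : Complex.exp ((c + 2 * Real.pi : ℝ) * Complex.I) = Complex.exp (c * Complex.I) := by
  rw [Complex.exp_eq_exp_iff_exists_int]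
  exact ⟨1, by push_cast; ring⟩

lemma angular {g : ℝ → ℝ} (hc : ContinuousOn g (Icc 0 (2 * Real.pi)))
    (hm : StrictMonoOn g (Icc 0 (2 * Real.pi))) (hg : g (2 * Real.pi) = g 0 + 2 * Real.pi) :
    ∃ E : ℂ → ℂ, Par E DD ∧ ∀ ρ ∈ Icc (0:ℝ) 1, ∀ α ∈ Icc 0 (2 * Real.pi), E (pol ρ α) = pol ρ (g α) := by
  have hpp : (0:ℝ) ≤ 2 * Real.pi := Real.two_pi_pos.le
  have l0 : (0:ℝ) ∈ Icc 0 (2 * Real.pi) := left_mem_Icc.2 hpp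
  have l1 : (2 * Real.pi) ∈ Icc 0 (2 * Real.pi) := right_mem_Icc.2 hpp
  have hgI : ∀ α ∈ Icc 0 (2 * Real.pi), g α ∈ Icc (g 0) (g 0 + 2 * Real.pi) := by
    intro α hα
    exact ⟨hm.monotoneOn l0 hα hα.1, hg ▸ hm.monotoneOn hα l1 hα.2⟩
  have key : ∀ α ∈ Icc 0 (2 * Real.pi), ∀ β ∈ Icc 0 (2 * Real.pi),
      (Complex.exp (α * Complex.I) = Complex.exp (β * Complex.I) ↔
       Complex.exp (g α * Complex.I) = Complex.exp (g β * Complex.I)) := by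
    intro α hα β hβ
    constructor
    · intro h
      rcases exp_eq_near (c := 0) (by simpa using hα) (by simpa using hβ) h with h | ⟨h1, h2⟩ | ⟨h1, h2⟩
      · rw [h]
      · rw [h1, h2, zero_add, hg, exp_per]
      · rw [h1, h2, zero_add, hg, exp_per]
    · intro h
      rcases exp_eq_near (c := g 0) (hgI α hα) (hgI β hβ) h with h | ⟨h1, h2⟩ | ⟨h1, h2⟩
      · rw [hm.injOn hα hβ h]
      · rw [hm.injOn hα l0 h1, hm.injOn hβ l1 (h2.trans hg.symm)]
        have := exp_per 0
        rw [zero_add] at this; exact this.symm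
      · rw [hm.injOn hβ l0 h1, hm.injOn hα l1 (h2.trans hg.symm)]
        have := exp_per 0
        rw [zero_add] at this; exact this
  have key2 : ∀ ρ ∈ Icc (0:ℝ) 1, ∀ α ∈ Icc 0 (2 * Real.pi), ∀ σ ∈ Icc (0:ℝ) 1, ∀ β ∈ Icc 0 (2 * Real.pi),
      (pol ρ α = pol σ β ↔ pol ρ (g α) = pol σ (g β)) := by
    intro ρ hρ α hα σ hσ β hβ
    by_cases hrs : ρ = σ
    · subst hrs
      by_cases h0 : ρ = 0
      · simp [h0, pol]
      · have : (ρ : ℂ) ≠ 0 := by exact_mod_cast h0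
        simp only [pol, mul_right_inj' this]
        exact key α hα β hβ
    · constructor <;> intro h <;> exfalso <;> apply hrs
      · rw [← norm_pol hρ.1 α, h, norm_pol hσ.1]
      · rw [← norm_pol hρ.1 (g α), h, norm_pol hσ.1]
  have hK : IsCompact (Icc (0:ℝ) 1 ×ˢ Icc 0 (2 * Real.pi)) := isCompact_Icc.prod isCompact_Icc
  obtain ⟨E, hEc, hE⟩ := factor hK (P := fun p : ℝ × ℝ => pol p.1 p.2) (F := fun p => pol p.1 (g p.2))
    continuous_pol.continuousOn
    (continuous_pol.comp_continuousOn (continuousOn_fst.prodMk (hc.comp continuousOn_snd fun p hp => hp.2)))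
    (fun a ha b hb hab => (key2 _ ha.1 _ ha.2 _ hb.1 _ hb.2).1 hab)
  have hPK : (fun p : ℝ × ℝ => pol p.1 p.2) '' (Icc (0:ℝ) 1 ×ˢ Icc 0 (2 * Real.pi)) = DD := by
    apply Subset.antisymm
    · rintro _ ⟨p, hp, rfl⟩
      rw [mem_DD]; simp only; rw [norm_pol hp.1.1]; exact hp.1.2
    · intro w hw
      obtain ⟨β, hβ, h⟩ := exists_pol 0 w
      exact ⟨(‖w‖, β), ⟨⟨norm_nonneg _, mem_DD.1 hw⟩, by simpa using hβ⟩, h.symm⟩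
  rw [hPK] at hEc
  refine ⟨E, ⟨hEc, ?_, ?_⟩, fun ρ hρ α hα => hE (ρ, α) ⟨hρ, hα⟩⟩
  · rw [← hPK]
    rintro _ ⟨a, ha, rfl⟩ _ ⟨b, hb, rfl⟩ hab
    rw [hE a ha, hE b hb] at hab
    exact (key2 _ ha.1 _ ha.2 _ hb.1 _ hb.2).2 hab
  · apply Subset.antisymm
    · conv_lhs => rw [← hPK]
      rintro _ ⟨_, ⟨p, hp, rfl⟩, rfl⟩
      rw [hE p hp, mem_DD, norm_pol hp.1.1]; exact hp.1.2
    · intro w hw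
      obtain ⟨β, hβ, h⟩ := exists_pol (g 0) w
      rw [← hg] at hβ
      obtain ⟨α, hα, rfl⟩ := intermediate_value_Icc hpp hc hβ
      refine ⟨pol ‖w‖ α, ?_, ?_⟩
      · rw [mem_DD, norm_pol (norm_nonneg _)]; exact mem_DD.1 hw
      · rw [hE (‖w‖, α) ⟨⟨norm_nonneg _, mem_DD.1 hw⟩, hα⟩]; exact h.symm

lemma par_conj : Par (fun z => (starRingEnd ℂ) z) DD where
  cont := Complex.continuous_conj.continuousOn
  inj := fun a _ b _ h => (starRingEnd ℂ).injective h
  img := by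
    apply Subset.antisymm
    · rintro _ ⟨z, hz, rfl⟩
      rw [mem_DD] at *; simpa using hz
    · intro z hz
      exact ⟨(starRingEnd ℂ) z, by rw [mem_DD] at *; simpa using hz, by simp⟩

/-- lift of an arc in the unit circle -/
lemma lift_arc {c : ℝ → ℂ} (hc : ContinuousOn c (Icc 0 1)) (h1 : ∀ t ∈ Icc (0:ℝ) 1, ‖c t‖ = 1) :
    ∃ θ : ℝ → ℝ, ContinuousOn θ (Icc 0 1) ∧ ∀ t ∈ Icc (0:ℝ) 1, c t = pol 1 (θ t) := by
  have : HasLog c (Icc (0:ℝ) 1) := by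
    refine hasLog_star isCompact_Icc ?_ hc ?_
    · intro x hx t ht
      simp only [smul_eq_mul, mem_Icc] at *
      constructor
      · exact mul_nonneg ht.1 hx.1
      · nlinarith
    · intro x hx h0
      have := h1 x hx
      simp [h0] at this
  obtain ⟨L, hL, hL'⟩ := this
  refine ⟨fun t => (L t).im, Complex.continuous_im.comp_continuousOn hL, ?_⟩
  intro t ht
  have h2 := (hL' t ht).symm
  have h3 := h1 t ht
  have h4 : (L t).re = 0 := by
    rw [h2, Complex.norm_exp] at h3
    exact (Real.exp_eq_one_iff _).1 h3
  rw [h2]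
  simp only [pol, Complex.ofReal_one, one_mul]
  congr 1
  apply Complex.ext <;> simp [h4]

lemma normalize_mono {θ : ℝ → ℝ} (hθ : ContinuousOn θ (Icc 0 1)) (hm : StrictMonoOn θ (Icc 0 1))
    (hi : InjOn (fun t => pol 1 (θ t)) (Icc 0 1)) :
    ∃ E, Par E DD ∧ ∀ α ∈ Icc 0 Real.pi, E (pol 1 α) = pol 1 (θ (α / Real.pi)) := by
  have hp := Real.pi_pos
  have l0 : (0:ℝ) ∈ Icc (0:ℝ) 1 := by simp
  have l1 : (1:ℝ) ∈ Icc (0:ℝ) 1 := by simp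
  have hlt : θ 1 < θ 0 + 2 * Real.pi := by
    by_contra hcon
    push Not at hcon
    obtain ⟨t, ht, h⟩ := intermediate_value_Icc zero_le_one hθ
      (⟨by linarith, hcon⟩ : θ 0 + 2 * Real.pi ∈ Icc (θ 0) (θ 1))
    have : t = 0 := by
      apply hi ht l0
      simp only [pol]
      rw [h, exp_per]
    rw [this] at h
    linarith
  set g : ℝ → ℝ := fun α => if α ≤ Real.pi then θ (α / Real.pi) else
    θ 1 + (α - Real.pi) / Real.pi * (θ 0 + 2 * Real.pi - θ 1) with hg
  have hdiv : ∀ α ∈ Icc 0 Real.pi, α / Real.pi ∈ Icc (0:ℝ) 1 := by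
    intro α hα
    exact ⟨div_nonneg hα.1 hp.le, (div_le_one hp).2 hα.2⟩
  have hgpi : g Real.pi = θ 1 := by simp [hg, hp.ne']
  have e1 : EqOn g (fun α => θ (α / Real.pi)) (Icc 0 Real.pi) := by
    intro α hα
    simp [hg, hα.2]
  have e2 : EqOn g (fun α => θ 1 + (α - Real.pi) / Real.pi * (θ 0 + 2 * Real.pi - θ 1)) (Icc Real.pi (2 * Real.pi)) := by
    intro α hα
    rcases eq_or_lt_of_le hα.1 with h | h
    · rw [← h, hgpi]; simp
    · simp [hg, not_le.2 h]
  have hun : Icc (0:ℝ) Real.pi ∪ Icc Real.pi (2 * Real.pi) = Icc 0 (2 * Real.pi) :=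
    Icc_union_Icc_eq_Icc hp.le (by linarith)
  have c1 : ContinuousOn g (Icc 0 Real.pi) :=
    (hθ.comp (by fun_prop) hdiv).congr e1
  have c2 : ContinuousOn g (Icc Real.pi (2 * Real.pi)) := by
    refine ContinuousOn.congr ?_ e2
    fun_prop
  have m1 : StrictMonoOn g (Icc 0 Real.pi) := by
    intro a ha b hb hab
    rw [e1 ha, e1 hb]
    exact hm (hdiv a ha) (hdiv b hb) (by gcongr)
  have m2 : StrictMonoOn g (Icc Real.pi (2 * Real.pi)) := by
    intro a ha b hb hab
    rw [e2 ha, e2 hb]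
    have : 0 < θ 0 + 2 * Real.pi - θ 1 := by linarith
    have : (a - Real.pi) / Real.pi < (b - Real.pi) / Real.pi := by gcongr
    simp only
    gcongr
  have hg0 : g 0 = θ 0 := by simp [hg, hp.le]
  obtain ⟨E, hE, hE'⟩ := angular (g := g)
    (by rw [← hun]; exact c1.union_of_isClosed c2 isClosed_Icc isClosed_Icc)
    (by rw [← hun]; exact m1.union m2 (isGreatest_Icc hp.le) (isLeast_Icc (by linarith)))
    (by rw [e2 (right_mem_Icc.2 (by linarith)), hg0]; simp only; field_simp; ring)
  refine ⟨E, hE, ?_⟩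
  intro α hα
  rw [hE' 1 (by simp) α ⟨hα.1, by linarith [hα.2]⟩, e1 hα]

lemma normalize {Y : Type*} [TopologicalSpace Y] [T2Space Y] {f : ℂ → Y} {s : Set Y} (hf : Par f s)
    {b : ℝ → Y} (hb : ContinuousOn b (Icc 0 1)) (hbi : InjOn b (Icc 0 1))
    (hbs : ∀ t ∈ Icc (0:ℝ) 1, ∃ u : ℂ, ‖u‖ = 1 ∧ f u = b t) :
    ∃ f', Par f' s ∧ ∀ α ∈ Icc 0 Real.pi, f' (pol 1 α) = b (α / Real.pi) := by
  have hp := Real.pi_pos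
  obtain ⟨g, hg, hg1, hg2⟩ := hf.inv
  have hbs' : ∀ t ∈ Icc (0:ℝ) 1, b t ∈ s := by
    intro t ht
    obtain ⟨u, hu, h⟩ := hbs t ht
    rw [← h]; exact hf.mem hu.le
  have hn : ∀ t ∈ Icc (0:ℝ) 1, ‖g (b t)‖ = 1 := by
    intro t ht
    obtain ⟨u, hu, h⟩ := hbs t ht
    rw [← h, hg1 u (mem_DD.2 hu.le), hu]
  obtain ⟨θ, hθ, hθ'⟩ := lift_arc (c := fun t => g (b t)) (hg.comp hb hbs') hn
  have hi : InjOn (fun t => pol 1 (θ t)) (Icc 0 1) := by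
    intro x hx y hy hxy
    simp only at hxy
    rw [← hθ' x hx, ← hθ' y hy] at hxy
    apply hbi hx hy
    rw [← (hg2 _ (hbs' x hx)).2, hxy, (hg2 _ (hbs' y hy)).2]
  have hdiv : ∀ α ∈ Icc 0 Real.pi, α / Real.pi ∈ Icc (0:ℝ) 1 := by
    intro α hα
    exact ⟨div_nonneg hα.1 hp.le, (div_le_one hp).2 hα.2⟩
  have hθi : InjOn θ (Icc 0 1) := fun x hx y hy h => hi hx hy (by simp only [h])
  rcases hθ.strictMonoOn_of_injOn_Icc' zero_le_one hθi with hm | hm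
  · obtain ⟨E, hE, hE'⟩ := normalize_mono hθ hm hi
    refine ⟨f ∘ E, hf.comp hE, ?_⟩
    intro α hα
    simp only [Function.comp]
    rw [hE' α hα, ← hθ' _ (hdiv α hα), (hg2 _ (hbs' _ (hdiv α hα))).2]
  · have hcj : ∀ α : ℝ, (starRingEnd ℂ) (pol 1 (- α)) = pol 1 α := by
      intro α
      simp only [pol, Complex.ofReal_one, one_mul, ← Complex.exp_conj]
      simp
    obtain ⟨E, hE, hE'⟩ := normalize_mono (θ := fun t => - θ t) hθ.neg
      (fun a ha b hb hab => neg_lt_neg (hm ha hb hab))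
      (by
        intro x hx y hy hxy
        apply hi hx hy
        simp only at *
        rw [← hcj, hxy, hcj])
    refine ⟨(f ∘ fun z => (starRingEnd ℂ) z) ∘ E, (hf.comp par_conj).comp hE, ?_⟩
    intro α hα
    simp only [Function.comp]
    rw [hE' α hα, hcj, ← hθ' _ (hdiv α hα), (hg2 _ (hbs' _ (hdiv α hα))).2]

end Plan

namespace Plan

open Filter Topology

lemma sq_im {w : ℂ} : w ∈ DD ↔ w.re ^ 2 + w.im ^ 2 ≤ 1 := by
  have := Complex.sq_norm_sub_sq_re w
  rw [mem_DD, (by linarith : w.re^2 + w.im ^2 = ‖w‖^2)]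
  constructor
  · intro h; nlinarith [norm_nonneg w]
  · intro h; nlinarith [norm_nonneg w]

/-- half-chord -/
def hc (w : ℂ) : ℝ := √(1 - w.re ^ 2)

lemma hc_nonneg (w : ℂ) : 0 ≤ hc w := Real.sqrt_nonneg _

lemma hc_sq {w : ℂ} (hw : w ∈ DD) : hc w ^ 2 = 1 - w.re ^ 2 := by
  rw [sq_im] at hw
  exact Real.sq_sqrt (by nlinarith [sq_nonneg w.im])

lemma im_le_hc {w : ℂ} (hw : w ∈ DD) : |w.im| ≤ hc w := by
  have h1 := hc_sq hw
  rw [sq_im] at hw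
  exact abs_le_of_sq_le_sq (by linarith) (hc_nonneg w)

def foldA (w : ℂ) : ℂ := ⟨w.re, hc w - 2 * |w.im|⟩

lemma continuous_foldA : Continuous foldA := by
  have : foldA = fun w => (w.re : ℂ) + ((hc w - 2 * |w.im| : ℝ) : ℂ) * Complex.I := by
    ext w
    apply Complex.ext <;> simp [foldA]
  rw [this]; unfold hc
  fun_prop

lemma foldA_mem {w : ℂ} (hw : w ∈ DD) : foldA w ∈ DD := by
  have h1 := hc_sq hw
  have h2 := im_le_hc hw
  rw [sq_im] at *
  have h3 := abs_nonneg w.im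
  simp only [foldA]
  nlinarith [hc_nonneg w]

lemma foldA_surj {z : ℂ} (hz : z ∈ DD) : ∃ w ∈ DD, 0 ≤ w.im ∧ foldA w = z ∧ foldA ((starRingEnd ℂ) w) = z := by
  have h1 := hc_sq hz
  have h2 := abs_le.1 (im_le_hc hz)
  have hh : 0 ≤ (hc z - z.im) / 2 := by linarith [h2.2]
  have e1 : foldA ⟨z.re, (hc z - z.im) / 2⟩ = z := by
    apply Complex.ext
    · simp [foldA]
    · simp only [foldA, abs_of_nonneg hh]; simp [hc]; ring
  refine ⟨⟨z.re, (hc z - z.im) / 2⟩, ?_, hh, e1, ?_⟩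
  · rw [sq_im] at *; simp only; nlinarith
  · conv_rhs => rw [← e1]
    simp [foldA, hc]

lemma foldA_inj {w w' : ℂ} (h : foldA w = foldA w') : w.re = w'.re ∧ |w.im| = |w'.im| := by
  have h1 : w.re = w'.re := by simpa [foldA] using congrArg Complex.re h
  have h2 := congrArg Complex.im h
  simp only [foldA, hc, h1] at h2
  exact ⟨h1, by linarith⟩

lemma foldA_real {w : ℂ} (hw : w ∈ DD) (h : w.im = 0) :
    ∃ α ∈ Icc 0 Real.pi, foldA w = pol 1 α := by
  have h3 := hc_nonneg w
  refine ⟨Real.arccos w.re, ⟨Real.arccos_nonneg _, Real.arccos_le_pi _⟩, ?_⟩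
  rw [sq_im] at hw
  have : |w.re| ≤ 1 := by rw [← sq_le_one_iff_abs_le_one]; nlinarith
  rw [abs_le] at this
  simp only [pol, Complex.ofReal_one, one_mul]
  rw [Complex.exp_mul_I]
  apply Complex.ext
  · simp [foldA, ← Complex.ofReal_cos, ← Complex.ofReal_sin, Real.cos_arccos this.1 this.2]
  · simp [foldA, ← Complex.ofReal_cos, ← Complex.ofReal_sin, Real.sin_arccos, h, hc]

lemma foldA_pol {w : ℂ} (hw : w ∈ DD) {α : ℝ} (hα : α ∈ Icc 0 Real.pi) (h : foldA w = pol 1 α) : w.im = 0 := by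
  have h1 := hc_sq hw
  have h2 : (foldA w).re ^ 2 + (foldA w).im ^ 2 = 1 := by
    rw [h]
    simp only [pol, Complex.ofReal_one, one_mul]
    rw [Complex.exp_mul_I]
    simp [← Complex.ofReal_cos, ← Complex.ofReal_sin]
  have h3 : 0 ≤ (foldA w).im := by
    rw [h]
    simp only [pol, Complex.ofReal_one, one_mul]
    rw [Complex.exp_mul_I]
    simp [← Complex.ofReal_cos, ← Complex.ofReal_sin]
    exact Real.sin_nonneg_of_mem_Icc hα
  simp only [foldA] at h2 h3
  have h4 := abs_nonneg w.im
  have : |w.im| = 0 := by nlinarith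
  exact abs_eq_zero.1 this

lemma not_mem_interior_left {Y : Type*} [TopologicalSpace Y] [Surf Y] {A B : Set Y}
    (hB : Dsk B) (hi : interior (A ∩ B) = ∅) {y : Y} (hy : y ∈ B) : y ∉ interior A := by
  intro h
  obtain ⟨f, hf⟩ := hB
  have h1 := hf.subset_closure hy
  rw [mem_closure_iff] at h1
  obtain ⟨z, hz1, hz2⟩ := h1 _ isOpen_interior h
  have : z ∈ interior (A ∩ B) := by
    rw [interior_inter]
    exact ⟨hz1, hf.ball_sub hz2⟩
  rw [hi] at this
  exact this

/-- The gluing lemma. -/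
theorem glue {Y : Type*} [TopologicalSpace Y] [T2Space Y] [Surf Y] {A B : Set Y}
    (hA : Dsk A) (hB : Dsk B) {b : ℝ → Y} (hb : ContinuousOn b (Icc 0 1)) (hbi : InjOn b (Icc 0 1))
    (hAB : A ∩ B = b '' Icc 0 1) (hi : interior (A ∩ B) = ∅) : Dsk (A ∪ B) := by
  classical
  have hp := Real.pi_pos
  have hbA : ∀ t ∈ Icc (0:ℝ) 1, b t ∈ A ∩ B := fun t ht => hAB ▸ ⟨t, ht, rfl⟩
  have hnA : ∀ t ∈ Icc (0:ℝ) 1, b t ∉ interior A := fun t ht => not_mem_interior_left hB hi (hbA t ht).2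
  have hnB : ∀ t ∈ Icc (0:ℝ) 1, b t ∉ interior B := fun t ht =>
    not_mem_interior_left hA (by rw [inter_comm]; exact hi) (hbA t ht).1
  obtain ⟨fA, hfA⟩ := hA
  obtain ⟨fB, hfB⟩ := hB
  obtain ⟨gA, hgA, eA⟩ := normalize hfA hb hbi (fun t ht => hfA.bdry (hbA t ht).1 (hnA t ht))
  obtain ⟨gB, hgB, eB⟩ := normalize hfB hb hbi (fun t ht => hfB.bdry (hbA t ht).2 (hnB t ht))
  have hmap : MapsTo foldA DD DD := fun w hw => foldA_mem hw
  have cA : ContinuousOn (gA ∘ foldA) DD := hgA.cont.comp continuous_foldA.continuousOn hmap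
  have cB : ContinuousOn (gB ∘ foldA) DD := hgB.cont.comp continuous_foldA.continuousOn hmap
  have agree : ∀ w ∈ DD, w.im = 0 → gA (foldA w) = gB (foldA w) := by
    intro w hw h0
    obtain ⟨α, hα, h⟩ := foldA_real hw h0
    rw [h, eA α hα, eB α hα]
  set F : ℂ → Y := fun w => if 0 ≤ w.im then gA (foldA w) else gB (foldA w) with hF
  have cross : ∀ w ∈ DD, ∀ w' ∈ DD, gA (foldA w) = gB (foldA w') → w.im = 0 ∧ w'.im = 0 := by
    intro w hw w' hw' h
    have h1 : gA (foldA w) ∈ A ∩ B := ⟨hgA.mem (mem_DD.1 (hmap hw)), h ▸ hgB.mem (mem_DD.1 (hmap hw'))⟩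
    rw [hAB] at h1
    obtain ⟨t, ht, htt⟩ := h1
    have hα : t * Real.pi ∈ Icc 0 Real.pi := ⟨mul_nonneg ht.1 hp.le, by nlinarith [ht.2]⟩
    have h2 := eA _ hα
    have h3 := eB _ hα
    have hd : t * Real.pi / Real.pi = t := by field_simp
    have hpol : pol 1 (t * Real.pi) ∈ DD := by rw [mem_DD, norm_pol zero_le_one]
    rw [hd, htt] at h2 h3
    rw [h] at h3
    exact ⟨foldA_pol hw hα (hgA.inj (hmap hw) hpol h2.symm),
      foldA_pol hw' hα (hgB.inj (hmap hw') hpol h3.symm)⟩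
  refine ⟨F, ?_, ?_, ?_⟩
  · have hU : DD = (DD ∩ {w : ℂ | 0 ≤ w.im}) ∪ (DD ∩ {w : ℂ | w.im ≤ 0}) := by
      ext w
      simp only [mem_union, mem_inter_iff, mem_ofPred_eq]
      have := le_total 0 w.im
      tauto
    rw [hU]
    have k1 : IsClosed (DD ∩ {w : ℂ | 0 ≤ w.im}) :=
      Metric.isClosed_closedBall.inter (isClosed_le continuous_const Complex.continuous_im)
    have k2 : IsClosed (DD ∩ {w : ℂ | w.im ≤ 0}) :=
      Metric.isClosed_closedBall.inter (isClosed_le Complex.continuous_im continuous_const)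
    refine ContinuousOn.union_of_isClosed ?_ ?_ k1 k2
    · refine (cA.mono inter_subset_left).congr ?_
      intro w hw
      have : 0 ≤ w.im := hw.2
      simp [hF, this]
    · refine (cB.mono inter_subset_left).congr ?_
      intro w hw
      have h1 : w.im ≤ 0 := hw.2
      by_cases h : 0 ≤ w.im
      · simp only [hF, h, if_true, Function.comp]
        exact agree w hw.1 (le_antisymm h1 h)
      · simp [hF, h]
  · intro w hw w' hw' h
    simp only [hF] at h
    by_cases h1 : 0 ≤ w.im <;> by_cases h2 : 0 ≤ w'.im
    · simp only [h1, h2, if_true] at h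
      have := foldA_inj (hgA.inj (hmap hw) (hmap hw') h)
      rw [abs_of_nonneg h1, abs_of_nonneg h2] at this
      exact Complex.ext this.1 this.2
    · simp only [h1, h2, if_true, if_false] at h
      exact (h2 (cross w hw w' hw' h).2.ge).elim
    · simp only [h1, h2, if_true, if_false] at h
      exact (h1 (cross w' hw' w hw h.symm).2.ge).elim
    · simp only [h1, h2, if_false] at h
      have := foldA_inj (hgB.inj (hmap hw) (hmap hw') h)
      rw [abs_of_neg (not_le.1 h1), abs_of_neg (not_le.1 h2)] at this
      exact Complex.ext this.1 (by linarith)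
  · apply Subset.antisymm
    · rintro _ ⟨w, hw, rfl⟩
      simp only [hF]
      split_ifs
      · exact Or.inl (hgA.mem (mem_DD.1 (hmap hw)))
      · exact Or.inr (hgB.mem (mem_DD.1 (hmap hw)))
    · rintro y (hy | hy)
      · rw [← hgA.img] at hy
        obtain ⟨z, hz, rfl⟩ := hy
        obtain ⟨w, hw, h0, h1, h2⟩ := foldA_surj hz
        exact ⟨w, hw, by simp [hF, h0, h1]⟩
      · rw [← hgB.img] at hy
        obtain ⟨z, hz, rfl⟩ := hy
        obtain ⟨w, hw, h0, h1, h2⟩ := foldA_surj hz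
        have hw' : (starRingEnd ℂ) w ∈ DD := by rw [mem_DD] at *; simpa using hw
        refine ⟨_, hw', ?_⟩
        by_cases h3 : 0 ≤ ((starRingEnd ℂ) w).im
        · simp only [hF, h3, if_true]
          rw [agree _ hw' (by simp at h3 ⊢; linarith), h2]
        · simp only [hF, h3, if_false, h2]

end Plan

namespace Plan

open Filter Topology

instance surfPlane : Surf (ℝ × ℝ) := ⟨fun y =>
  ⟨Complex.equivRealProdCLM.symm.toHomeomorph.toOpenPartialHomeomorph, by simp⟩⟩

instance factFin3 : Fact (Module.finrank ℝ (EuclideanSpace ℝ (Fin 3)) = 2 + 1) := ⟨by simp⟩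

/-- identification of the Euclidean plane with pairs of reals -/
def e2 : EuclideanSpace ℝ (Fin 2) ≃ₜ ℝ × ℝ :=
  (PiLp.homeomorph 2 (fun _ : Fin 2 => ℝ)).trans Homeomorph.finTwoArrow

/-- stereographic projection to the plane -/
def stereo (N : SpherePt) : OpenPartialHomeomorph SpherePt (ℝ × ℝ) :=
  (stereographic' 2 N).trans e2.toOpenPartialHomeomorph

lemma stereo_source (N : SpherePt) : (stereo N).source = {N}ᶜ := by
  simp [stereo]

instance surfSphere : Surf SpherePt := ⟨fun y =>
  ⟨(stereo (-y)).trans Complex.equivRealProdCLM.symm.toHomeomorph.toOpenPartialHomeomorph, by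
    simp only [OpenPartialHomeomorph.trans_source, Homeomorph.toOpenPartialHomeomorph_source, preimage_univ, inter_univ]
    rw [stereo_source]
    exact ne_neg_of_mem_unit_sphere ℝ y⟩⟩

lemma dsk_convexC {s : Set ℂ} (hs : Convex ℝ s) (hk : IsCompact s) (hi : (interior s).Nonempty) : Dsk s := by
  obtain ⟨h, _, h2, _⟩ := exists_homeomorph_image_interior_closure_frontier_eq_unitBall hs hi hk.isBounded
  rw [hk.isClosed.closure_eq] at h2
  refine ⟨h.symm, h.symm.continuous.continuousOn, h.symm.injective.injOn, ?_⟩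
  rw [DD, ← h2, ← image_comp]; simp

lemma dsk_convex {s : Set (ℝ × ℝ)} (hs : Convex ℝ s) (hk : IsCompact s) (hi : (interior s).Nonempty) : Dsk s := by
  have e := Complex.equivRealProdCLM
  have h1 : Dsk (e.symm '' s) := by
    refine dsk_convexC (hs.is_linear_image e.symm.toLinearMap.isLinear) (hk.image e.symm.continuous) ?_
    have := e.symm.toHomeomorph.image_interior s
    have h2 : interior (e.symm '' s) = e.symm '' interior s := this.symm
    rw [h2]; exact hi.image _
  have h2 := h1.map (φ := e) e.continuous.continuousOn e.injective.injOn
  rw [← image_comp] at h2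
  simpa using h2

lemma Par.homeo {Y : Type*} [TopologicalSpace Y] [T2Space Y] {f : ℂ → Y} {s : Set Y} (h : Par f s) :
    Nonempty (↥s ≃ₜ ↥DD) := by
  obtain ⟨g, hg, hg1, hg2⟩ := h.inv
  refine ⟨{ toFun := fun y => ⟨g y, (hg2 y y.2).1⟩, invFun := fun w => ⟨f w, h.mem (mem_DD.1 w.2)⟩,
            left_inv := fun y => Subtype.ext (hg2 y y.2).2,
            right_inv := fun w => Subtype.ext (hg1 w w.2),
            continuous_toFun := ?_, continuous_invFun := ?_ }⟩
  · exact (continuousOn_iff_continuous_domRestrict.1 hg).subtype_mk _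
  · exact (continuousOn_iff_continuous_domRestrict.1 h.cont).subtype_mk _

lemma dsk_of_homeo {Y : Type*} [TopologicalSpace Y] {s : Set Y} (h : ↥s ≃ₜ ↥DD) : Dsk s := by
  classical
  have p0 : (0:ℂ) ∈ DD := by simp
  refine ⟨fun w => if hw : w ∈ DD then (h.symm ⟨w, hw⟩ : Y) else (h.symm ⟨0, p0⟩ : Y), ?_, ?_, ?_⟩
  · rw [continuousOn_iff_continuous_domRestrict]
    have : DD.domRestrict (fun w => if hw : w ∈ DD then (h.symm ⟨w, hw⟩ : Y) else (h.symm ⟨0, p0⟩ : Y)) =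
        fun w => (h.symm w : Y) := by
      ext w
      simp only [domRestrict_apply, dif_pos w.2]
    rw [this]
    exact continuous_subtype_val.comp h.symm.continuous
  · intro a ha b hb hab
    simp only [dif_pos ha, dif_pos hb] at hab
    have := h.symm.injective (Subtype.ext hab)
    exact congrArg Subtype.val this
  · apply Subset.antisymm
    · rintro _ ⟨w, hw, rfl⟩
      simp only [dif_pos hw]
      exact (h.symm _).2
    · intro y hy
      refine ⟨h ⟨y, hy⟩, (h ⟨y, hy⟩).2, ?_⟩
      simp only [dif_pos (h ⟨y, hy⟩).2]
      simp

lemma dsk_closedBall : Dsk (Metric.closedBall (0 : Plane) 1) :=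
  dsk_convex (convex_closedBall _ _) (isCompact_closedBall _ _)
    ⟨0, by rw [interior_closedBall _ one_ne_zero]; simp⟩

lemma isClosedDisk_iff {s : Set SpherePt} : IsClosedDisk s ↔ Dsk s := by
  obtain ⟨k, hk⟩ := dsk_closedBall
  obtain ⟨φ⟩ := hk.homeo
  constructor
  · rintro ⟨h⟩
    exact dsk_of_homeo (h.trans φ)
  · rintro ⟨f, hf⟩
    obtain ⟨h⟩ := hf.homeo
    exact ⟨h.trans φ.symm⟩

lemma interior_image_empty {X Y : Type*} [TopologicalSpace X] [TopologicalSpace Y] [T2Space Y]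
    [Surf X] [Surf Y] {A : Set X} (hA : IsCompact A) {φ : X → Y} (hc : ContinuousOn φ A)
    (hi : InjOn φ A) (h0 : interior A = ∅) : interior (φ '' A) = ∅ := by
  rcases isEmpty_or_nonempty X with hX | hX
  · simp [Set.eq_empty_of_isEmpty A]
  by_contra hne
  obtain ⟨y, hy⟩ := nonempty_iff_ne_empty.2 hne
  obtain ⟨g, hg, hg1⟩ := factor hA hc continuousOn_id (fun a ha b hb hab => hi ha hb hab)
  obtain ⟨e, he⟩ := Surf.chart y
  set T : Set ℂ := e.target ∩ e.symm ⁻¹' (interior (φ '' A)) with hT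
  have hTo : IsOpen T := e.isOpen_inter_preimage_symm isOpen_interior
  have hmem : e y ∈ T := ⟨e.map_source he, by simpa [e.left_inv he] using hy⟩
  have hTs : ∀ x ∈ T, e.symm x ∈ φ '' A := fun x hx => interior_subset hx.2
  have := invDom (h := g ∘ e.symm) (hTo.mem_nhds hmem)
    (hg.comp (e.symm.continuousOn.mono inter_subset_left) hTs) (by
      intro x hx y hy hxy
      obtain ⟨a, ha, h1⟩ := hTs x hx
      obtain ⟨b, hb, h2⟩ := hTs y hy
      simp only [Function.comp, ← h1, ← h2, hg1 a ha, hg1 b hb, id] at hxy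
      rw [hxy, h2] at h1
      exact e.symm.injOn hx.1 hy.1 h1.symm)
  have h2 : (g ∘ e.symm) '' T ⊆ A := by
    rintro _ ⟨x, hx, rfl⟩
    obtain ⟨a, ha, h1⟩ := hTs x hx
    simp only [Function.comp, ← h1, hg1 a ha, id]; exact ha
  have h3 := mem_interior_iff_mem_nhds.2 (mem_of_superset this h2)
  rw [h0] at h3; exact h3

end Plan

namespace Plan

open Filter Topology

lemma cut {Y : Type*} [TopologicalSpace Y] {h : ℝ → Y} (hh : Continuous h) {K : Fin 4 → Set Y}
    (hK : ∀ k, IsClosed (K k)) (hd : ∀ j k, j ≠ k → K j ∩ K k = ∅) {a b : ℝ} (hab : a < b) {i j : Fin 4}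
    (hij : i ≠ j) (ha : h a ∈ K i) (hb : h b ∈ K j) (hi : InjOn h (Ioo a b)) {Z : Set Y} (hZ : Z.Finite) :
    ∃ c ∈ Ioo a b, h c ∉ Z ∧ ∀ k, h c ∉ K k := by
  set U : Set ℝ := Ioo a b ∩ h ⁻¹' (⋃ k, K k)ᶜ with hU
  have hUo : IsOpen U := isOpen_Ioo.inter ((isClosed_iUnion_of_finite hK).isOpen_compl.preimage hh)
  have hne : U.Nonempty := by
    by_contra hcon
    rw [not_nonempty_iff_eq_empty] at hcon
    have hsub : Ioo a b ⊆ h ⁻¹' (⋃ k, K k) := by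
      intro x hx
      by_contra hx'
      have : x ∈ U := ⟨hx, hx'⟩
      rw [hcon] at this; exact this
    have hsub2 : Icc a b ⊆ h ⁻¹' (⋃ k, K k) := by
      rw [← closure_Ioo hab.ne]
      exact closure_minimal hsub ((isClosed_iUnion_of_finite hK).preimage hh)
    have hcl := isPreconnected_closed_iff.1 (isPreconnected_Icc (a := a) (b := b)) (h ⁻¹' K i)
      (h ⁻¹' ⋃ k, ⋃ (_ : k ≠ i), K k) ((hK i).preimage hh)
      ((isClosed_iUnion_of_finite fun k => isClosed_iUnion_of_finite fun _ => hK k).preimage hh) (by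
        intro x hx
        obtain ⟨k, hk⟩ := mem_iUnion.1 (hsub2 hx)
        by_cases hki : k = i
        · left; rw [← hki]; exact hk
        · right; exact mem_iUnion.2 ⟨k, mem_iUnion.2 ⟨hki, hk⟩⟩)
      ⟨a, left_mem_Icc.2 hab.le, ha⟩
      ⟨b, right_mem_Icc.2 hab.le, mem_iUnion.2 ⟨j, mem_iUnion.2 ⟨hij.symm, hb⟩⟩⟩
    obtain ⟨x, -, hx1, hx2⟩ := hcl
    obtain ⟨k, hk⟩ := mem_iUnion.1 hx2
    obtain ⟨hki, hk⟩ := mem_iUnion.1 hk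
    have : h x ∈ K k ∩ K i := ⟨hk, hx1⟩
    rw [hd k i hki] at this; exact this
  have hinf : U.Infinite := infinite_of_mem_nhds hne.some (hUo.mem_nhds hne.some_mem)
  have hinf2 : (h '' U).Infinite := hinf.image (hi.mono inter_subset_left)
  obtain ⟨y, ⟨c, hc, rfl⟩, hy⟩ := hinf2.exists_notMem_finite hZ
  exact ⟨c, hc.1, hy, fun k hk => hc.2 (mem_iUnion.2 ⟨k, hk⟩)⟩

lemma extend_mono {g : ℝ → ℝ} {a b b' y : ℝ} (hc : ContinuousOn g (Icc a b)) (hm : StrictMonoOn g (Icc a b))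
    (hab : a ≤ b) (hb : b < b') (hy : g b < y) :
    ∃ g' : ℝ → ℝ, ContinuousOn g' (Icc a b') ∧ StrictMonoOn g' (Icc a b') ∧ (∀ x ≤ b, g' x = g x) ∧ g' b' = y := by
  set g' : ℝ → ℝ := fun x => if x ≤ b then g x else g b + (x - b) / (b' - b) * (y - g b) with hg
  have e1 : EqOn g' g (Icc a b) := by
    intro x hx; simp [hg, hx.2]
  have e2 : EqOn g' (fun x => g b + (x - b) / (b' - b) * (y - g b)) (Icc b b') := by
    intro x hx
    rcases eq_or_lt_of_le hx.1 with h | h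
    · rw [← h]; simp [hg]
    · simp [hg, not_le.2 h]
  have hun : Icc a b ∪ Icc b b' = Icc a b' := Icc_union_Icc_eq_Icc hab hb.le
  have h0 : 0 < b' - b := by linarith
  have h1 : 0 < y - g b := by linarith
  have m2 : StrictMonoOn g' (Icc b b') := by
    intro x hx z hz hxz
    rw [e2 hx, e2 hz]
    simp only
    gcongr
  refine ⟨g', ?_, ?_, ?_, ?_⟩
  · rw [← hun]
    refine ContinuousOn.union_of_isClosed (hc.congr e1) (ContinuousOn.congr (by fun_prop) e2) isClosed_Icc isClosed_Icc
  · rw [← hun]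
    exact (hm.congr e1.symm).union m2 (isGreatest_Icc hab) (isLeast_Icc hb.le)
  · intro x hx; simp [hg, hx]
  · rw [e2 (right_mem_Icc.2 hb.le)]; field_simp; ring

/-- sign patterns of the four quadrants -/
def sg1 : Fin 4 → ℝ := ![1, -1, -1, 1]
def sg2 : Fin 4 → ℝ := ![1, 1, -1, -1]

def Quad (k : Fin 4) : Set ℂ := {w | w ∈ DD ∧ 0 ≤ sg1 k * w.re ∧ 0 ≤ sg2 k * w.im}

lemma quad_convex (k : Fin 4) : Convex ℝ (Quad k) := by
  intro x hx y hy a b ha hb hab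
  refine ⟨convex_closedBall 0 1 hx.1 hy.1 ha hb hab, ?_, ?_⟩
  · have h1 := hx.2.1; have h2 := hy.2.1
    simp only [Complex.add_re, Complex.real_smul, Complex.mul_re, Complex.ofReal_re, Complex.ofReal_im, zero_mul, sub_zero]
    nlinarith [mul_nonneg ha h1, mul_nonneg hb h2]
  · have h1 := hx.2.2; have h2 := hy.2.2
    simp only [Complex.add_im, Complex.real_smul, Complex.mul_im, Complex.ofReal_re, Complex.ofReal_im, zero_mul, add_zero]
    nlinarith [mul_nonneg ha h1, mul_nonneg hb h2]

lemma quad_compact (k : Fin 4) : IsCompact (Quad k) := by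
  have c1 : Continuous (fun w : ℂ => sg1 k * w.re) := by fun_prop
  have c2 : Continuous (fun w : ℂ => sg2 k * w.im) := by fun_prop
  refine isCompact_DD.inter_right (t := {w : ℂ | 0 ≤ sg1 k * w.re ∧ 0 ≤ sg2 k * w.im}) ?_
  exact (isClosed_le continuous_const c1).inter (isClosed_le continuous_const c2)

lemma quad_interior (k : Fin 4) : (interior (Quad k)).Nonempty := by
  have c1 : Continuous (fun w : ℂ => sg1 k * w.re) := by fun_prop
  have c2 : Continuous (fun w : ℂ => sg2 k * w.im) := by fun_prop
  have ho : IsOpen {w : ℂ | w ∈ Metric.ball (0:ℂ) 1 ∧ 0 < sg1 k * w.re ∧ 0 < sg2 k * w.im} :=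
    Metric.isOpen_ball.inter ((isOpen_lt continuous_const c1).inter (isOpen_lt continuous_const c2))
  refine ⟨⟨sg1 k / 2, sg2 k / 2⟩, interior_mono ?_ (ho.subset_interior_iff.2 Subset.rfl ?_)⟩
  · intro w hw
    exact ⟨Metric.ball_subset_closedBall hw.1, hw.2.1.le, hw.2.2.le⟩
  · refine ⟨?_, ?_⟩
    · rw [mem_ball_zero_iff]
      have := Complex.sq_norm_sub_sq_re (⟨sg1 k / 2, sg2 k / 2⟩ : ℂ)
      have h1 : sg1 k ^ 2 = 1 := by fin_cases k <;> simp [sg1]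
      have h2 : sg2 k ^ 2 = 1 := by fin_cases k <;> simp [sg2]
      simp only at this
      nlinarith [norm_nonneg (⟨sg1 k / 2, sg2 k / 2⟩ : ℂ)]
    · fin_cases k <;> simp [sg1, sg2] <;> norm_num

lemma quad_dsk (k : Fin 4) : Dsk (Quad k) := dsk_convexC (quad_convex k) (quad_compact k) (quad_interior k)

lemma quad_cover {w : ℂ} (hw : w ∈ DD) : ∃ k, w ∈ Quad k := by
  rcases le_total 0 w.re with h1 | h1 <;> rcases le_total 0 w.im with h2 | h2
  · exact ⟨0, hw, by simpa [sg1], by simpa [sg2]⟩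
  · exact ⟨3, hw, by simpa [sg1], by simpa [sg2]⟩
  · exact ⟨1, hw, by simpa [sg1], by simpa [sg2]⟩
  · exact ⟨2, hw, by simpa [sg1], by simpa [sg2]⟩

lemma sg_ne {j k : Fin 4} (h : j ≠ k) : sg1 j = - sg1 k ∨ sg2 j = - sg2 k := by
  fin_cases j <;> fin_cases k <;> simp [sg1, sg2] at h ⊢

lemma sg1_ne (k : Fin 4) : sg1 k ≠ 0 := by fin_cases k <;> simp [sg1]
lemma sg2_ne (k : Fin 4) : sg2 k ≠ 0 := by fin_cases k <;> simp [sg2]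

lemma quad_inter {j k : Fin 4} (h : j ≠ k) : interior (Quad j ∩ Quad k) = ∅ := by
  have key : ∀ w ∈ Quad j ∩ Quad k, w.re = 0 ∨ w.im = 0 := by
    rintro w ⟨⟨_, h1, h2⟩, ⟨_, h3, h4⟩⟩
    rcases sg_ne h with hs | hs
    · left; rw [hs] at h1
      have : sg1 k * w.re = 0 := by linarith
      simpa [sg1_ne] using this
    · right; rw [hs] at h2
      have : sg2 k * w.im = 0 := by linarith
      simpa [sg2_ne] using this
  by_contra hne
  obtain ⟨w, hw⟩ := nonempty_iff_ne_empty.2 hne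
  -- push off the two axes
  have hc : ContinuousAt (fun t : ℝ => w + (t:ℂ) * (1 + Complex.I)) 0 := by fun_prop
  have hmem : interior (Quad j ∩ Quad k) ∈ 𝓝 (w + ((0:ℝ):ℂ) * (1 + Complex.I)) := by
    simpa using isOpen_interior.mem_nhds hw
  have hev := hc.preimage_mem_nhds hmem
  have hinf : ((fun t : ℝ => w + (t:ℂ) * (1 + Complex.I)) ⁻¹' interior (Quad j ∩ Quad k)).Infinite :=
    infinite_of_mem_nhds 0 hev
  obtain ⟨t, ht, ht'⟩ := hinf.exists_notMem_finite (Set.toFinite {-w.re, -w.im})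
  rcases key _ (interior_subset ht) with h1 | h1
  · apply ht'; left; simp at h1; linarith
  · apply ht'; right; simp at h1; simp; linarith

structure Sectors {Y : Type*} [TopologicalSpace Y] (D : Set Y) (K : Fin 4 → Set Y) (Z : Set Y) (S : Fin 4 → Set Y) : Prop where
  dsk : ∀ k, Dsk (S k)
  cover : ⋃ k, S k = D
  common : (⋂ k, S k).Nonempty
  K_sub : ∀ k, K k ⊆ S k
  K_disj : ∀ j k, j ≠ k → S j ∩ K k = ∅
  int : ∀ j k, j ≠ k → interior (S j ∩ S k) = ∅
  two : ∀ z ∈ D, z ∉ interior D → {k | z ∈ S k}.ncard ≤ 2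
  one : ∀ z ∈ D, z ∉ interior D → z ∈ Z → {k | z ∈ S k}.ncard ≤ 1

lemma conn_sign {Y : Type*} [TopologicalSpace Y] {K : Set Y} (hK : IsPreconnected K) {r : Y → ℝ}
    (hr : ContinuousOn r K) (h0 : ∀ y ∈ K, r y ≠ 0) {a : Y} (ha : a ∈ K) (hpos : 0 < r a) :
    ∀ y ∈ K, 0 < r y := by
  intro y hy
  by_contra hneg
  have : (0:ℝ) ∈ r '' K := (hK.image r hr).ordConnected.out ⟨y, hy, rfl⟩ ⟨a, ha, rfl⟩ ⟨not_lt.1 hneg, hpos.le⟩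
  obtain ⟨x, hx, hx0⟩ := this
  exact h0 x hx hx0

lemma sectors_of_par {Y : Type*} [TopologicalSpace Y] [T2Space Y] [Surf Y] {f : ℂ → Y} {D : Set Y} (hf : Par f D)
    {K : Fin 4 → Set Y} (hK : ∀ k, IsPreconnected (K k)) (hKD : ∀ k, K k ⊆ D \ interior D)
    {Z : Set Y} (hZ : ∀ w : ℂ, ‖w‖ = 1 → (w.re = 0 ∨ w.im = 0) → f w ∉ Z ∧ ∀ k, f w ∉ K k)
    (hx : ∀ k, ∃ w, ‖w‖ = 1 ∧ 0 < sg1 k * w.re ∧ 0 < sg2 k * w.im ∧ f w ∈ K k) :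
    ∃ S, Sectors D K Z S := by
  have hsub : ∀ k, Quad k ⊆ DD := fun k w hw => hw.1
  have hstrict : ∀ k, ∀ y ∈ K k, ∃ w, ‖w‖ = 1 ∧ 0 < sg1 k * w.re ∧ 0 < sg2 k * w.im ∧ f w = y := by
    intro k y hy
    obtain ⟨g, hg, hg1, hg2⟩ := hf.inv
    obtain ⟨w, hw1, hw2, hw3, hw4⟩ := hx k
    have hKs : K k ⊆ D := fun y hy => (hKD k hy).1
    have hbd : ∀ y ∈ K k, ‖g y‖ = 1 ∧ f (g y) = y := by
      intro y hy
      obtain ⟨u, hu, rfl⟩ := hf.bdry (hKD k hy).1 (hKD k hy).2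
      rw [hg1 u (mem_DD.2 hu.le)]; exact ⟨hu, rfl⟩
    have hgw : g (f w) = w := hg1 w (mem_DD.2 hw1.le)
    refine ⟨g y, (hbd y hy).1, ?_, ?_, (hbd y hy).2⟩
    · refine conn_sign (hK k) (r := fun y => sg1 k * (g y).re) ?_ ?_ hw4 (by simpa [hgw] using hw2) y hy
      · exact continuousOn_const.mul (Complex.continuous_re.comp_continuousOn (hg.mono hKs))
      · intro y hy h0
        simp only [mul_eq_zero, sg1_ne, false_or] at h0
        have := (hZ (g y) (hbd y hy).1 (Or.inl h0)).2 k
        rw [(hbd y hy).2] at this; exact this hy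
    · refine conn_sign (hK k) (r := fun y => sg2 k * (g y).im) ?_ ?_ hw4 (by simpa [hgw] using hw3) y hy
      · exact continuousOn_const.mul (Complex.continuous_im.comp_continuousOn (hg.mono hKs))
      · intro y hy h0
        simp only [mul_eq_zero, sg2_ne, false_or] at h0
        have := (hZ (g y) (hbd y hy).1 (Or.inr h0)).2 k
        rw [(hbd y hy).2] at this; exact this hy
  have hmemS : ∀ k, ∀ w ∈ DD, f w ∈ f '' Quad k → w ∈ Quad k := by
    rintro k w hw ⟨w', hw', h⟩
    rw [← hf.inj hw'.1 hw h]; exact hw'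
  have hsame : ∀ w : ℂ, w.re ≠ 0 → ∀ j k, w ∈ Quad j → w ∈ Quad k → sg1 j = sg1 k := by
    intro w hw j k hj hk
    have h1 := hj.2.1; have h2 := hk.2.1
    fin_cases j <;> fin_cases k <;> simp [sg1] at h1 h2 ⊢ <;>
      exact (hw (by linarith)).elim
  have hsame2 : ∀ w : ℂ, w.im ≠ 0 → ∀ j k, w ∈ Quad j → w ∈ Quad k → sg2 j = sg2 k := by
    intro w hw j k hj hk
    have h1 := hj.2.2; have h2 := hk.2.2
    fin_cases j <;> fin_cases k <;> simp [sg2] at h1 h2 ⊢ <;>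
      exact (hw (by linarith)).elim
  refine ⟨fun k => f '' Quad k, ?_, ?_, ?_, ?_, ?_, ?_, ?_, ?_⟩
  · exact fun k => (quad_dsk k).map (hf.cont.mono (hsub k)) (hf.inj.mono (hsub k))
  · rw [← image_iUnion, ← hf.img]
    congr 1
    apply Subset.antisymm
    · exact iUnion_subset hsub
    · intro w hw
      exact mem_iUnion.2 (quad_cover hw)
  · refine ⟨f 0, mem_iInter.2 fun k => ⟨0, ⟨by simp, by simp, by simp⟩, rfl⟩⟩
  · intro k y hy
    obtain ⟨w, hw1, hw2, hw3, hw4⟩ := hstrict k y hy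
    exact ⟨w, ⟨mem_DD.2 hw1.le, hw2.le, hw3.le⟩, hw4⟩
  · intro j k hjk
    rw [eq_empty_iff_forall_notMem]
    rintro y ⟨hy1, hy2⟩
    obtain ⟨w, hw1, hw2, hw3, rfl⟩ := hstrict k y hy2
    have := hmemS j w (mem_DD.2 hw1.le) hy1
    rcases sg_ne hjk with hs | hs
    · have h1 := this.2.1; rw [hs] at h1; linarith
    · have h1 := this.2.2; rw [hs] at h1; linarith
  · intro j k hjk
    rw [← hf.inj.image_inter (hsub j) (hsub k)]
    exact interior_image_empty ((quad_compact j).inter (quad_compact k))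
      (hf.cont.mono (inter_subset_left.trans (hsub j))) (hf.inj.mono (inter_subset_left.trans (hsub j))) (quad_inter hjk)
  · intro z hz hz'
    obtain ⟨u, hu, rfl⟩ := hf.bdry hz hz'
    have hu' : u ∈ DD := mem_DD.2 hu.le
    by_cases h0 : u.re = 0
    · have h1 : u.im ≠ 0 := by
        intro h1
        have : u = 0 := Complex.ext h0 h1
        rw [this] at hu; simp at hu
      obtain ⟨k, hk⟩ := quad_cover hu'
      calc _ ≤ ({j | sg2 j = sg2 k} : Set (Fin 4)).ncard := ncard_le_ncard (fun j hj => hsame2 u h1 j k (hmemS j u hu' hj) hk) (toFinite _)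
        _ ≤ 2 := by
          fin_cases k
          · exact (ncard_le_ncard (t := {0, 1}) (by intro j hj; fin_cases j <;> simp [sg2] at hj ⊢ <;> norm_num at hj) (toFinite _)).trans ((ncard_insert_le _ _).trans (by simp))
          · exact (ncard_le_ncard (t := {0, 1}) (by intro j hj; fin_cases j <;> simp [sg2] at hj ⊢ <;> norm_num at hj) (toFinite _)).trans ((ncard_insert_le _ _).trans (by simp))
          · exact (ncard_le_ncard (t := {2, 3}) (by intro j hj; fin_cases j <;> simp [sg2] at hj ⊢ <;> norm_num at hj) (toFinite _)).trans ((ncard_insert_le _ _).trans (by simp))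
          · exact (ncard_le_ncard (t := {2, 3}) (by intro j hj; fin_cases j <;> simp [sg2] at hj ⊢ <;> norm_num at hj) (toFinite _)).trans ((ncard_insert_le _ _).trans (by simp))
    · obtain ⟨k, hk⟩ := quad_cover hu'
      calc _ ≤ ({j | sg1 j = sg1 k} : Set (Fin 4)).ncard := ncard_le_ncard (fun j hj => hsame u h0 j k (hmemS j u hu' hj) hk) (toFinite _)
        _ ≤ 2 := by
          fin_cases k
          · exact (ncard_le_ncard (t := {0, 3}) (by intro j hj; fin_cases j <;> simp [sg1] at hj ⊢ <;> norm_num at hj) (toFinite _)).trans ((ncard_insert_le _ _).trans (by simp))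
          · exact (ncard_le_ncard (t := {1, 2}) (by intro j hj; fin_cases j <;> simp [sg1] at hj ⊢ <;> norm_num at hj) (toFinite _)).trans ((ncard_insert_le _ _).trans (by simp))
          · exact (ncard_le_ncard (t := {1, 2}) (by intro j hj; fin_cases j <;> simp [sg1] at hj ⊢ <;> norm_num at hj) (toFinite _)).trans ((ncard_insert_le _ _).trans (by simp))
          · exact (ncard_le_ncard (t := {0, 3}) (by intro j hj; fin_cases j <;> simp [sg1] at hj ⊢ <;> norm_num at hj) (toFinite _)).trans ((ncard_insert_le _ _).trans (by simp))
  · intro z hz hz' hzZ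
    obtain ⟨u, hu, rfl⟩ := hf.bdry hz hz'
    have hu' : u ∈ DD := mem_DD.2 hu.le
    have h0 : u.re ≠ 0 := fun h => (hZ u hu (Or.inl h)).1 hzZ
    have h1 : u.im ≠ 0 := fun h => (hZ u hu (Or.inr h)).1 hzZ
    rw [ncard_le_one (toFinite _)]
    intro j hj k hk
    have e1 := hsame u h0 j k (hmemS j u hu' hj) (hmemS k u hu' hk)
    have e2 := hsame2 u h1 j k (hmemS j u hu' hj) (hmemS k u hu' hk)
    by_contra hne
    rcases sg_ne hne with h | h
    · exact sg1_ne k (by linarith)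
    · exact sg2_ne k (by linarith)

end Plan

namespace Plan

open Filter Topology

lemma pol_one_re (α : ℝ) : (pol 1 α).re = Real.cos α := by
  simp [pol, Complex.exp_ofReal_mul_I_re]

lemma pol_one_im (α : ℝ) : (pol 1 α).im = Real.sin α := by
  simp [pol, Complex.exp_ofReal_mul_I_im]

lemma axis_pt {w : ℂ} (hw : ‖w‖ = 1) (h : w.re = 0 ∨ w.im = 0) :
    w = pol 1 0 ∨ w = pol 1 (Real.pi / 2) ∨ w = pol 1 Real.pi ∨ w = pol 1 (3 * (Real.pi / 2)) := by
  have h1 := Complex.sq_norm_sub_sq_re w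
  rw [hw] at h1
  have c3 : Real.cos (3 * (Real.pi / 2)) = 0 := by
    rw [show 3 * (Real.pi / 2) = Real.pi / 2 + Real.pi by ring, Real.cos_add_pi]; simp
  have s3 : Real.sin (3 * (Real.pi / 2)) = -1 := by
    rw [show 3 * (Real.pi / 2) = Real.pi / 2 + Real.pi by ring, Real.sin_add_pi]; simp
  simp only [Complex.ext_iff, pol_one_re, pol_one_im, c3, s3, Real.cos_zero, Real.sin_zero, Real.cos_pi, Real.sin_pi,
    Real.cos_pi_div_two, Real.sin_pi_div_two]
  rcases h with h | h
  · rw [h] at h1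
    have : (w.im - 1) * (w.im + 1) = 0 := by linarith
    rcases mul_eq_zero.1 this with h2 | h2
    · right; left; exact ⟨h, by linarith⟩
    · right; right; right; exact ⟨h, by linarith⟩
  · rw [h] at h1
    have : (w.re - 1) * (w.re + 1) = 0 := by linarith
    rcases mul_eq_zero.1 this with h2 | h2
    · left; exact ⟨by linarith, h⟩
    · right; right; left; exact ⟨by linarith, h⟩

lemma sectors_sorted {Y : Type*} [TopologicalSpace Y] [T2Space Y] [Surf Y] {f : ℂ → Y} {D : Set Y} (hf : Par f D)
    {K : Fin 4 → Set Y} (hK : ∀ k, IsPreconnected (K k)) (hKc : ∀ k, IsClosed (K k))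
    (hKD : ∀ k, K k ⊆ D \ interior D)
    (hd : ∀ j k, j ≠ k → K j ∩ K k = ∅) {Z : Set Y} (hZ : Z.Finite) {θ : Fin 4 → ℝ} (hm : StrictMono θ)
    (hθ : ∀ k, f (pol 1 (θ k)) ∈ K k) (hlt : θ 3 < θ 0 + 2 * Real.pi) : ∃ S, Sectors D K Z S := by
  have hpp := Real.pi_pos
  have h01 : θ 0 < θ 1 := hm (by decide)
  have h12 : θ 1 < θ 2 := hm (by decide)
  have h23 : θ 2 < θ 3 := hm (by decide)
  have hh : Continuous (fun α : ℝ => f (pol 1 α)) := by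
    have hc : Continuous (fun α : ℝ => pol 1 α) := continuous_pol.comp (continuous_const.prodMk continuous_id)
    exact hf.cont.comp_continuous hc (fun α => mem_DD.2 (norm_pol zero_le_one α).le)
  have hinj : ∀ a b : ℝ, b ≤ a + 2 * Real.pi → InjOn (fun α : ℝ => f (pol 1 α)) (Ioo a b) := by
    intro a b hab x hx y hy hxy
    have h1 := hf.inj (mem_DD.2 (norm_pol zero_le_one x).le) (mem_DD.2 (norm_pol zero_le_one y).le) hxy
    simp only [pol, Complex.ofReal_one, one_mul] at h1
    rcases exp_eq_near (c := a) ⟨hx.1.le, by linarith [hx.2]⟩ ⟨hy.1.le, by linarith [hy.2]⟩ h1 with h | h | h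
    · exact h
    · exact absurd h.1 hx.1.ne'
    · exact absurd h.1 hy.1.ne'
  have hper : ∀ α : ℝ, pol 1 (α + 2 * Real.pi) = pol 1 α := by
    intro α; simp only [pol]; rw [exp_per]
  obtain ⟨c0, hc0, z0, k0⟩ := cut hh hKc hd h01 (by decide : (0 : Fin 4) ≠ 1) (hθ 0) (hθ 1) (hinj _ _ (by linarith)) hZ
  obtain ⟨c1, hc1, z1, k1⟩ := cut hh hKc hd h12 (by decide : (1 : Fin 4) ≠ 2) (hθ 1) (hθ 2) (hinj _ _ (by linarith)) hZ
  obtain ⟨c2, hc2, z2, k2⟩ := cut hh hKc hd h23 (by decide : (2 : Fin 4) ≠ 3) (hθ 2) (hθ 3) (hinj _ _ (by linarith)) hZ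
  obtain ⟨c3, hc3, z3, k3⟩ := cut hh hKc hd hlt (by decide : (3 : Fin 4) ≠ 0) (hθ 3) (by simp only [hper]; exact hθ 0) (hinj _ _ (by linarith)) hZ
  set q : ℝ := Real.pi / 2 with hq
  have hq0 : 0 < q := by positivity
  have hp2 : Real.pi = q + q := by rw [hq]; ring
  obtain ⟨g1, cg1, mg1, eg1, vg1⟩ := extend_mono (g := fun _ => c3 - 2 * Real.pi) (a := 0) (b := 0) (b' := q) (y := c0)
    continuousOn_const (by intro x hx y hy hxy; simp at hx hy; linarith) le_rfl hq0 (by linarith [hc3.2, hc0.1])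
  obtain ⟨g2, cg2, mg2, eg2, vg2⟩ := extend_mono (b' := q + q) (y := c1) cg1 mg1 hq0.le (by linarith) (by rw [vg1]; linarith [hc0.2, hc1.1])
  obtain ⟨g3, cg3, mg3, eg3, vg3⟩ := extend_mono (b' := 3 * q) (y := c2) cg2 mg2 (by linarith) (by linarith) (by rw [vg2]; linarith [hc1.2, hc2.1])
  obtain ⟨g, cg, mg, eg, vg⟩ := extend_mono (b' := 2 * Real.pi) (y := c3) cg3 mg3 (by linarith) (by linarith) (by rw [vg3]; linarith [hc2.2, hc3.1])
  have v0 : g 0 = c3 - 2 * Real.pi := by rw [eg 0 (by linarith), eg3 0 (by linarith), eg2 0 (by linarith), eg1 0 le_rfl]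
  have v1 : g q = c0 := by rw [eg q (by linarith), eg3 q (by linarith), eg2 q le_rfl, vg1]
  have v2 : g (q + q) = c1 := by rw [eg _ (by linarith), eg3 _ le_rfl, vg2]
  have v3 : g (3 * q) = c2 := by rw [eg _ le_rfl, vg3]
  obtain ⟨E, hE, hE'⟩ := angular cg mg (by rw [vg, v0]; ring)
  have hfE := hf.comp hE
  have i1 : (1:ℝ) ∈ Icc (0:ℝ) 1 := by simp
  refine sectors_of_par hfE hK hKD ?_ ?_
  · intro w hw hw'
    simp only [Function.comp]
    rcases axis_pt hw hw' with rfl | rfl | rfl | rfl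
    · rw [hE' 1 i1 0 ⟨le_rfl, by linarith⟩, v0, ← hper]; simp only [sub_add_cancel]; exact ⟨z3, k3⟩
    · rw [hE' 1 i1 _ ⟨hq0.le, by linarith⟩, v1]; exact ⟨z0, k0⟩
    · rw [hE' 1 i1 _ ⟨hpp.le, by linarith⟩, hp2, v2]; exact ⟨z1, k1⟩
    · rw [hE' 1 i1 _ ⟨by linarith, by linarith⟩, v3]; exact ⟨z2, k2⟩
  · -- representatives
    have rep : ∀ a b t : ℝ, 0 ≤ a → a ≤ b → b ≤ 2 * Real.pi → t ∈ Ioo (g a) (g b) → ∃ α ∈ Ioo a b, g α = t := by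
      intro a b t ha hab hb ht
      have := intermediate_value_Ioo hab (cg.mono (Icc_subset_Icc ha hb)) ht
      obtain ⟨α, hα, h⟩ := this
      exact ⟨α, hα, h⟩
    intro k
    fin_cases k
    · obtain ⟨α, hα, h⟩ := rep 0 q (θ 0) le_rfl hq0.le (by linarith) ⟨by rw [v0]; linarith [hc3.2], by rw [v1]; exact hc0.1⟩
      refine ⟨pol 1 α, norm_pol zero_le_one _, ?_, ?_, ?_⟩
      · simp only [sg1, pol_one_re]; simp; exact Real.cos_pos_of_mem_Ioo ⟨by linarith [hα.1], by linarith [hα.2]⟩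
      · simp only [sg2, pol_one_im]; simp; exact Real.sin_pos_of_pos_of_lt_pi hα.1 (by linarith [hα.2])
      · simp only [Function.comp]; rw [hE' 1 i1 α ⟨by linarith [hα.1], by linarith [hα.2]⟩, h]; exact hθ 0
    · obtain ⟨α, hα, h⟩ := rep q (q + q) (θ 1) hq0.le (by linarith) (by linarith) ⟨by rw [v1]; exact hc0.2, by rw [v2]; exact hc1.1⟩
      refine ⟨pol 1 α, norm_pol zero_le_one _, ?_, ?_, ?_⟩
      · simp only [sg1, pol_one_re]; simp; exact Real.cos_neg_of_pi_div_two_lt_of_lt (by linarith [hα.1]) (by linarith [hα.2])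
      · simp only [sg2, pol_one_im]; simp; exact Real.sin_pos_of_pos_of_lt_pi (by linarith [hα.1]) (by linarith [hα.2])
      · simp only [Function.comp]; rw [hE' 1 i1 α ⟨by linarith [hα.1], by linarith [hα.2]⟩, h]; exact hθ 1
    · obtain ⟨α, hα, h⟩ := rep (q + q) (3 * q) (θ 2) (by linarith) (by linarith) (by linarith) ⟨by rw [v2]; exact hc1.2, by rw [v3]; exact hc2.1⟩
      refine ⟨pol 1 α, norm_pol zero_le_one _, ?_, ?_, ?_⟩
      · simp only [sg1, pol_one_re]; simp; exact Real.cos_neg_of_pi_div_two_lt_of_lt (by linarith [hα.1]) (by linarith [hα.2])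
      · simp only [sg2, pol_one_im]; simp
        rw [← Real.sin_sub_two_pi]
        exact Real.sin_neg_of_neg_of_neg_pi_lt (by linarith [hα.2]) (by linarith [hα.1])
      · simp only [Function.comp]; rw [hE' 1 i1 α ⟨by linarith [hα.1], by linarith [hα.2]⟩, h]; exact hθ 2
    · obtain ⟨α, hα, h⟩ := rep (3 * q) (2 * Real.pi) (θ 3) (by linarith) (by linarith) (by linarith) ⟨by rw [v3]; exact hc2.2, by rw [vg]; exact hc3.1⟩
      refine ⟨pol 1 α, norm_pol zero_le_one _, ?_, ?_, ?_⟩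
      · simp only [sg1, pol_one_re]; simp
        rw [← Real.cos_sub_two_pi]
        exact Real.cos_pos_of_mem_Ioo ⟨by linarith [hα.1], by linarith [hα.2]⟩
      · simp only [sg2, pol_one_im]; simp
        rw [← Real.sin_sub_two_pi]
        exact Real.sin_neg_of_neg_of_neg_pi_lt (by linarith [hα.2]) (by linarith [hα.1])
      · simp only [Function.comp]; rw [hE' 1 i1 α ⟨by linarith [hα.1], by linarith [hα.2]⟩, h]; exact hθ 3

lemma Sectors.reindex {Y : Type*} [TopologicalSpace Y] {D : Set Y} {K : Fin 4 → Set Y} {Z : Set Y} {S : Fin 4 → Set Y}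
    (σ : Equiv.Perm (Fin 4)) (h : Sectors D (K ∘ σ) Z S) : Sectors D K Z (S ∘ σ.symm) where
  dsk k := h.dsk _
  cover := by rw [← h.cover]; exact σ.symm.surjective.iUnion_comp S
  common := by
    have := h.common
    rw [← σ.symm.surjective.iInter_comp S] at this; exact this
  K_sub k := by simpa using h.K_sub (σ.symm k)
  K_disj j k hjk := by simpa using h.K_disj (σ.symm j) (σ.symm k) (by simpa using hjk)
  int j k hjk := h.int _ _ (by simpa using hjk)
  two z hz hz' := by
    have := h.two z hz hz'
    rw [← ncard_image_of_injective _ σ.injective] at this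
    refine (ncard_le_ncard ?_ (toFinite _)).trans this
    intro k hk
    exact ⟨σ.symm k, hk, by simp⟩
  one z hz hz' hZ := by
    have := h.one z hz hz' hZ
    rw [← ncard_image_of_injective _ σ.injective] at this
    refine (ncard_le_ncard ?_ (toFinite _)).trans this
    intro k hk
    exact ⟨σ.symm k, hk, by simp⟩

/-- The sector lemma. -/
theorem sectors {Y : Type*} [TopologicalSpace Y] [T2Space Y] [Surf Y] {D : Set Y} (hD : Dsk D)
    {K : Fin 4 → Set Y} (hK : ∀ k, IsPreconnected (K k)) (hKc : ∀ k, IsClosed (K k)) (hKn : ∀ k, (K k).Nonempty)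
    (hKD : ∀ k, K k ⊆ D \ interior D)
    (hd : ∀ j k, j ≠ k → K j ∩ K k = ∅) {Z : Set Y} (hZ : Z.Finite) : ∃ S, Sectors D K Z S := by
  obtain ⟨f, hf⟩ := hD
  have hth : ∀ k, ∃ t : ℝ, t ∈ Icc 0 (2 * Real.pi) ∧ f (pol 1 t) ∈ K k := by
    intro k
    obtain ⟨y, hy⟩ := hKn k
    obtain ⟨u, hu, rfl⟩ := hf.bdry (hKD k hy).1 (hKD k hy).2
    obtain ⟨β, hβ, h⟩ := exists_pol 0 u
    rw [hu] at h
    exact ⟨β, by simpa using hβ, by rw [← h]; exact hy⟩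
  choose θ hθI hθ using hth
  have hdis : ∀ j k, f (pol 1 (θ j)) = f (pol 1 (θ k)) → j = k := by
    intro j k h
    by_contra hne
    have : f (pol 1 (θ j)) ∈ K j ∩ K k := ⟨hθ j, h ▸ hθ k⟩
    rw [hd j k hne] at this; exact this
  have hinj : Function.Injective θ := fun j k h => hdis j k (by rw [h])
  set σ := Tuple.sort θ with hσ
  have hmono : StrictMono (θ ∘ σ) :=
    (Tuple.monotone_sort θ).strictMono_of_injective (hinj.comp σ.injective)
  obtain ⟨S, hS⟩ := sectors_sorted (K := K ∘ σ) hf (fun k => hK _) (fun k => hKc _) (fun k => hKD _)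
    (fun j k hjk => hd _ _ (by simpa using hjk)) hZ hmono (fun k => hθ _) (by
      refine lt_of_le_of_ne (by have := (hθI (σ 3)).2; have := (hθI (σ 0)).1; simp only [Function.comp]; linarith) ?_
      intro h
      have h2 : (3 : Fin 4) = 0 := by
        apply σ.injective
        apply hdis
        have h3 : θ (σ 3) = θ (σ 0) + 2 * Real.pi := h
        rw [h3]
        simp only [pol]; rw [exp_per]
      exact absurd h2 (by decide))
  exact ⟨_, hS.reindex σ⟩

end Plan

namespace Plan

open Filter Topology

lemma pol_mul (u : ℂ) (hu : ‖u‖ = 1) (θ : ℝ) : ‖u * pol 1 θ‖ = 1 := by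
  rw [norm_mul, hu, norm_pol zero_le_one, one_mul]

lemma continuous_pol1 : Continuous (fun α : ℝ => pol 1 α) :=
  continuous_pol.comp (continuous_const.prodMk continuous_id)

lemma pol1_inj {a b : ℝ} (ha : |a| < Real.pi) (hb : |b| < Real.pi) (h : pol 1 a = pol 1 b) : a = b := by
  simp only [pol, Complex.ofReal_one, one_mul] at h
  rw [abs_lt] at ha hb
  rcases exp_eq_near (c := -Real.pi) ⟨ha.1.le, by linarith⟩ ⟨hb.1.le, by linarith⟩ h with h | h | h
  · exact h
  · linarith [h.1]
  · linarith [h.1]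

/-- Two discs sharing a boundary arc around `p` cover a neighbourhood of `p`. -/
lemma two_cover {Y : Type*} [TopologicalSpace Y] [T2Space Y] [Surf Y] {A D : Set Y} {f g : ℂ → Y}
    (hf : Par f A) (hg : Par g D) (hi : interior (A ∩ D) = ∅) {u0 : ℂ} (hu0 : ‖u0‖ = 1) {ε : ℝ} (hε : 0 < ε)
    (hεp : ε ≤ Real.pi) (h : ∀ θ : ℝ, |θ| < ε → f (u0 * pol 1 θ) ∈ D) : A ∪ D ∈ 𝓝 (f u0) := by
  obtain ⟨k, hk, hk1, hk2⟩ := hg.inv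
  set τ : ℝ → ℂ := fun θ => k (f (u0 * pol 1 θ)) with hτ
  have hin : ∀ θ, f (u0 * pol 1 θ) ∈ A := fun θ => hf.mem (pol_mul u0 hu0 θ).le
  have hτ1 : ∀ θ, |θ| < ε → ‖τ θ‖ = 1 ∧ g (τ θ) = f (u0 * pol 1 θ) := by
    intro θ hθ
    obtain ⟨u, hu, h2⟩ := hg.bdry (h θ hθ) (not_mem_interior_left ⟨f, hf⟩ (by rw [inter_comm]; exact hi) (hin θ))
    simp only [hτ]
    rw [← h2, hk1 u (mem_DD.2 hu.le)]
    exact ⟨hu, rfl⟩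
  have hτc : ContinuousOn τ (Ioo (-ε) ε) := by
    refine hk.comp (hf.cont.comp (continuous_const.mul continuous_pol1).continuousOn ?_) ?_
    · intro θ _; exact mem_DD.2 (pol_mul u0 hu0 θ).le
    · intro θ hθ; exact h θ (abs_lt.2 hθ)
  set T : Set ℂ := {w | w.re ∈ Ioo (-1:ℝ) 1 ∧ w.im ∈ Ioo (-ε) ε} with hT
  have hTo : IsOpen T := (isOpen_Ioo.preimage Complex.continuous_re).inter (isOpen_Ioo.preimage Complex.continuous_im)
  set P : ℂ → ℂ := fun w => ((1 - w.re : ℝ) : ℂ) * (u0 * pol 1 w.im) with hP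
  set Q : ℂ → ℂ := fun w => ((1 + w.re : ℝ) : ℂ) * τ w.im with hQ
  have nP : ∀ w : ℂ, w ∈ T → ‖P w‖ = 1 - w.re := by
    intro w hw
    simp only [hP, norm_mul (((1 - w.re : ℝ) : ℂ)), pol_mul u0 hu0]
    simp [-Complex.ofReal_sub, abs_of_nonneg (by linarith [hw.1.2] : 0 ≤ 1 - w.re)]
  have nQ : ∀ w : ℂ, w ∈ T → ‖Q w‖ = 1 + w.re := by
    intro w hw
    simp only [hQ, norm_mul, (hτ1 w.im (abs_lt.2 hw.2)).1]
    simp [-Complex.ofReal_add, abs_of_nonneg (by linarith [hw.1.1] : 0 ≤ 1 + w.re)]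
  classical
  set H : ℂ → Y := fun w => if 0 ≤ w.re then f (P w) else g (Q w) with hH
  have agree : ∀ w ∈ T, w.re = 0 → f (P w) = g (Q w) := by
    intro w hw h0
    simp only [hP, hQ, h0]
    simp [(hτ1 w.im (abs_lt.2 hw.2)).2]
  have hPc : Continuous P := by
    have := continuous_pol1.comp Complex.continuous_im
    simp only [hP]
    exact (by fun_prop : Continuous fun w : ℂ => ((1 - w.re : ℝ) : ℂ)).mul (continuous_const.mul this)
  have hQc : ContinuousOn Q T := by
    have := hτc.comp Complex.continuous_im.continuousOn (fun w hw => hw.2 : MapsTo Complex.im T _)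
    exact (by fun_prop : Continuous fun w : ℂ => ((1 + w.re : ℝ) : ℂ)).continuousOn.mul this
  have hHc : ContinuousOn H T := by
    have k1 : ContinuousOn H (T ∩ {w : ℂ | 0 ≤ w.re}) := by
      refine ContinuousOn.congr (f := fun w => f (P w)) ?_ ?_
      · refine hf.cont.comp hPc.continuousOn ?_
        intro w hw
        rw [mem_DD, nP w hw.1]
        have : 0 ≤ w.re := hw.2
        linarith
      · intro w hw
        have : 0 ≤ w.re := hw.2
        simp [hH, this]
    have k2 : ContinuousOn H (T ∩ {w : ℂ | w.re ≤ 0}) := by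
      refine ContinuousOn.congr (f := fun w => g (Q w)) ?_ ?_
      · refine hg.cont.comp (hQc.mono inter_subset_left) ?_
        intro w hw
        rw [mem_DD, nQ w hw.1]
        have : w.re ≤ 0 := hw.2
        linarith
      · intro w hw
        have h1 : w.re ≤ 0 := hw.2
        by_cases h2 : 0 ≤ w.re
        · simp only [hH, h2, if_true]; exact agree w hw.1 (le_antisymm h1 h2)
        · simp [hH, h2]
    intro w hw
    have hU : T = (T ∩ {w : ℂ | 0 ≤ w.re}) ∪ (T ∩ {w : ℂ | w.re ≤ 0}) := by
      ext w
      simp only [mem_union, mem_inter_iff, mem_ofPred_eq]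
      have := le_total 0 w.re
      tauto
    have c1 : IsClosed {w : ℂ | 0 ≤ w.re} := isClosed_le continuous_const Complex.continuous_re
    have c2 : IsClosed {w : ℂ | w.re ≤ 0} := isClosed_le Complex.continuous_re continuous_const
    have key : ∀ S : Set ℂ, IsClosed S → ContinuousOn H (T ∩ S) → ContinuousWithinAt H (T ∩ S) w := by
      intro S hS hc
      by_cases hwS : w ∈ S
      · exact hc w ⟨hw, hwS⟩
      · apply continuousWithinAt_of_notMem_closure
        intro hcl
        exact hwS (hS.closure_eq ▸ closure_mono inter_subset_right hcl)
    rw [hU]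
    exact (key _ c1 k1).union (key _ c2 k2)
  have oA : ∀ w : ℂ, ‖w‖ < 1 → f w ∉ D := by
    intro w hw hD
    exact not_mem_interior_left ⟨g, hg⟩ hi hD (hf.ball_sub ⟨w, by simpa using hw, rfl⟩)
  have oD : ∀ w : ℂ, ‖w‖ < 1 → g w ∉ A := by
    intro w hw hD
    exact not_mem_interior_left ⟨f, hf⟩ (by rw [inter_comm]; exact hi) hD (hg.ball_sub ⟨w, by simpa using hw, rfl⟩)
  have hHi : InjOn H T := by
    intro w hw w' hw' hww
    simp only [hH] at hww
    have bw : |w.im| < ε := abs_lt.2 hw.2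
    have bw' : |w'.im| < ε := abs_lt.2 hw'.2
    by_cases h1 : 0 ≤ w.re <;> by_cases h2 : 0 ≤ w'.re
    · simp only [h1, h2, if_true] at hww
      have e := hf.inj (mem_DD.2 (by rw [nP w hw]; linarith)) (mem_DD.2 (by rw [nP w' hw']; linarith)) hww
      have e1 : w.re = w'.re := by
        have := congrArg norm e
        rw [nP w hw, nP w' hw'] at this; linarith
      simp only [hP, e1] at e
      have h3 : (((1 - w'.re : ℝ) : ℂ)) ≠ 0 := by
        have : 1 - w'.re ≠ 0 := by linarith [hw'.1.2]
        exact_mod_cast this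
      have h4 : u0 ≠ 0 := by rintro rfl; simp at hu0
      have e2 := mul_left_cancel₀ h4 (mul_left_cancel₀ h3 e)
      exact Complex.ext e1 (pol1_inj (by linarith) (by linarith) e2)
    · simp only [h1, h2, if_true, if_false] at hww
      exfalso
      have h3 := oD (Q w') (by rw [nQ w' hw']; linarith)
      rw [← hww] at h3
      exact h3 (hf.mem (by rw [nP w hw]; linarith))
    · simp only [h1, h2, if_true, if_false] at hww
      exfalso
      have h3 := oD (Q w) (by rw [nQ w hw]; linarith)
      rw [hww] at h3
      exact h3 (hf.mem (by rw [nP w' hw']; linarith))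
    · simp only [h1, h2, if_false] at hww
      push Not at h1 h2
      have e := hg.inj (mem_DD.2 (by rw [nQ w hw]; linarith)) (mem_DD.2 (by rw [nQ w' hw']; linarith)) hww
      have e1 : w.re = w'.re := by
        have := congrArg norm e
        rw [nQ w hw, nQ w' hw'] at this; linarith
      simp only [hQ, e1] at e
      have h3 : (((1 + w'.re : ℝ) : ℂ)) ≠ 0 := by
        have : 1 + w'.re ≠ 0 := by linarith [hw'.1.1]
        exact_mod_cast this
      have e2 := mul_left_cancel₀ h3 e
      have e3 : f (u0 * pol 1 w.im) = f (u0 * pol 1 w'.im) := by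
        rw [← (hτ1 _ bw).2, ← (hτ1 _ bw').2, e2]
      have h4 : u0 ≠ 0 := by rintro rfl; simp at hu0
      have e4 := mul_left_cancel₀ h4 (hf.inj (mem_DD.2 (pol_mul u0 hu0 _).le) (mem_DD.2 (pol_mul u0 hu0 _).le) e3)
      exact Complex.ext e1 (pol1_inj (by linarith) (by linarith) e4)
  have h0T : (0:ℂ) ∈ T := by simp [hT, hε]
  have := invDom (hTo.mem_nhds h0T) hHc hHi
  have hH0 : H 0 = f u0 := by simp [hH, hP, pol]
  rw [hH0] at this
  refine mem_of_superset this ?_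
  rintro _ ⟨w, hw, rfl⟩
  simp only [hH]
  split_ifs with h1
  · left; exact hf.mem (by rw [nP w hw]; linarith)
  · right; exact hg.mem (by rw [nQ w hw]; linarith)

/-- the claim on triple points -/
lemma triple {Y C : Type*} [TopologicalSpace Y] [T2Space Y] [Surf Y] [Finite C] {R : C → Set Y}
    (hR : ∀ c, Dsk (R c)) (hd : ∀ c d, c ≠ d → interior (R c ∩ R d) = ∅) (hcov : ⋃ c, R c = univ)
    (h4 : ∀ p, {c | p ∈ R c}.ncard ≤ 4) {p : Y} {a b c : C} (hab : a ≠ b) (hac : a ≠ c) (hbc : b ≠ c)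
    (ha : p ∈ R a) (hb : p ∈ R b) (hc : p ∈ R c) (fb : (R a ∩ R b).Finite) (fc : (R a ∩ R c).Finite) : False := by
  have hcl : ∀ c, IsClosed (R c) := fun c => (hR c).compact.isClosed
  obtain ⟨f, hf⟩ := hR a
  obtain ⟨u0, hu0, rfl⟩ := hf.bdry ha (not_mem_interior_left (hR b) (hd a b hab) hb)
  set γ : ℝ → Y := fun θ => f (u0 * pol 1 θ) with hγ
  have hγc : Continuous γ := hf.cont.comp_continuous (continuous_const.mul continuous_pol1)
    (fun θ => mem_DD.2 (pol_mul u0 hu0 θ).le)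
  have hγ0 : γ 0 = f u0 := by simp [hγ, pol]
  have hu0' : u0 ≠ 0 := by rintro rfl; simp at hu0
  have hγi : InjOn γ (Ioo (-Real.pi) Real.pi) := by
    intro x hx y hy hxy
    have := mul_left_cancel₀ hu0' (hf.inj (mem_DD.2 (pol_mul u0 hu0 _).le) (mem_DD.2 (pol_mul u0 hu0 _).le) hxy)
    exact pol1_inj (abs_lt.2 hx) (abs_lt.2 hy) this
  -- every boundary point is in another region
  have other : ∀ θ, ∃ d, d ≠ a ∧ γ θ ∈ R d := by
    intro θ
    by_contra hcon
    push Not at hcon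
    have hn : γ θ ∉ interior (R a) := hf.sphere (pol_mul u0 hu0 θ)
    apply hn
    have ho : IsOpen (⋃ d : {d // d ≠ a}, R d)ᶜ := (isClosed_iUnion_of_finite fun d => hcl _).isOpen_compl
    refine mem_interior.2 ⟨_, ?_, ho, ?_⟩
    · intro y hy
      have : y ∈ ⋃ c, R c := by rw [hcov]; trivial
      obtain ⟨d, hd'⟩ := mem_iUnion.1 this
      by_cases hda : d = a
      · rw [← hda]; exact hd'
      · exact (hy (mem_iUnion.2 ⟨⟨d, hda⟩, hd'⟩)).elim
    · intro hy
      obtain ⟨⟨d, hda⟩, hd'⟩ := mem_iUnion.1 hy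
      exact hcon d hda hd'
  have ev1 : ∀ᶠ θ in 𝓝 (0:ℝ), ∀ d, f u0 ∉ R d → γ θ ∉ R d := by
    rw [eventually_all]
    intro d
    by_cases h : f u0 ∈ R d
    · simp [h]
    · have : (R d)ᶜ ∈ 𝓝 (γ 0) := by rw [hγ0]; exact (hcl d).isOpen_compl.mem_nhds h
      filter_upwards [hγc.continuousAt.preimage_mem_nhds this] with θ hθ _
      exact hθ
  have ev2 : ∀ B : Set Y, B.Finite → ∀ᶠ θ in 𝓝 (0:ℝ), θ ≠ 0 → γ θ ∉ B := by
    intro B hB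
    have hfin : (Ioo (-Real.pi) Real.pi ∩ γ ⁻¹' B).Finite := by
      refine Finite.of_finite_image (hB.subset ?_) (hγi.mono inter_subset_left)
      rintro _ ⟨x, hx, rfl⟩; exact hx.2
    have hc1 : ((Ioo (-Real.pi) Real.pi ∩ γ ⁻¹' B) \ {0})ᶜ ∈ 𝓝 (0:ℝ) :=
      (hfin.subset sdiff_subset).isClosed.isOpen_compl.mem_nhds (by simp)
    filter_upwards [hc1, Ioo_mem_nhds (neg_lt_zero.2 Real.pi_pos) Real.pi_pos] with θ h1 h2 h3 h4
    exact h1 ⟨⟨h2, h4⟩, h3⟩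
  have hall := (ev1.and ((ev2 _ fb).and (ev2 _ fc)))
  obtain ⟨ε, hε, hball⟩ := Metric.eventually_nhds_iff.1 hall
  have hsel : ∀ θ : ℝ, |θ| < ε → θ ≠ 0 → ∃ d, d ≠ a ∧ d ≠ b ∧ d ≠ c ∧ f u0 ∈ R d ∧ γ θ ∈ R d := by
    intro θ hθ h0
    obtain ⟨d, hda, hdm⟩ := other θ
    obtain ⟨q1, q2, q3⟩ := hball (y := θ) (by simpa using hθ)
    have hγa : γ θ ∈ R a := hf.mem (pol_mul u0 hu0 θ).le
    refine ⟨d, hda, ?_, ?_, ?_, hdm⟩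
    · rintro rfl; exact q2 h0 ⟨hγa, hdm⟩
    · rintro rfl; exact q3 h0 ⟨hγa, hdm⟩
    · by_contra hnot; exact q1 d hnot hdm
  obtain ⟨d, hda, hdb, hdc, hdp, -⟩ := hsel (ε / 2) (by rw [abs_of_pos] <;> linarith) (by linarith)
  have huniq : ∀ e, e ≠ a → e ≠ b → e ≠ c → f u0 ∈ R e → e = d := by
    intro e e1 e2 e3 e4
    by_contra hne
    have hle := h4 (f u0)
    have h5 : ({a, b, c, d, e} : Set C).ncard ≤ 4 := by
      refine (ncard_le_ncard ?_ (toFinite _)).trans hle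
      rintro x (rfl | rfl | rfl | rfl | rfl) <;> assumption
    have h6 : ({a, b, c, d, e} : Set C).ncard = 5 := by
      rw [ncard_insert_of_notMem, ncard_insert_of_notMem, ncard_insert_of_notMem, ncard_pair]
      · exact fun h => hne h.symm
      all_goals simp
      all_goals tauto
    omega
  have hcover := two_cover hf (hR d).choose_spec (hd a d hda.symm) hu0 (lt_min hε Real.pi_pos) (min_le_right _ _) (by
    intro θ hθ
    by_cases h0 : θ = 0
    · subst h0; rw [show f (u0 * pol 1 0) = γ 0 from rfl, hγ0]; exact hdp
    · obtain ⟨e, e1, e2, e3, e4, e5⟩ := hsel θ (hθ.trans_le (min_le_left _ _)) h0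
      rw [← huniq e e1 e2 e3 e4]; exact e5)
  obtain ⟨g, hg⟩ := hR b
  have h7 := hg.subset_closure hb
  rw [mem_closure_iff_nhds] at h7
  obtain ⟨y, hy1, hy2⟩ := h7 _ hcover
  rcases hy1 with hy | hy
  · exact not_mem_interior_left (hR a) (hd b a hab.symm) hy (hg.ball_sub hy2)
  · exact not_mem_interior_left (hR d) (hd b d hdb.symm) hy (hg.ball_sub hy2)

lemma exists_injective_choice {E Y : Type*} [Finite E] (A : E → Set Y) (hA : ∀ e, (A e).Infinite) :
    ∃ p : E → Y, Function.Injective p ∧ ∀ e, p e ∈ A e := by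
  classical
  have := Fintype.ofFinite E
  have h1 : ∀ e, ∃ t : Finset Y, ↑t ⊆ A e ∧ t.card = Fintype.card E := fun e => (hA e).exists_subset_card_eq _
  choose t ht hc using h1
  obtain ⟨p, hp, hp'⟩ := (Finset.all_card_le_biUnion_card_iff_exists_injective t).1 (by
    intro s
    rcases s.eq_empty_or_nonempty with rfl | ⟨e, he⟩
    · simp
    · calc s.card ≤ Fintype.card E := Finset.card_le_univ s
        _ = (t e).card := (hc e).symm
        _ ≤ _ := Finset.card_le_card (Finset.subset_biUnion_of_mem t he))
  exact ⟨p, hp, fun e => ht e (hp' e)⟩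

end Plan

namespace Plan

open Filter Topology

/-- Every 4-map graph has a crossing-augmented 1-planar drawing. -/
theorem reverse {V : Type} [Fintype V] (G : SimpleGraph V) (h : IsKMapGraph G 4) :
    ∃ D : G.Drawing, D.IsOnePlanarD ∧ IsCrossingAugmentedD D := by
  classical
  obtain ⟨C, hCfin, M, h4, φ, hadj⟩ := h
  set R := M.region with hRdef
  have hR : ∀ c, Dsk (R c) := fun c => isClosedDisk_iff.1 (M.disk c)
  have hd : ∀ c d, c ≠ d → interior (R c ∩ R d) = ∅ := by
    intro c d hcd; rw [interior_inter]; exact M.int_disjoint c d hcd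
  have hR' := hR
  choose F hF using hR'
  set i : V → C := fun v => (φ v : C) with hi
  have hiinj : Function.Injective i := fun a b hab => φ.injective (Subtype.ext hab)
  have hoR : ∀ c d w, ‖w‖ < 1 → F c w ∈ R d → c = d := by
    intro c d w hw hmem
    by_contra hcd
    exact not_mem_interior_left (hR d) (hd c d hcd) hmem ((hF c).ball_sub ⟨w, by simpa using hw, rfl⟩)
  -- edges
  have hE : ∀ e : G.edgeSet, ∃ u v : V, (e : Sym2 V) = s(u, v) ∧ G.Adj u v := by
    rintro ⟨e, he⟩
    induction e using Sym2.ind with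
    | _ u v => exact ⟨u, v, rfl, he⟩
  choose u v huv hAdj using hE
  set I : G.edgeSet → Set SpherePt := fun e => R (i (u e)) ∩ R (i (v e)) with hI
  have hIne : ∀ e, (I e).Nonempty := fun e => ((hadj _ _).1 (hAdj e)).2
  have hIeq : ∀ (e : G.edgeSet) (x b : V), (e : Sym2 V) = s(x, b) → I e = R (i x) ∩ R (i b) := by
    intro e x b h
    rw [huv e, Sym2.eq_iff] at h
    rcases h with ⟨h1, h2⟩ | ⟨h1, h2⟩
    · simp only [hI, h1, h2]
    · simp only [hI, h1, h2, inter_comm]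
  have hedgene : ∀ (e : G.edgeSet) (x b : V), (e : Sym2 V) = s(x, b) → x ≠ b := by
    intro e x b h
    have := e.2
    rw [h] at this
    exact G.ne_of_adj this
  obtain ⟨p, hpI, hpne⟩ : ∃ p : G.edgeSet → SpherePt, (∀ e, p e ∈ I e) ∧
      ∀ e f : G.edgeSet, e ≠ f → ∀ x : V, x ∈ (e : Sym2 V) → x ∈ (f : Sym2 V) → p e ≠ p f := by
    choose p0 hp0 using hIne
    obtain ⟨pI, hpI, hpI'⟩ := exists_injective_choice (E := {e // (I e).Infinite}) (fun e => I e \ range p0)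
      (fun e => e.2.sdiff (finite_range p0))
    refine ⟨fun e => if h : (I e).Infinite then pI ⟨e, h⟩ else p0 e, ?_, ?_⟩
    · intro e
      by_cases h : (I e).Infinite
      · simp only [h, dif_pos]; exact (hpI' ⟨e, h⟩).1
      · simp only [h, dif_neg, not_false_iff]; exact hp0 e
    · intro e f hef x hxe hxf
      by_cases h1 : (I e).Infinite <;> by_cases h2 : (I f).Infinite
      · simp only [h1, h2, dif_pos]
        intro h; have := hpI h; simp at this; exact hef this
      · simp only [h1, h2, dif_pos, dif_neg, not_false_iff]
        intro h; exact (hpI' ⟨e, h1⟩).2 ⟨f, h.symm⟩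
      · simp only [h1, h2, dif_pos, dif_neg, not_false_iff]
        intro h; exact (hpI' ⟨f, h2⟩).2 ⟨e, h⟩
      · simp only [h1, h2, dif_neg, not_false_iff]
        intro h
        obtain ⟨b, hb⟩ := hxe
        obtain ⟨c, hc⟩ := hxf
        rw [not_infinite] at h1 h2
        have q1 := hp0 e
        have q2 := hp0 f
        rw [hIeq e x b hb] at h1 q1
        rw [hIeq f x c hc] at h2 q2
        have hbc : b ≠ c := by
          rintro rfl
          exact hef (Subtype.ext (hb.trans hc.symm))
        exact triple hR hd M.cover h4 (fun h => hedgene e x b hb (hiinj h)) (fun h => hedgene f x c hc (hiinj h))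
          (fun h => hbc (hiinj h)) q1.1 q1.2 (h ▸ q2.2) h1 h2
  have hpR : ∀ (e : G.edgeSet) (x : V), x ∈ (e : Sym2 V) → p e ∈ R (i x) := by
    rintro e x ⟨b, hb⟩
    have := hpI e
    rw [hIeq e x b hb] at this; exact this.1
  have huine : ∀ e, i (u e) ≠ i (v e) := fun e h => G.ne_of_adj (hAdj e) (hiinj h)
  have hue : ∀ e : G.edgeSet, u e ∈ (e : Sym2 V) := fun e => by rw [huv e]; simp
  have hve : ∀ e : G.edgeSet, v e ∈ (e : Sym2 V) := fun e => by rw [huv e]; simp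
  have hpno : ∀ e c w, ‖w‖ < 1 → F c w ≠ p e := by
    intro e c w hw h
    have h1 := hoR c (i (u e)) w hw (h ▸ hpR e _ (hue e))
    have h2 := hoR c (i (v e)) w hw (h ▸ hpR e _ (hve e))
    exact huine e (h1.symm.trans h2)
  have hα : ∀ (e : G.edgeSet) (x : V), ∃ w : ℂ, x ∈ (e : Sym2 V) → ‖w‖ = 1 ∧ F (i x) w = p e := by
    intro e x
    by_cases hx : x ∈ (e : Sym2 V)
    · have := hpR e x hx
      rw [← (hF (i x)).img] at this
      obtain ⟨w, hw, hw'⟩ := this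
      refine ⟨w, fun _ => ⟨?_, hw'⟩⟩
      by_contra hne
      exact hpno e (i x) w (lt_of_le_of_ne (mem_DD.1 hw) hne) hw'
    · exact ⟨0, fun h => (hx h).elim⟩
  choose α hα using hα
  set A : G.edgeSet → ℝ → SpherePt := fun e t =>
    if t ≤ 1 / 2 then F (i (u e)) ((2 * t : ℝ) * α e (u e)) else F (i (v e)) ((2 - 2 * t : ℝ) * α e (v e)) with hAdef
  have nrm : ∀ (e : G.edgeSet) (x : V), x ∈ (e : Sym2 V) → ∀ r : ℝ, 0 ≤ r → ‖(r : ℂ) * α e x‖ = r := by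
    intro e x hx r hr
    rw [norm_mul, (hα e x hx).1, mul_one]; simp [abs_of_nonneg hr]
  have hA : ∀ e, ∀ t ∈ Icc (0:ℝ) 1, (t = 1 / 2 ∧ A e t = p e) ∨ ∃ x, ∃ r ∈ Ico (0:ℝ) 1, x ∈ (e : Sym2 V) ∧
      A e t = F (i x) ((r : ℂ) * α e x) ∧ ((x = u e ∧ r = 2 * t) ∨ (x = v e ∧ r = 2 - 2 * t)) ∧ (r = 0 → t = 0 ∨ t = 1) := by
    intro e t ht
    rcases lt_trichotomy t (1 / 2) with h | h | h
    · right
      refine ⟨u e, 2 * t, ⟨by linarith [ht.1], by linarith⟩, hue e, ?_, Or.inl ⟨rfl, rfl⟩, fun h => Or.inl (by linarith)⟩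
      simp only [hAdef, if_pos h.le]
    · left
      refine ⟨h, ?_⟩
      simp only [hAdef, h, le_refl, if_true]
      norm_num
      exact (hα e _ (hue e)).2
    · right
      refine ⟨v e, 2 - 2 * t, ⟨by linarith [ht.2], by linarith⟩, hve e, ?_, Or.inr ⟨rfl, rfl⟩, fun h => Or.inr (by linarith)⟩
      simp only [hAdef, if_neg (not_le.2 h)]
  have hAh : ∀ e, A e (1 / 2) = p e := by
    intro e
    simp only [hAdef, le_refl, if_true]
    norm_num
    exact (hα e _ (hue e)).2
  have hFinj : ∀ x y w w', ‖w‖ < 1 → ‖w'‖ < 1 → F (i x) w = F (i y) w' → x = y ∧ w = w' := by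
    intro x y w w' hw hw' h
    have h1 : i x = i y := hoR _ _ w hw (h ▸ (hF (i y)).mem hw'.le)
    have h2 := hiinj h1
    subst h2
    exact ⟨rfl, (hF (i x)).inj (mem_DD.2 hw.le) (mem_DD.2 hw'.le) h⟩
  have hAc : ∀ e, ContinuousOn (A e) (Icc 0 1) := by
    intro e
    rw [← Icc_union_Icc_eq_Icc (by norm_num : (0:ℝ) ≤ 1 / 2) (by norm_num : (1/2:ℝ) ≤ 1)]
    refine ContinuousOn.union_of_isClosed ?_ ?_ isClosed_Icc isClosed_Icc
    · refine ContinuousOn.congr (f := fun t : ℝ => F (i (u e)) ((2 * t : ℝ) * α e (u e))) ?_ ?_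
      · refine (hF _).cont.comp (by fun_prop) ?_
        intro t ht
        rw [mem_DD, nrm e _ (hue e) _ (by linarith [ht.1])]; linarith [ht.2]
      · intro t ht; simp only [hAdef, if_pos ht.2]
    · refine ContinuousOn.congr (f := fun t : ℝ => F (i (v e)) ((2 - 2 * t : ℝ) * α e (v e))) ?_ ?_
      · refine (hF _).cont.comp (by fun_prop) ?_
        intro t ht
        rw [mem_DD, nrm e _ (hve e) _ (by linarith [ht.2])]; linarith [ht.1]
      · intro t ht
        rcases eq_or_lt_of_le ht.1 with h | h
        · rw [← h, hAh]
          norm_num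
          exact (hα e _ (hve e)).2.symm
        · simp only [hAdef, if_neg (not_le.2 h)]
  have hAi : ∀ e, InjOn (A e) (Icc 0 1) := by
    intro e t ht s hs hts
    rcases hA e t ht with ⟨h1, h2⟩ | ⟨x, r, hr, hx, h1, h2, -⟩ <;> rcases hA e s hs with ⟨h3, h5⟩ | ⟨y, r', hr', hy, h3, h5, -⟩
    · rw [h1, h3]
    · exfalso
      rw [h2, h3] at hts
      exact hpno e _ _ (by rw [nrm e y hy r' hr'.1]; exact hr'.2) hts.symm
    · exfalso
      rw [h1, h5] at hts
      exact hpno e _ _ (by rw [nrm e x hx r hr.1]; exact hr.2) hts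
    · rw [h1, h3] at hts
      obtain ⟨q1, q2⟩ := hFinj x y _ _ (by rw [nrm e x hx r hr.1]; exact hr.2) (by rw [nrm e y hy r' hr'.1]; exact hr'.2) hts
      have q3 := congrArg norm q2
      rw [nrm e x hx r hr.1, nrm e y hy r' hr'.1] at q3
      have hne := G.ne_of_adj (hAdj e)
      rcases h2 with ⟨k1, k2⟩ | ⟨k1, k2⟩ <;> rcases h5 with ⟨k3, k4⟩ | ⟨k3, k4⟩
      · linarith
      · exact (hne (by rw [← k1, q1, k3])).elim
      · exact (hne (by rw [← k3, ← q1, k1])).elim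
      · linarith
  have hcross : ∀ e f : G.edgeSet, e ≠ f → ∀ t ∈ Ioo (0:ℝ) 1, ∀ s ∈ Ioo (0:ℝ) 1, A e t = A f s → A e t = p e ∧ p e = p f := by
    intro e f hef t ht s hs hts
    rcases hA e t (Ioo_subset_Icc_self ht) with ⟨h1, h2⟩ | ⟨x, r, hr, hx, h1, h2, h0⟩ <;>
      rcases hA f s (Ioo_subset_Icc_self hs) with ⟨h3, h5⟩ | ⟨y, r', hr', hy, h3, h5, h0'⟩
    · exact ⟨h2, by rw [← h2, hts, h5]⟩
    · exfalso
      rw [h2, h3] at hts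
      exact hpno e _ _ (by rw [nrm f y hy r' hr'.1]; exact hr'.2) hts.symm
    · exfalso
      rw [h1, h5] at hts
      exact hpno f _ _ (by rw [nrm e x hx r hr.1]; exact hr.2) hts
    · exfalso
      rw [h1, h3] at hts
      obtain ⟨q1, q2⟩ := hFinj x y _ _ (by rw [nrm e x hx r hr.1]; exact hr.2) (by rw [nrm f y hy r' hr'.1]; exact hr'.2) hts
      subst q1
      have q3 := congrArg norm q2
      rw [nrm e x hx r hr.1, nrm f x hy r' hr'.1] at q3
      subst q3
      have hr0 : (r : ℂ) ≠ 0 := by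
        intro hr0
        rcases h0 (by exact_mod_cast hr0) with h | h
        · exact ht.1.ne' h
        · exact ht.2.ne h
      have q4 := mul_left_cancel₀ hr0 q2
      exact hpne e f hef x hx hy (by rw [← (hα e x hx).2, ← (hα f x hy).2, q4])
  -- the projection point
  obtain ⟨N, hN1, hN2⟩ : ∃ N : SpherePt, (∀ v, F (i v) 0 ≠ N) ∧ ∀ e, ∀ t ∈ Icc (0:ℝ) 1, A e t ≠ N := by
    have hne : (univ : Set SpherePt).Nonempty := by
      refine ⟨⟨EuclideanSpace.single 0 1, by simp⟩, trivial⟩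
    rw [← M.cover] at hne
    obtain ⟨y, hy⟩ := hne
    obtain ⟨c, -⟩ := mem_iUnion.1 hy
    have hinf : (F c '' Metric.sphere (0:ℂ) 1).Infinite := by
      refine Infinite.image ((hF c).inj.mono Metric.sphere_subset_closedBall) ?_
      have : InjOn (fun t : ℝ => pol 1 t) (Ioo 0 1) := by
        intro a ha b hb hab
        have := Real.pi_gt_three
        exact pol1_inj (by rw [abs_lt]; constructor <;> linarith [ha.1, ha.2]) (by rw [abs_lt]; constructor <;> linarith [hb.1, hb.2]) hab
      refine ((Ioo_infinite zero_lt_one).image this).mono ?_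
      rintro _ ⟨t, -, rfl⟩
      simp [norm_pol]
    obtain ⟨_, ⟨w, hw, rfl⟩, hw'⟩ := hinf.exists_notMem_finite (finite_range p)
    rw [mem_sphere_zero_iff_norm] at hw
    have hw2 : ‖w / 2‖ = 1 / 2 := by rw [norm_div, hw]; simp
    have hw2l : ‖w / 2‖ < 1 := by rw [hw2]; norm_num
    refine ⟨F c (w / 2), ?_, ?_⟩
    · intro x hx
      have h1 : i x = c := hoR _ _ 0 (by simp) (hx ▸ (hF c).mem hw2l.le)
      rw [h1] at hx
      have := (hF c).inj (by simp) (mem_DD.2 hw2l.le) hx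
      rw [← this] at hw2; simp at hw2
    · intro e t ht hAt
      rcases hA e t ht with ⟨h1, h2⟩ | ⟨x, r, hr, hx, h1, h2, h0⟩
      · exact hpno e c _ hw2l (by rw [← hAt, h2])
      · rw [h1] at hAt
        have hn : ‖(r:ℂ) * α e x‖ < 1 := by rw [nrm e x hx r hr.1]; exact hr.2
        have h3 : i x = c := hoR _ _ _ hn (hAt ▸ (hF c).mem hw2l.le)
        rw [h3] at hAt
        have h5 := (hF c).inj (mem_DD.2 hn.le) (mem_DD.2 hw2l.le) hAt
        have h6 := congrArg norm h5
        rw [nrm e x hx r hr.1, hw2] at h6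
        rw [h6] at h5
        have h7 : α e x = w := by
          have : (((1/2 : ℝ)) : ℂ) * α e x = w / 2 := h5
          push_cast at this
          linear_combination 2 * this
        apply hw'
        refine ⟨e, ?_⟩
        rw [← (hα e x hx).2, h7, h3]
  set ψ := stereo N with hψ
  have hψc : ContinuousOn ψ {N}ᶜ := by rw [← stereo_source]; exact ψ.continuousOn
  have hψi : InjOn ψ {N}ᶜ := by rw [← stereo_source]; exact ψ.injOn
  have hinc : ∀ e f : G.edgeSet, e ≠ f → p e = p f → ∀ x : V, ¬ (x ∈ (e : Sym2 V) ∧ x ∈ (f : Sym2 V)) :=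
    fun e f hef hpp x hx => hpne e f hef x hx.1 hx.2 hpp
  have hintr : ∀ e f : G.edgeSet, e ≠ f → ∀ y, y ∈ (fun t => ψ (A e t)) '' Ioo (0:ℝ) 1 → y ∈ (fun t => ψ (A f t)) '' Ioo (0:ℝ) 1 →
      y = ψ (p e) ∧ p e = p f := by
    rintro e f hef y ⟨t, ht, rfl⟩ ⟨s, hs, h⟩
    have h1 := hψi (hN2 f s (Ioo_subset_Icc_self hs)) (hN2 e t (Ioo_subset_Icc_self ht)) h
    obtain ⟨h2, h3⟩ := hcross e f hef t ht s hs h1.symm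
    exact ⟨by simp only [h2], h3⟩
  have ends0 : ∀ e, A e 0 = F (i (u e)) 0 := by intro e; simp [hAdef]
  have ends1 : ∀ e, A e 1 = F (i (v e)) 0 := by intro e; simp only [hAdef]; norm_num
  let D : G.Drawing :=
    { pos := fun x => ψ (F (i x) 0)
      pos_inj := by
        intro x y h
        exact (hFinj x y 0 0 (by simp) (by simp) (hψi (hN1 x) (hN1 y) h)).1
      arc := fun e t => ψ (A e t)
      arc_cont := fun e => hψc.comp (hAc e) (fun t ht => hN2 e t ht)
      arc_inj := fun e => hψi.comp (hAi e) (fun t ht => hN2 e t ht)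
      arc_ends := fun e => ⟨u e, v e, huv e, by simp only [ends0], by simp only [ends1]⟩
      arc_avoid := by
        rintro e x ⟨t, ht, h⟩
        have h1 := hψi (hN2 e t (Ioo_subset_Icc_self ht)) (hN1 x) h
        rcases hA e t (Ioo_subset_Icc_self ht) with ⟨h1', h2⟩ | ⟨y, r, hr, hx, h1', h2, h0⟩
        · exact hpno e _ 0 (by simp) (by rw [← h1, h2])
        · rw [h1'] at h1
          have h3 := (hFinj _ _ _ _ (by rw [nrm e y hx r hr.1]; exact hr.2) (by simp) h1).2
          have h5 := nrm e y hx r hr.1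
          rw [h3, norm_zero] at h5
          rcases h0 h5.symm with h | h
          · exact ht.1.ne' h
          · exact ht.2.ne h
      no_incident_cross := by
        rintro e f hef ⟨y, hy1, hy2⟩
        exact hinc e f hef (hintr e f hef y hy1 hy2).2 }
  refine ⟨D, ?_, ?_⟩
  · rintro e ⟨f, y⟩ ⟨hfe, hy1, hy2⟩ ⟨f', y'⟩ ⟨hfe', hy1', hy2'⟩
    simp only at hfe hfe' hy1 hy2 hy1' hy2'
    obtain ⟨k1, k2⟩ := hintr e f hfe.symm y hy1 hy2
    obtain ⟨k1', k2'⟩ := hintr e f' hfe'.symm y' hy1' hy2'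
    have hyy : y = y' := by rw [k1, k1']
    suffices f = f' by rw [this, hyy]
    by_contra hff
    have m1 := hinc e f hfe.symm k2
    have m2 := hinc e f' hfe'.symm k2'
    have m3 := hinc f f' hff (k2.symm.trans k2')
    have hle := h4 (p e)
    have h5 : ({i (u e), i (v e), i (u f), i (v f), i (u f')} : Set C).ncard ≤ 4 := by
      refine (ncard_le_ncard ?_ (toFinite _)).trans hle
      rintro x (rfl | rfl | rfl | rfl | rfl)
      · exact hpR e _ (hue e)
      · exact hpR e _ (hve e)
      · exact k2 ▸ hpR f _ (hue f)
      · exact k2 ▸ hpR f _ (hve f)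
      · exact k2' ▸ hpR f' _ (hue f')
    have h6 : ({i (u e), i (v e), i (u f), i (v f), i (u f')} : Set C).ncard = 5 := by
      rw [ncard_insert_of_notMem, ncard_insert_of_notMem, ncard_insert_of_notMem, ncard_pair]
      · intro h; exact m3 (v f) ⟨hve f, hiinj h ▸ hue f'⟩
      · rintro (h | h)
        · exact huine f h
        · exact m3 (u f) ⟨hue f, hiinj h ▸ hue f'⟩
      · rintro (h | h | h)
        · exact m1 (v e) ⟨hve e, hiinj h ▸ hue f⟩
        · exact m1 (v e) ⟨hve e, hiinj h ▸ hve f⟩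
        · exact m2 (v e) ⟨hve e, hiinj h ▸ hue f'⟩
      · rintro (h | h | h | h)
        · exact huine e h
        · exact m1 (u e) ⟨hue e, hiinj h ▸ hue f⟩
        · exact m1 (u e) ⟨hue e, hiinj h ▸ hve f⟩
        · exact m2 (u e) ⟨hue e, hiinj h ▸ hue f'⟩
    omega
  · rintro e f hef ⟨y, hy1, hy2⟩ a b c d hab hcd
    obtain ⟨-, k2⟩ := hintr e f hef y hy1 hy2
    have hae : a ∈ (e : Sym2 V) := by rw [hab]; simp
    have hcf : c ∈ (f : Sym2 V) := by rw [hcd]; simp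
    rw [hadj]
    refine ⟨?_, p e, hpR e a hae, k2 ▸ hpR f c hcf⟩
    rintro rfl
    exact hinc e f hef k2 a ⟨hae, hcf⟩

end Plan

namespace Plan
open Filter Topology

/-- The closed unit square of the integer cell `c`. -/
def Q (c : ℤ × ℤ) : Set (ℝ × ℝ) := Icc (c.1 : ℝ) (c.1 + 1) ×ˢ Icc (c.2 : ℝ) (c.2 + 1)

/-- Union of the squares of a set of cells. -/
def U (P : Set (ℤ × ℤ)) : Set (ℝ × ℝ) := ⋃ c ∈ P, Q c

lemma mem_Q {c : ℤ × ℤ} {z : ℝ × ℝ} :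
    z ∈ Q c ↔ ((c.1 : ℝ) ≤ z.1 ∧ z.1 ≤ c.1 + 1) ∧ ((c.2 : ℝ) ≤ z.2 ∧ z.2 ≤ c.2 + 1) := by
  simp only [Q, mem_prod, mem_Icc]

lemma mem_U {P : Set (ℤ × ℤ)} {z : ℝ × ℝ} : z ∈ U P ↔ ∃ c ∈ P, z ∈ Q c := by
  simp [U]

lemma U_mono {P P' : Set (ℤ × ℤ)} (h : P ⊆ P') : U P ⊆ U P' := biUnion_subset_biUnion_left h

lemma U_union (P P' : Set (ℤ × ℤ)) : U (P ∪ P') = U P ∪ U P' := by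
  exact biUnion_union _ _ _

lemma U_insert (q : ℤ × ℤ) (P : Set (ℤ × ℤ)) : U (insert q P) = U P ∪ Q q := by
  rw [union_comm]; simp [U]

lemma U_singleton (q : ℤ × ℤ) : U {q} = Q q := by simp [U]

lemma dsk_Q (c : ℤ × ℤ) : Dsk (Q c) := by
  apply dsk_convex
  · exact (convex_Icc _ _).prod (convex_Icc _ _)
  · exact isCompact_Icc.prod isCompact_Icc
  · rw [Q, interior_prod_eq, interior_Icc, interior_Icc]
    exact (nonempty_Ioo.2 (by linarith)).prod (nonempty_Ioo.2 (by linarith))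

lemma close_of_meet {c c' : ℤ × ℤ} {z : ℝ × ℝ} (h : z ∈ Q c) (h' : z ∈ Q c') :
    (c'.1 - c.1 ≤ 1 ∧ c.1 - c'.1 ≤ 1) ∧ (c'.2 - c.2 ≤ 1 ∧ c.2 - c'.2 ≤ 1) := by
  rw [mem_Q] at h h'
  obtain ⟨⟨a1, a2⟩, a3, a4⟩ := h
  obtain ⟨⟨b1, b2⟩, b3, b4⟩ := h'
  refine ⟨⟨?_, ?_⟩, ?_, ?_⟩ <;> (rw [← @Int.cast_le ℝ]; push_cast; linarith)

lemma isClosed_Q (c : ℤ × ℤ) : IsClosed (Q c) := isClosed_Icc.prod isClosed_Icc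

lemma isCompact_Q (c : ℤ × ℤ) : IsCompact (Q c) := isCompact_Icc.prod isCompact_Icc

lemma isCompact_U {P : Set (ℤ × ℤ)} (h : P.Finite) : IsCompact (U P) :=
  h.isCompact_biUnion fun c _ => isCompact_Q c

/-- Points with an integer coordinate. -/
def Lines : Set (ℝ × ℝ) := {z | z.1 ∈ range ((↑) : ℤ → ℝ) ∨ z.2 ∈ range ((↑) : ℤ → ℝ)}

lemma interior_Lines : interior Lines = ∅ := by
  rw [interior_eq_empty_iff_dense_compl]
  have h : Dense ((range ((↑) : ℤ → ℝ))ᶜ) := (countable_range _).dense_compl ℝ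
  have := h.prod h
  refine this.mono ?_
  rintro ⟨x, y⟩ ⟨h1, h2⟩ h3
  rcases h3 with h3 | h3
  · exact h1 h3
  · exact h2 h3

lemma meet_lines {c c' : ℤ × ℤ} (hne : c ≠ c') {z : ℝ × ℝ} (h : z ∈ Q c) (h' : z ∈ Q c') : z ∈ Lines := by
  have hk := close_of_meet h h'
  rw [mem_Q] at h h'
  obtain ⟨⟨a1, a2⟩, a3, a4⟩ := h
  obtain ⟨⟨b1, b2⟩, b3, b4⟩ := h'
  by_cases h1 : c.1 = c'.1
  · have h2 : c.2 ≠ c'.2 := fun h2 => hne (Prod.ext h1 h2)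
    right
    rcases lt_or_gt_of_ne h2 with h2 | h2
    · refine ⟨c'.2, ?_⟩
      have : (c'.2 : ℝ) = c.2 + 1 := by exact_mod_cast (by omega : c'.2 = c.2 + 1)
      linarith
    · refine ⟨c.2, ?_⟩
      have : (c.2 : ℝ) = c'.2 + 1 := by exact_mod_cast (by omega : c.2 = c'.2 + 1)
      linarith
  · left
    rcases lt_or_gt_of_ne h1 with h2 | h2
    · refine ⟨c'.1, ?_⟩
      have : (c'.1 : ℝ) = c.1 + 1 := by exact_mod_cast (by omega : c'.1 = c.1 + 1)
      linarith
    · refine ⟨c.1, ?_⟩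
      have : (c.1 : ℝ) = c'.1 + 1 := by exact_mod_cast (by omega : c.1 = c'.1 + 1)
      linarith

lemma interior_U_inter {P P' : Set (ℤ × ℤ)} (h : Disjoint P P') : interior (U P ∩ U P') = ∅ := by
  refine subset_empty_iff.1 ((interior_mono ?_).trans interior_Lines.subset)
  rintro z ⟨h1, h2⟩
  obtain ⟨c, hc, h1⟩ := mem_U.1 h1
  obtain ⟨c', hc', h2⟩ := mem_U.1 h2
  exact meet_lines (fun e : c = c' => (disjoint_left.1 h) hc (e ▸ hc')) h1 h2

/-- The four grid directions. -/
def Dir (d : ℤ × ℤ) : Prop := d = (1, 0) ∨ d = (-1, 0) ∨ d = (0, 1) ∨ d = (0, -1)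

/-- The side shared by `q` and `q - d`. -/
def sideMap (q d : ℤ × ℤ) (t : ℝ) : ℝ × ℝ :=
  (q.1 + (if d.1 = -1 then 1 else 0) + t * d.2 ^ 2, q.2 + (if d.2 = -1 then 1 else 0) + t * d.1 ^ 2)

/-- The side shared by `q` and `q - d`, as a set. -/
def side (q d : ℤ × ℤ) : Set (ℝ × ℝ) := sideMap q d '' Icc 0 1

lemma sideMap_cont (q d : ℤ × ℤ) : Continuous (sideMap q d) := by
  unfold sideMap; fun_prop

lemma sideMap_inj {q d : ℤ × ℤ} (hd : Dir d) : Function.Injective (sideMap q d) := by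
  intro s t h
  rcases hd with rfl | rfl | rfl | rfl <;> simpa [sideMap] using h

lemma mem_side {q d : ℤ × ℤ} (hd : Dir d) {z : ℝ × ℝ} : z ∈ side q d ↔ z ∈ Q q ∧ z ∈ Q (q - d) := by
  simp only [side, mem_image, mem_Q]
  rcases hd with rfl | rfl | rfl | rfl
  · simp only [sideMap]
    constructor
    · rintro ⟨t, ⟨h0, h1⟩, rfl⟩; norm_num; constructor <;> linarith
    · intro h; refine ⟨z.2 - q.2, ⟨?_, ?_⟩, ?_⟩
      · norm_num at h ⊢; linarith
      · norm_num at h ⊢; linarith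
      · norm_num at h ⊢; ext <;> simp; linarith
  · simp only [sideMap]
    constructor
    · rintro ⟨t, ⟨h0, h1⟩, rfl⟩; norm_num; constructor <;> linarith
    · intro h; refine ⟨z.2 - q.2, ⟨?_, ?_⟩, ?_⟩
      · norm_num at h ⊢; linarith
      · norm_num at h ⊢; linarith
      · norm_num at h ⊢; ext <;> simp; linarith
  · simp only [sideMap]
    constructor
    · rintro ⟨t, ⟨h0, h1⟩, rfl⟩; norm_num; constructor <;> linarith
    · intro h; refine ⟨z.1 - q.1, ⟨?_, ?_⟩, ?_⟩
      · norm_num at h ⊢; linarith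
      · norm_num at h ⊢; linarith
      · norm_num at h ⊢; ext <;> simp; linarith
  · simp only [sideMap]
    constructor
    · rintro ⟨t, ⟨h0, h1⟩, rfl⟩; norm_num; constructor <;> linarith
    · intro h; refine ⟨z.1 - q.1, ⟨?_, ?_⟩, ?_⟩
      · norm_num at h ⊢; linarith
      · norm_num at h ⊢; linarith
      · norm_num at h ⊢; ext <;> simp; linarith

lemma meet_side {q d p : ℤ × ℤ} (hd : Dir d) (h : (p.1 - q.1) * d.1 + (p.2 - q.2) * d.2 = -1)
    {z : ℝ × ℝ} (h1 : z ∈ Q q) (h2 : z ∈ Q p) : z ∈ side q d := by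
  rw [mem_side hd]
  refine ⟨h1, ?_⟩
  rw [mem_Q] at *
  rcases hd with rfl | rfl | rfl | rfl
  · have : (p.1 : ℝ) = q.1 - 1 := by exact_mod_cast (by simp at h; omega : p.1 = q.1 - 1)
    norm_num at *; rw [this] at h2; norm_num at h2; refine ⟨⟨?_, ?_⟩, ?_, ?_⟩ <;> linarith
  · have : (p.1 : ℝ) = q.1 + 1 := by exact_mod_cast (by simp at h; omega : p.1 = q.1 + 1)
    norm_num at *; rw [this] at h2; norm_num at h2; refine ⟨⟨?_, ?_⟩, ?_, ?_⟩ <;> linarith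
  · have : (p.2 : ℝ) = q.2 - 1 := by exact_mod_cast (by simp at h; omega : p.2 = q.2 - 1)
    norm_num at *; rw [this] at h2; norm_num at h2; refine ⟨⟨?_, ?_⟩, ?_, ?_⟩ <;> linarith
  · have : (p.2 : ℝ) = q.2 + 1 := by exact_mod_cast (by simp at h; omega : p.2 = q.2 + 1)
    norm_num at *; rw [this] at h2; norm_num at h2; refine ⟨⟨?_, ?_⟩, ?_, ?_⟩ <;> linarith

/-- Attaching one square along exactly one side keeps a disc. -/
lemma grow {P : Set (ℤ × ℤ)} {q d : ℤ × ℤ} (hP : Dsk (U P)) (hd : Dir d) (hp : q - d ∈ P)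
    (hk : ∀ p ∈ P, (p.1 - q.1 ≤ 1 ∧ q.1 - p.1 ≤ 1) ∧ (p.2 - q.2 ≤ 1 ∧ q.2 - p.2 ≤ 1) →
      (p.1 - q.1) * d.1 + (p.2 - q.2) * d.2 = -1) : Dsk (U (insert q P)) := by
  have hq : q ∉ P := fun hq => by simpa using hk q hq (by simp)
  rw [U_insert]
  refine glue hP (dsk_Q q) (b := sideMap q d) (sideMap_cont q d).continuousOn (sideMap_inj hd).injOn ?_ ?_
  · change _ = side q d
    ext z
    constructor
    · rintro ⟨h1, h2⟩
      obtain ⟨p, hpP, hz⟩ := mem_U.1 h1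
      exact meet_side hd (hk p hpP (close_of_meet h2 hz)) h2 hz
    · intro h
      rw [mem_side hd] at h
      exact ⟨mem_U.2 ⟨_, hp, h.2⟩, h.1⟩
  · rw [← U_singleton]
    exact interior_U_inter (by simpa using hq)

end Plan

namespace Plan
open Filter Topology

/-- King-move closeness of cells. -/
def Close (p q : ℤ × ℤ) : Prop := (p.1 - q.1 ≤ 1 ∧ q.1 - p.1 ≤ 1) ∧ (p.2 - q.2 ≤ 1 ∧ q.2 - p.2 ≤ 1)

/-- The tripled cell. -/
def ctr (c : ℤ × ℤ) : ℤ × ℤ := (3 * c.1, 3 * c.2)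

/-- The arm cell at the tripled cell. -/
def arm (a : (ℤ × ℤ) × (ℤ × ℤ)) : ℤ × ℤ := (3 * a.1.1 + a.2.1, 3 * a.1.2 + a.2.2)

/-- All cells with centers `T` and arms `A`. -/
def cells (T : Set (ℤ × ℤ)) (A : Set ((ℤ × ℤ) × (ℤ × ℤ))) : Set (ℤ × ℤ) := ctr '' T ∪ arm '' A

lemma Dir.neg {d : ℤ × ℤ} (h : Dir d) : Dir (-d) := by
  rcases h with rfl | rfl | rfl | rfl <;> simp [Dir]

lemma close_cc {c c' : ℤ × ℤ} (h : Close (ctr c) (ctr c')) : c = c' := by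
  obtain ⟨x, y⟩ := c; obtain ⟨x', y'⟩ := c'
  simp only [Close, ctr] at h
  ext <;> simp <;> omega

lemma close_ca {c : ℤ × ℤ} {a : (ℤ × ℤ) × (ℤ × ℤ)} (ha : Dir a.2) (h : Close (ctr c) (arm a)) : c = a.1 := by
  obtain ⟨x, y⟩ := c; obtain ⟨⟨x', y'⟩, d⟩ := a
  simp only [Close, ctr, arm] at h ha
  rcases ha with rfl | rfl | rfl | rfl <;> simp only at h <;> ext <;> simp <;> omega

lemma close_symm {p q : ℤ × ℤ} (h : Close p q) : Close q p := by
  unfold Close at *; omega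

lemma close_aa {a b : (ℤ × ℤ) × (ℤ × ℤ)} (ha : Dir a.2) (hb : Dir b.2) (h : Close (arm a) (arm b)) :
    a.1 = b.1 ∨ (b.1 = a.1 + a.2 ∧ b.2 = - a.2) := by
  obtain ⟨⟨x, y⟩, d⟩ := a; obtain ⟨⟨x', y'⟩, d'⟩ := b
  simp only [Close, arm] at h ha hb
  rcases ha with rfl | rfl | rfl | rfl <;> rcases hb with rfl | rfl | rfl | rfl <;> simp only at h <;>
    simp only [Prod.mk.injEq, Prod.mk_add_mk, Prod.neg_mk, and_true, and_self, true_and, neg_neg, neg_zero] <;> omega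

lemma arm_inj {a b : (ℤ × ℤ) × (ℤ × ℤ)} (ha : Dir a.2) (hb : Dir b.2) (h : arm a = arm b) : a = b := by
  obtain ⟨⟨x, y⟩, d⟩ := a; obtain ⟨⟨x', y'⟩, d'⟩ := b
  simp only [arm, Prod.mk.injEq] at h ha hb
  rcases ha with rfl | rfl | rfl | rfl <;> rcases hb with rfl | rfl | rfl | rfl <;> simp only at h <;>
    simp only [Prod.mk.injEq, and_true, and_self, true_and] <;> omega

lemma cells_insert (T A) (a) : cells T (insert a A) = insert (arm a) (cells T A) := by
  simp [cells, image_insert_eq, union_insert]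

lemma cells_insert' (T A) (c) : cells (insert c T) A = insert (ctr c) (cells T A) := by
  simp [cells, image_insert_eq, insert_union]

lemma add_arm {T : Set (ℤ × ℤ)} {A : Set ((ℤ × ℤ) × (ℤ × ℤ))} (hA : ∀ a ∈ A, a.1 ∈ T ∧ Dir a.2)
    (hD : Dsk (U (cells T A))) {c d : ℤ × ℤ} (hc : c ∈ T) (hd : Dir d)
    (hn : (c + d, -d) ∉ A) : Dsk (U (cells T (insert (c, d) A))) := by
  by_cases hin : (c, d) ∈ A
  · rwa [insert_eq_of_mem hin]
  rw [cells_insert]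
  refine grow hD hd (Or.inl ⟨c, hc, by ext <;> simp [ctr, arm]⟩) ?_
  rintro p (⟨c', hc', rfl⟩ | ⟨a, ha, rfl⟩) hk
  · obtain rfl := close_ca hd hk
    rcases hd with rfl | rfl | rfl | rfl <;> simp [ctr, arm]
  · rcases close_aa hd (hA a ha).2 (close_symm hk) with h | h
    · obtain ⟨a1, a2⟩ := a
      simp only at h; subst h
      have hne : d ≠ a2 := by rintro rfl; exact hin ha
      have := (hA _ ha).2
      simp only at this
      simp only [arm] at hk ⊢
      rcases hd with rfl | rfl | rfl | rfl <;> rcases this with rfl | rfl | rfl | rfl <;> simp_all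
    · exfalso; apply hn
      obtain ⟨a1, a2⟩ := a
      simp only at h; rw [← h.1, ← h.2]; exact ha

lemma add_two {T : Set (ℤ × ℤ)} {A : Set ((ℤ × ℤ) × (ℤ × ℤ))} (hA : ∀ a ∈ A, a.1 ∈ T ∧ Dir a.2)
    (hD : Dsk (U (cells T A))) {c d : ℤ × ℤ} (hd : Dir d) (hn : c + d ∉ T) (hin : (c, d) ∈ A) :
    Dsk (U (cells (insert (c + d) T) (insert (c + d, -d) A))) := by
  have h1 : Dsk (U (cells T (insert (c + d, -d) A))) := by
    rw [cells_insert]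
    have e : arm (c + d, -d) - d = arm (c, d) := by
      obtain ⟨x, y⟩ := c; obtain ⟨x', y'⟩ := d
      simp only [arm, Prod.mk_add_mk, Prod.neg_mk, Prod.mk_sub_mk, Prod.mk.injEq]; constructor <;> ring
    refine grow hD hd (Or.inr ⟨(c, d), hin, e.symm⟩) ?_
    rintro p (⟨c', hc', rfl⟩ | ⟨a, ha, rfl⟩) hk
    · exact absurd hc' ((close_ca hd.neg hk) ▸ hn)
    · rcases close_aa hd.neg (hA a ha).2 (close_symm hk) with h | h
      · exact absurd ((hA a ha).1) (h ▸ hn)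
      · obtain ⟨a1, a2⟩ := a
        simp only [neg_neg, add_neg_cancel_right] at h
        obtain ⟨rfl, rfl⟩ := h
        rcases hd with rfl | rfl | rfl | rfl <;> simp [arm] <;> ring
  rw [cells_insert']
  have e : ctr (c + d) - d = arm (c + d, -d) := by
    simp only [arm, ctr]; ext <;> simp <;> ring
  refine grow h1 hd (Or.inr ⟨_, mem_insert _ _, e.symm⟩) ?_
  rintro p (⟨c', hc', rfl⟩ | ⟨a, (rfl | ha), rfl⟩) hk
  · exact absurd hc' ((close_cc hk) ▸ hn)
  · rw [← e]
    rcases hd with rfl | rfl | rfl | rfl <;> simp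
  · exact absurd (hA a ha).1 ((close_ca (hA a ha).2 (close_symm hk)) ▸ hn)

/-- Edge-connected sets of cells, grown one cell at a time. -/
inductive Conn : Set (ℤ × ℤ) → Prop
  | single (c : ℤ × ℤ) : Conn {c}
  | add {T : Set (ℤ × ℤ)} {c d : ℤ × ℤ} : Conn T → c ∈ T → Dir d → c + d ∉ T → Conn (insert (c + d) T)

lemma Conn.finite {T : Set (ℤ × ℤ)} (h : Conn T) : T.Finite := by
  induction h with
  | single c => exact finite_singleton c
  | add _ _ _ _ ih => exact ih.insert _

lemma Conn.nonempty {T : Set (ℤ × ℤ)} (h : Conn T) : T.Nonempty := by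
  cases h with
  | single c => exact singleton_nonempty c
  | add _ _ _ _ => exact insert_nonempty _ _

lemma Conn.core {T : Set (ℤ × ℤ)} (h : Conn T) : ∃ A : Set ((ℤ × ℤ) × (ℤ × ℤ)), A.Finite ∧
    (∀ a ∈ A, a.1 ∈ T ∧ Dir a.2 ∧ a.1 + a.2 ∈ T) ∧ Dsk (U (cells T A)) := by
  induction h with
  | single c =>
    refine ⟨∅, finite_empty, by simp, ?_⟩
    simp only [cells, image_singleton, image_empty, union_empty, U_singleton]
    exact dsk_Q _
  | @add T c d hT hc hd hn ih =>
    obtain ⟨A, hf, hA, hD⟩ := ih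
    refine ⟨insert (c + d, -d) (insert (c, d) A), (hf.insert _).insert _, ?_, ?_⟩
    · rintro a (rfl | rfl | ha)
      · simp [hd.neg, hc]
      · simp [hd, hc]
      · exact ⟨Or.inr (hA a ha).1, (hA a ha).2.1, Or.inr (hA a ha).2.2⟩
    · refine add_two (A := insert (c, d) A) ?_ ?_ hd hn (mem_insert _ _)
      · rintro a (rfl | ha)
        · exact ⟨hc, hd⟩
        · exact ⟨(hA a ha).1, (hA a ha).2.1⟩
      · exact add_arm (fun a ha => ⟨(hA a ha).1, (hA a ha).2.1⟩) hD hc hd (fun h => hn (hA _ h).1)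

/-- A connected set of cells with outgoing arms is a disc. -/
lemma Conn.arms {T : Set (ℤ × ℤ)} (h : Conn T) : ∃ A : Set ((ℤ × ℤ) × (ℤ × ℤ)), A.Finite ∧
    (∀ a ∈ A, a.1 ∈ T ∧ Dir a.2 ∧ a.1 + a.2 ∈ T) ∧
    ∀ B : Set ((ℤ × ℤ) × (ℤ × ℤ)), B.Finite → (∀ b ∈ B, b.1 ∈ T ∧ Dir b.2 ∧ b.1 + b.2 ∉ T) →
      Dsk (U (cells T (A ∪ B))) := by
  obtain ⟨A, hf, hA, hD⟩ := h.core
  refine ⟨A, hf, hA, ?_⟩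
  intro B hB
  induction B, hB using Set.Finite.induction_on with
  | empty => intro _; simpa using hD
  | @insert b B _ _ ih =>
    intro hb
    have ih' := ih fun x hx => hb x (Or.inr hx)
    rw [union_insert]
    have h0 := hb b (mem_insert _ _)
    refine add_arm (c := b.1) (d := b.2) ?_ ih' h0.1 h0.2.1 ?_
    · rintro a (ha | ha)
      · exact ⟨(hA a ha).1, (hA a ha).2.1⟩
      · exact ⟨(hb a (Or.inr ha)).1, (hb a (Or.inr ha)).2.1⟩
    · rintro (ha | ha)
      · exact h0.2.2 (hA _ ha).1
      · exact h0.2.2 (hb _ (Or.inr ha)).1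

end Plan

namespace Plan
open Filter Topology

lemma meet_arms {T T' : Set (ℤ × ℤ)} {A A' : Set ((ℤ × ℤ) × (ℤ × ℤ))}
    (hA : ∀ a ∈ A, a.1 ∈ T ∧ Dir a.2) (hA' : ∀ a ∈ A', a.1 ∈ T' ∧ Dir a.2) (hd : Disjoint T T')
    {p p' : ℤ × ℤ} (hp : p ∈ cells T A) (hp' : p' ∈ cells T' A') (hk : Close p p') :
    ∃ a ∈ A, p = arm a ∧ p' = arm (a.1 + a.2, -a.2) ∧ (a.1 + a.2, -a.2) ∈ A' := by
  rcases hp with ⟨c, hc, rfl⟩ | ⟨a, ha, rfl⟩ <;> rcases hp' with ⟨c', hc', rfl⟩ | ⟨a', ha', rfl⟩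
  · exact absurd hc' (disjoint_left.1 hd (close_cc hk ▸ hc))
  · exact absurd (hA' a' ha').1 (disjoint_left.1 hd (close_ca (hA' a' ha').2 hk ▸ hc))
  · exact absurd hc' (disjoint_left.1 hd (close_ca (hA a ha).2 (close_symm hk) ▸ (hA a ha).1))
  · rcases close_aa (hA a ha).2 (hA' a' ha').2 hk with h | ⟨h1, h2⟩
    · exact absurd (hA' a' ha').1 (disjoint_left.1 hd (h ▸ (hA a ha).1))
    · have : a' = (a.1 + a.2, -a.2) := Prod.ext h1 h2
      subst this
      exact ⟨a, ha, rfl, rfl, ha'⟩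

structure Contacts {H : Type} (R : H → H → Prop) (P : H → Set (ℤ × ℤ)) : Prop where
  fin : ∀ h, (P h).Finite
  dsk : ∀ h, Dsk (U (P h))
  disj : ∀ h h', h ≠ h' → Disjoint (P h) (P h')
  not : ∀ h h', h ≠ h' → ¬ R h h' → U (P h) ∩ U (P h') = ∅
  con : ∀ h h', R h h' → ∃ q d, Dir d ∧ U (P h) ∩ U (P h') = side q d
  three : ∀ h h' h'', h ≠ h' → h ≠ h'' → h' ≠ h'' → U (P h) ∩ U (P h') ∩ U (P h'') = ∅

lemma contacts {H : Type} [Finite H] (R : H → H → Prop) (T : H → Set (ℤ × ℤ))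
    (hT : ∀ h, Conn (T h)) (hTd : ∀ h h', h ≠ h' → Disjoint (T h) (T h'))
    (hRs : ∀ h h', R h h' → R h' h) (hRi : ∀ h h', R h h' → h ≠ h')
    (hR : ∀ h h', R h h' → ∃ c ∈ T h, ∃ d, Dir d ∧ c + d ∈ T h') :
    ∃ P, Contacts R P := by
  obtain ⟨f, hf⟩ := exists_injective_nat H
  obtain ⟨con, hcon, hsym⟩ : ∃ con : H → H → (ℤ × ℤ) × (ℤ × ℤ),
      (∀ h h', R h h' → (con h h').1 ∈ T h ∧ Dir (con h h').2 ∧ (con h h').1 + (con h h').2 ∈ T h') ∧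
      ∀ h h', R h h' → con h' h = ((con h h').1 + (con h h').2, -(con h h').2) := by
    have : ∀ h h', ∃ a : (ℤ × ℤ) × (ℤ × ℤ), R h h' → a.1 ∈ T h ∧ Dir a.2 ∧ a.1 + a.2 ∈ T h' := by
      intro h h'
      by_cases hr : R h h'
      · obtain ⟨c, hc, d, hd, h1⟩ := hR h h' hr
        exact ⟨(c, d), fun _ => ⟨hc, hd, h1⟩⟩
      · exact ⟨0, fun h => absurd h hr⟩
    choose k hk using this
    refine ⟨fun h h' => if f h < f h' then k h h' else ((k h' h).1 + (k h' h).2, -(k h' h).2), ?_, ?_⟩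
    · intro h h' hr
      by_cases hlt : f h < f h'
      · simp only [hlt, if_true]; exact hk h h' hr
      · simp only [hlt, if_false]
        obtain ⟨h1, h2, h3⟩ := hk h' h (hRs _ _ hr)
        exact ⟨h3, h2.neg, by simpa using h1⟩
    · intro h h' hr
      have hne : f h ≠ f h' := fun e => hRi h h' hr (hf e)
      by_cases hlt : f h < f h'
      · simp only [hlt, if_true, not_lt_of_gt hlt, if_false]
      · have h1 : f h' < f h := by omega
        simp [hlt, h1]
  choose A hAf hA hAD using fun h => (hT h).arms
  set B : H → Set ((ℤ × ℤ) × (ℤ × ℤ)) := fun h => (fun h' => con h h') '' {h' | R h h'} with hB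
  have hBm : ∀ h, ∀ b ∈ B h, b.1 ∈ T h ∧ Dir b.2 ∧ b.1 + b.2 ∉ T h := by
    rintro h _ ⟨h', hr, rfl⟩
    obtain ⟨h1, h2, h3⟩ := hcon h h' hr
    exact ⟨h1, h2, disjoint_right.1 (hTd h h' (hRi _ _ hr)) h3⟩
  set C := fun h => A h ∪ B h with hC
  have hCm : ∀ h, ∀ a ∈ C h, a.1 ∈ T h ∧ Dir a.2 := by
    rintro h a (ha | ha)
    · exact ⟨(hA h a ha).1, (hA h a ha).2.1⟩
    · exact ⟨(hBm h a ha).1, (hBm h a ha).2.1⟩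
  have hCfin : ∀ h, (C h).Finite := fun h => (hAf h).union ((toFinite _).image _)
  have key : ∀ h h', h ≠ h' → ∀ p ∈ cells (T h) (C h), ∀ p' ∈ cells (T h') (C h'), Close p p' →
      R h h' ∧ p = arm (con h h') ∧ p' = arm (con h' h) := by
    intro h h' hne p hp p' hp' hk
    obtain ⟨a, ha, e1, e2, ha'⟩ := meet_arms (hCm h) (hCm h') (hTd h h' hne) hp hp' hk
    rcases ha with ha | ⟨h'', hr, rfl⟩
    · exact absurd ((hCm h' _ ha').1) (disjoint_left.1 (hTd _ _ hne) (hA h a ha).2.2)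
    · have : h'' = h' := by
        by_contra hh
        exact disjoint_left.1 (hTd _ _ hh) (hcon h h'' hr).2.2 (hCm h' _ ha').1
      subst this
      refine ⟨hr, e1, ?_⟩
      rw [hsym h h'' hr]; exact e2
  have hclose : ∀ p p' : ℤ × ℤ, ∀ z, z ∈ Q p → z ∈ Q p' → Close p p' :=
    fun p p' z h1 h2 => close_of_meet h2 h1
  have hdisj : ∀ h h', h ≠ h' → Disjoint (cells (T h) (C h)) (cells (T h') (C h')) := by
    intro h h' hne
    rw [disjoint_left]
    intro p hp hp'
    obtain ⟨hr, e1, e2⟩ := key h h' hne p hp p hp' (by simp [Close])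
    have h1 := hcon h h' hr
    have h2 := hcon h' h (hRs _ _ hr)
    have := arm_inj h1.2.1 h2.2.1 (e1.symm.trans e2)
    exact disjoint_left.1 (hTd _ _ hne) h1.1 (this ▸ h2.1)
  have harm : ∀ h h', R h h' → arm (con h h') ∈ cells (T h) (C h) :=
    fun h h' hr => Or.inr ⟨_, Or.inr ⟨h', hr, rfl⟩, rfl⟩
  refine ⟨fun h => cells (T h) (C h), ?_, ?_, hdisj, ?_, ?_, ?_⟩
  · intro h
    exact ((hT h).finite.image _).union ((hCfin h).image _)
  · intro h
    exact hAD h (B h) ((toFinite _).image _) (hBm h)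
  · intro h h' hne hr
    rw [eq_empty_iff_forall_notMem]
    rintro z ⟨h1, h2⟩
    obtain ⟨p, hp, h1⟩ := mem_U.1 h1
    obtain ⟨p', hp', h2⟩ := mem_U.1 h2
    exact hr (key h h' hne p hp p' hp' (hclose p p' z h1 h2)).1
  · intro h h' hr
    have hd := (hcon h h' hr).2.1
    refine ⟨arm (con h h'), -(con h h').2, hd.neg, ?_⟩
    have e : arm (con h h') - -(con h h').2 = arm (con h' h) := by
      rw [hsym h h' hr]
      simp only [arm]; ext <;> simp <;> ring
    ext z
    rw [mem_side hd.neg, e]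
    constructor
    · rintro ⟨h1, h2⟩
      obtain ⟨p, hp, h1⟩ := mem_U.1 h1
      obtain ⟨p', hp', h2⟩ := mem_U.1 h2
      obtain ⟨_, e1, e2⟩ := key h h' (hRi _ _ hr) p hp p' hp' (hclose p p' z h1 h2)
      exact ⟨e1 ▸ h1, e2 ▸ h2⟩
    · rintro ⟨h1, h2⟩
      exact ⟨mem_U.2 ⟨_, harm h h' hr, h1⟩, mem_U.2 ⟨_, harm h' h (hRs _ _ hr), h2⟩⟩
  · intro h h' h'' n1 n2 n3
    rw [eq_empty_iff_forall_notMem]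
    rintro z ⟨⟨h1, h2⟩, h3⟩
    obtain ⟨p, hp, h1⟩ := mem_U.1 h1
    obtain ⟨p', hp', h2⟩ := mem_U.1 h2
    obtain ⟨p'', hp'', h3⟩ := mem_U.1 h3
    obtain ⟨r1, e1, e2⟩ := key h h' n1 p hp p' hp' (hclose p p' z h1 h2)
    obtain ⟨r2, f1, f2⟩ := key h h'' n2 p hp p'' hp'' (hclose p p'' z h1 h3)
    have c1 := hcon h h' r1
    have c2 := hcon h h'' r2
    have := arm_inj c1.2.1 c2.2.1 (e1.symm.trans f1)
    exact disjoint_left.1 (hTd _ _ n3) c1.2.2 (this ▸ c2.2.2)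

end Plan

namespace Plan
open Filter Topology

/-- The contact relation between vertices and crossing points. -/
def Rel {V X : Type} (B : V → V → Prop) (nb : X → Fin 4 → V) : V ⊕ X → V ⊕ X → Prop
  | .inl u, .inl v => B u v
  | .inl u, .inr x => ∃ k, nb x k = u
  | .inr x, .inl u => ∃ k, nb x k = u
  | .inr _, .inr _ => False

/-- The big box. -/
def Box (N : ℤ) : Set (ℝ × ℝ) := Icc (-N : ℝ) N ×ˢ Icc (-N : ℝ) N

/-- The cells of the big box. -/
def BoxC (N : ℤ) : Set (ℤ × ℤ) := Ico (-N) N ×ˢ Ico (-N) N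

lemma mem_Box {N : ℤ} {z : ℝ × ℝ} : z ∈ Box N ↔ (-(N:ℝ) ≤ z.1 ∧ z.1 ≤ N) ∧ (-(N:ℝ) ≤ z.2 ∧ z.2 ≤ N) := by
  simp only [Box, mem_prod, mem_Icc]

lemma mem_BoxC {N : ℤ} {c : ℤ × ℤ} : c ∈ BoxC N ↔ (-N ≤ c.1 ∧ c.1 < N) ∧ (-N ≤ c.2 ∧ c.2 < N) := by
  simp only [BoxC, mem_prod, mem_Ico]

lemma floor_cell {N : ℤ} (hN : 0 < N) {t : ℝ} (h1 : -(N:ℝ) ≤ t) (h2 : t ≤ N) :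
    ∃ n : ℤ, -N ≤ n ∧ n < N ∧ (n : ℝ) ≤ t ∧ t ≤ n + 1 := by
  rcases lt_or_eq_of_le h2 with h | h
  · refine ⟨⌊t⌋, ?_, ?_, Int.floor_le t, (Int.lt_floor_add_one t).le⟩
    · rw [Int.le_floor]; push_cast; exact h1
    · rw [Int.floor_lt]; exact h
  · refine ⟨N - 1, by omega, by omega, ?_, ?_⟩ <;> push_cast <;> linarith

lemma U_BoxC {N : ℤ} (hN : 0 < N) : U (BoxC N) = Box N := by
  ext z
  rw [mem_U, mem_Box]
  constructor
  · rintro ⟨c, hc, hz⟩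
    rw [mem_BoxC] at hc
    rw [mem_Q] at hz
    have a1 : (-N : ℝ) ≤ c.1 := by exact_mod_cast hc.1.1
    have a2 : (c.1 : ℝ) + 1 ≤ N := by exact_mod_cast hc.1.2
    have a3 : (-N : ℝ) ≤ c.2 := by exact_mod_cast hc.2.1
    have a4 : (c.2 : ℝ) + 1 ≤ N := by exact_mod_cast hc.2.2
    refine ⟨⟨?_, ?_⟩, ?_, ?_⟩ <;> linarith [hz.1.1, hz.1.2, hz.2.1, hz.2.2]
  · rintro ⟨h1, h2⟩
    obtain ⟨n, n1, n2, n3, n4⟩ := floor_cell hN h1.1 h1.2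
    obtain ⟨m, m1, m2, m3, m4⟩ := floor_cell hN h2.1 h2.2
    exact ⟨(n, m), mem_BoxC.2 ⟨⟨n1, n2⟩, m1, m2⟩, mem_Q.2 ⟨⟨n3, n4⟩, m3, m4⟩⟩

lemma interior_Box (N : ℤ) : interior (Box N) = Ioo (-N : ℝ) N ×ˢ Ioo (-N : ℝ) N := by
  rw [Box, interior_prod_eq, interior_Icc]

lemma dsk_Box {N : ℤ} (hN : 0 < N) : Dsk (Box N) := by
  have : (0 : ℝ) < N := by exact_mod_cast hN
  apply dsk_convex
  · exact (convex_Icc _ _).prod (convex_Icc _ _)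
  · exact isCompact_Icc.prod isCompact_Icc
  · rw [interior_Box]
    exact (nonempty_Ioo.2 (by linarith)).prod (nonempty_Ioo.2 (by linarith))

/-- Integer coordinates whose unit interval contains `t`. -/
def fl (t : ℝ) : Finset ℤ := {⌊t⌋, ⌈t⌉ - 1}

lemma mem_fl {t : ℝ} {n : ℤ} (h : (n : ℝ) ≤ t) (h' : t ≤ n + 1) : n ∈ fl t := by
  have h1 : n ≤ ⌊t⌋ := Int.le_floor.2 h
  have h2 : ⌈t⌉ ≤ n + 1 := Int.ceil_le.2 (by push_cast; exact h')
  have h3 : ⌊t⌋ ≤ ⌈t⌉ := Int.floor_le_ceil t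
  have h4 : ⌈t⌉ ≤ ⌊t⌋ + 1 := Int.ceil_le_floor_add_one t
  simp only [fl, Finset.mem_insert, Finset.mem_singleton]
  omega

lemma card_fl (t : ℝ) : (fl t).card ≤ 2 := Finset.card_le_two

lemma card_fl' {t : ℝ} (h : t ∉ range ((↑) : ℤ → ℝ)) : (fl t).card ≤ 1 := by
  have h3 : ⌊t⌋ ≤ ⌈t⌉ := Int.floor_le_ceil t
  have h4 : ⌈t⌉ ≤ ⌊t⌋ + 1 := Int.ceil_le_floor_add_one t
  have : ⌈t⌉ ≠ ⌊t⌋ := by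
    intro e
    apply h
    refine ⟨⌊t⌋, le_antisymm (Int.floor_le t) ?_⟩
    rw [← e]; exact Int.le_ceil t
  have : ⌈t⌉ - 1 = ⌊t⌋ := by omega
  simp [fl, this]

/-- The finite set of cells containing `z`. -/
def cz (z : ℝ × ℝ) : Finset (ℤ × ℤ) := fl z.1 ×ˢ fl z.2

lemma mem_cz {z : ℝ × ℝ} {c : ℤ × ℤ} (h : z ∈ Q c) : c ∈ cz z := by
  rw [mem_Q] at h
  exact Finset.mem_product.2 ⟨mem_fl h.1.1 h.1.2, mem_fl h.2.1 h.2.2⟩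

lemma card_cz (z : ℝ × ℝ) : (cz z).card ≤ 4 := by
  rw [cz, Finset.card_product]
  nlinarith [card_fl z.1, card_fl z.2]

lemma card_cz' {z : ℝ × ℝ} (h : ¬ (z.1 ∈ range ((↑) : ℤ → ℝ) ∧ z.2 ∈ range ((↑) : ℤ → ℝ))) : (cz z).card ≤ 2 := by
  rw [cz, Finset.card_product]
  by_cases h1 : z.1 ∈ range ((↑) : ℤ → ℝ)
  · have h2 := card_fl' (fun h2 => h ⟨h1, h2⟩)
    nlinarith [card_fl z.1]
  · have h2 := card_fl' h1
    nlinarith [card_fl z.2]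

lemma bdry_cells {N : ℤ} {z : ℝ × ℝ} (h : z ∈ Box N) (h' : z ∉ interior (Box N)) :
    {c | c ∈ BoxC N ∧ z ∈ Q c}.ncard ≤ 3 := by
  classical
  have hs : ∃ c0 ∈ cz z, c0 ∉ BoxC N := by
    by_contra hcon
    push Not at hcon
    apply h'
    rw [interior_Box]
    have a := hcon (⌊z.1⌋, ⌊z.2⌋) (by simp [cz, fl])
    have b := hcon (⌈z.1⌉ - 1, ⌈z.2⌉ - 1) (by simp [cz, fl])
    rw [mem_BoxC] at a b
    simp only at a b
    refine ⟨⟨?_, ?_⟩, ?_, ?_⟩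
    · have := Int.lt_ceil.1 (show -N < ⌈z.1⌉ by omega); push_cast at this; exact this
    · exact Int.floor_lt.1 a.1.2
    · have := Int.lt_ceil.1 (show -N < ⌈z.2⌉ by omega); push_cast at this; exact this
    · exact Int.floor_lt.1 a.2.2
  obtain ⟨c0, h0, h0'⟩ := hs
  have : {c | c ∈ BoxC N ∧ z ∈ Q c} ⊆ ((cz z).erase c0 : Finset _) := by
    rintro c ⟨hc, hz⟩
    rw [Finset.mem_coe, Finset.mem_erase]
    exact ⟨fun e => h0' (e ▸ hc), mem_cz hz⟩
  refine (ncard_le_ncard this (Finset.finite_toSet _)).trans ?_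
  rw [ncard_coe_finset, Finset.card_erase_of_mem h0]
  have := card_cz z
  omega

end Plan

namespace Plan
open Filter Topology

/-- An arrangement of planar discs filling a disc, with prescribed touching. -/
structure Arr {V C : Type} (touch : V → V → Prop) (W : Set (ℝ × ℝ)) (reg : V ⊕ C → Set (ℝ × ℝ)) : Prop where
  box : Dsk W
  dsk : ∀ r, Dsk (reg r)
  int : ∀ r s, r ≠ s → interior (reg r ∩ reg s) = ∅
  cover : ⋃ r, reg r = W
  four : ∀ z, {r | z ∈ reg r}.ncard ≤ 4
  three : ∀ z ∈ W, z ∉ interior W → {r | z ∈ reg r}.ncard ≤ 3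
  touch_iff : ∀ u v, u ≠ v → ((reg (.inl u) ∩ reg (.inl v)).Nonempty ↔ touch u v)

lemma interior_iUnion_empty {ι : Type} [Countable ι] (s : ι → Set (ℝ × ℝ)) (hc : ∀ i, IsClosed (s i))
    (h : ∀ i, interior (s i) = ∅) : interior (⋃ i, s i) = ∅ := by
  rw [interior_eq_empty_iff_dense_compl, compl_iUnion]
  exact dense_iInter_of_isOpen (fun i => (hc i).isOpen_compl)
    (fun i => interior_eq_empty_iff_dense_compl.1 (h i))

lemma side_preconn (q d : ℤ × ℤ) : IsPreconnected (side q d) :=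
  isPreconnected_Icc.image _ (sideMap_cont q d).continuousOn

lemma side_nonempty (q d : ℤ × ℤ) : (side q d).Nonempty := ⟨_, 0, ⟨le_rfl, zero_le_one⟩, rfl⟩

lemma side_closed (q d : ℤ × ℤ) : IsClosed (side q d) :=
  (isCompact_Icc.image (sideMap_cont q d)).isClosed

lemma exists_box {H : Type} [Finite H] {P : H → Set (ℤ × ℤ)} (hf : ∀ h, (P h).Finite) :
    ∃ N : ℤ, 0 < N ∧ ∀ h, P h ⊆ BoxC N := by
  have hfin : (⋃ h, P h).Finite := finite_iUnion hf
  obtain ⟨M, hM⟩ := (hfin.image (fun c : ℤ × ℤ => |c.1| + |c.2|)).bddAbove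
  refine ⟨max M 0 + 1, by positivity, ?_⟩
  intro h c hc
  have := hM ⟨c, mem_iUnion.2 ⟨h, hc⟩, rfl⟩
  simp only at this
  have h1 := abs_le.1 (le_refl |c.1|)
  have h2 := abs_le.1 (le_refl |c.2|)
  have h3 := abs_nonneg c.1
  have h4 := abs_nonneg c.2
  have h5 := le_max_left M 0
  rw [mem_BoxC]
  omega

theorem arr {V X : Type} [Finite V] [Finite X] {B : V → V → Prop} {nb : X → Fin 4 → V}
    (hnb : ∀ x, Function.Injective (nb x)) {P : V ⊕ X → Set (ℤ × ℤ)} (hP : Contacts (Rel B nb) P) :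
    ∃ (C : Type) (_ : Finite C) (W : Set (ℝ × ℝ)) (reg : V ⊕ C → Set (ℝ × ℝ)),
      Arr (fun u v => B u v ∨ ∃ x k l, nb x k = u ∧ nb x l = v) W reg := by
  classical
  obtain ⟨N0, hN0, hPN0⟩ := exists_box hP.fin
  set N := N0 + 1 with hN
  have hNpos : 0 < N := by omega
  have hPN : ∀ h, P h ⊆ BoxC N := by
    intro h c hc
    have := hPN0 h hc
    rw [mem_BoxC] at *; omega
  have hPint : ∀ h, U (P h) ⊆ interior (Box N) := by
    intro h z hz
    have h1 : z ∈ Box N0 := U_BoxC hN0 ▸ U_mono (hPN0 h) hz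
    rw [mem_Box] at h1
    rw [interior_Box]
    have : (N : ℝ) = N0 + 1 := by rw [hN]; push_cast; ring
    refine ⟨⟨?_, ?_⟩, ?_, ?_⟩ <;> rw [this] <;> linarith [h1.1.1, h1.1.2, h1.2.1, h1.2.2]
  -- integer points
  set Z : Set (ℝ × ℝ) := (fun c : ℤ × ℤ => ((c.1 : ℝ), (c.2 : ℝ))) '' (Icc (-N) N ×ˢ Icc (-N) N) with hZ
  have hZf : Z.Finite := (((finite_Icc _ _).prod (finite_Icc _ _))).image _
  -- sectors
  have hintr : ∀ h h', h ≠ h' → interior (U (P h) ∩ U (P h')) = ∅ :=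
    fun h h' hne => interior_U_inter (hP.disj h h' hne)
  have hnI : ∀ h h', h ≠ h' → ∀ z ∈ U (P h'), z ∉ interior (U (P h)) :=
    fun h h' hne z hz => not_mem_interior_left (hP.dsk h') (hintr h h' hne) hz
  have hsec : ∀ x, ∃ S, Sectors (U (P (.inr x))) (fun k => U (P (.inr x)) ∩ U (P (.inl (nb x k)))) Z S := by
    intro x
    have hside : ∀ k, ∃ q d, Dir d ∧ U (P (.inr x)) ∩ U (P (.inl (nb x k))) = side q d :=
      fun k => hP.con (.inr x) (.inl (nb x k)) ⟨k, rfl⟩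
    refine sectors (hP.dsk _) ?_ ?_ ?_ ?_ ?_ hZf
    · intro k; obtain ⟨q, d, _, e⟩ := hside k; rw [e]; exact side_preconn q d
    · intro k; obtain ⟨q, d, _, e⟩ := hside k; rw [e]; exact side_closed q d
    · intro k; obtain ⟨q, d, _, e⟩ := hside k; rw [e]; exact side_nonempty q d
    · rintro k z ⟨h1, h2⟩
      exact ⟨h1, hnI _ _ (by simp) z h2⟩
    · intro j k hjk
      rw [← subset_empty_iff, ← hP.three (.inr x) (.inl (nb x j)) (.inl (nb x k)) (by simp) (by simp)
        (by simpa using fun h => hjk (hnb x h))]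
      rintro z ⟨⟨h1, h2⟩, _, h3⟩
      exact ⟨⟨h1, h2⟩, h3⟩
  choose S hS using hsec
  have hSD : ∀ x k, S x k ⊆ U (P (.inr x)) := fun x k => (subset_iUnion (S x) k).trans (hS x).cover.subset
  have hSS : ∀ x y, x ≠ y → ∀ k l z, z ∈ S x k → z ∈ S y l → False := by
    intro x y hxy k l z h1 h2
    have := hP.not (.inr x) (.inr y) (by simpa using hxy) (fun h => h)
    exact (eq_empty_iff_forall_notMem.1 this) z ⟨hSD _ _ h1, hSD _ _ h2⟩
  -- atoms
  set Hole : Set (ℤ × ℤ) := {c | c ∈ BoxC N ∧ ∀ h, c ∉ P h} with hHole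
  have hboxf : (BoxC N).Finite := (finite_Ico _ _).prod (finite_Ico _ _)
  have hHf : Finite Hole := (hboxf.subset (fun c hc => hc.1)).to_subtype
  set own : V ⊕ (X × Fin 4) ⊕ Hole → V ⊕ Hole := fun a => match a with
    | .inl v => .inl v
    | .inr (.inl (x, k)) => .inl (nb x k)
    | .inr (.inr q) => .inr q with hown
  set at' : V ⊕ (X × Fin 4) ⊕ Hole → Set (ℝ × ℝ) := fun a => match a with
    | .inl v => U (P (.inl v))
    | .inr (.inl (x, k)) => S x k
    | .inr (.inr q) => Q q with hat
  set body : V ⊕ (X × Fin 4) ⊕ Hole → Set (ℤ × ℤ) := fun a => match a with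
    | .inl v => P (.inl v)
    | .inr (.inl (x, k)) => P (.inr x)
    | .inr (.inr q) => {(q : ℤ × ℤ)} with hbody
  have hatbody : ∀ a, at' a ⊆ U (body a) := by
    rintro (v | ⟨x, k⟩ | q)
    · exact subset_rfl
    · exact hSD x k
    · simp only [hat, hbody, U_singleton]; exact subset_rfl
  have hatd : ∀ a, Dsk (at' a) := by
    rintro (v | ⟨x, k⟩ | q)
    · exact hP.dsk _
    · exact (hS x).dsk k
    · exact dsk_Q _
  have hatc : ∀ a, IsClosed (at' a) := fun a => (hatd a).compact.isClosed
  have hbodyd : ∀ a b, a ≠ b → (Disjoint (body a) (body b)) ∨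
      ∃ x k l, k ≠ l ∧ a = .inr (.inl (x, k)) ∧ b = .inr (.inl (x, l)) := by
    rintro (v | ⟨x, k⟩ | q) (w | ⟨y, l⟩ | q') hab
    · left; exact hP.disj _ _ (by simpa using hab)
    · left; exact hP.disj _ _ (by simp)
    · left; exact disjoint_singleton_right.2 (q'.2.2 _)
    · left; exact hP.disj _ _ (by simp)
    · by_cases hxy : x = y
      · right; subst hxy; exact ⟨x, k, l, fun h => hab (by rw [h]), rfl, rfl⟩
      · left; exact hP.disj _ _ (by simpa using hxy)
    · left; exact disjoint_singleton_right.2 (q'.2.2 _)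
    · left; exact disjoint_singleton_left.2 (q.2.2 _)
    · left; exact disjoint_singleton_left.2 (q.2.2 _)
    · left
      refine disjoint_singleton.2 fun h => hab ?_
      rw [Subtype.ext h]
  have hatint : ∀ a b, a ≠ b → interior (at' a ∩ at' b) = ∅ := by
    intro a b hab
    rcases hbodyd a b hab with h | ⟨x, k, l, hkl, rfl, rfl⟩
    · exact subset_empty_iff.1 ((interior_mono (inter_subset_inter (hatbody a) (hatbody b))).trans
        (interior_U_inter h).subset)
    · exact (hS x).int k l hkl
  set reg : V ⊕ Hole → Set (ℝ × ℝ) := fun r => ⋃ a : {a // own a = r}, at' a with hreg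
  have mem_reg : ∀ r z, z ∈ reg r ↔ ∃ a, own a = r ∧ z ∈ at' a := by
    intro r z
    simp only [hreg, mem_iUnion, Subtype.exists, exists_prop]
  have hregsub : ∀ z, {r | z ∈ reg r} ⊆ own '' {a | z ∈ at' a} := by
    intro z r hr
    obtain ⟨a, h1, h2⟩ := (mem_reg r z).1 hr
    exact ⟨a, h2, h1⟩
  have hle : ∀ z n, {a | z ∈ at' a}.ncard ≤ n → {r | z ∈ reg r}.ncard ≤ n := fun z n h =>
    (ncard_le_ncard (hregsub z) (toFinite _)).trans ((ncard_image_le (toFinite _)).trans h)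
  have hatbox : ∀ a, at' a ⊆ Box N := by
    intro a
    refine (hatbody a).trans ?_
    rw [← U_BoxC hNpos]
    apply U_mono
    rcases a with v | ⟨x, k⟩ | q
    · exact hPN _
    · exact hPN _
    · rintro c rfl; exact q.2.1
  refine ⟨Hole, hHf, Box N, reg, dsk_Box hNpos, ?_, ?_, ?_, ?_, ?_, ?_⟩
  · rintro (v | q)
    · -- discs of vertices
      have key : ∀ s : Finset (X × Fin 4), (∀ a ∈ s, nb a.1 a.2 = v) →
          Dsk (U (P (.inl v)) ∪ ⋃ a ∈ s, S a.1 a.2) := by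
        intro s
        induction s using Finset.induction_on with
        | empty => intro _; simpa using hP.dsk _
        | @insert a s has ih =>
          intro hs
          have ih' := ih fun b hb => hs b (Finset.mem_insert_of_mem hb)
          obtain ⟨x, k⟩ := a
          have hv : nb x k = v := hs (x, k) (Finset.mem_insert_self _ _)
          obtain ⟨q, d, hd, e⟩ := hP.con (.inr x) (.inl (nb x k)) ⟨k, rfl⟩
          have hAB : (U (P (.inl v)) ∪ ⋃ a ∈ s, S a.1 a.2) ∩ S x k = U (P (.inr x)) ∩ U (P (.inl (nb x k))) := by
            ext z
            constructor
            · rintro ⟨h1 | h1, h2⟩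
              · rw [hv]; exact ⟨hSD _ _ h2, h1⟩
              · exfalso
                simp only [mem_iUnion, exists_prop] at h1
                obtain ⟨⟨y, l⟩, hb, h1⟩ := h1
                by_cases hxy : x = y
                · subst hxy
                  have : nb x l = v := hs (x, l) (Finset.mem_insert_of_mem hb)
                  have : k = l := hnb x (hv.trans this.symm)
                  subst this; exact has hb
                · exact hSS x y hxy _ _ z h2 h1
            · intro h
              refine ⟨Or.inl ?_, (hS x).K_sub k h⟩
              rw [← hv]; exact h.2
          have : U (P (.inl v)) ∪ ⋃ a ∈ insert (x, k) s, S a.1 a.2 =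
              (U (P (.inl v)) ∪ ⋃ a ∈ s, S a.1 a.2) ∪ S x k := by
            rw [Finset.set_biUnion_insert, union_assoc, union_comm (S x k)]
          rw [this]
          refine glue ih' ((hS x).dsk k) (b := sideMap q d) (sideMap_cont q d).continuousOn (sideMap_inj hd).injOn
            (hAB.trans e) ?_
          rw [hAB]
          exact hintr _ _ (by simp)
      have := Fintype.ofFinite X
      have h2 := key (Finset.univ.filter fun a => nb a.1 a.2 = v) (by simp)
      convert h2 using 1
      ext z
      rw [mem_reg]
      simp only [mem_union, mem_iUnion, Finset.mem_filter, Finset.mem_univ, true_and, exists_prop]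
      constructor
      · rintro ⟨w | ⟨x, k⟩ | q, h1, hz2⟩
        · simp only [hown, Sum.inl.injEq] at h1; subst h1; exact Or.inl hz2
        · simp only [hown, Sum.inl.injEq] at h1; exact Or.inr ⟨(x, k), h1, hz2⟩
        · simp [hown] at h1
      · rintro (h | ⟨⟨x, k⟩, h1, h2⟩)
        · exact ⟨.inl v, rfl, h⟩
        · exact ⟨.inr (.inl (x, k)), by simp only [hown]; rw [← h1], h2⟩
    · have : reg (.inr q) = Q q := by
        ext z
        rw [mem_reg]
        constructor
        · rintro ⟨w | ⟨x, k⟩ | q', h1, h2⟩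
          · simp [hown] at h1
          · simp [hown] at h1
          · simp only [hown, Sum.inr.injEq] at h1; subst h1; exact h2
        · intro h; exact ⟨.inr (.inr q), rfl, h⟩
      rw [this]; exact dsk_Q _
  · intro r s hrs
    have h1 : reg r ∩ reg s ⊆ ⋃ p : {p : (V ⊕ (X × Fin 4) ⊕ Hole) × (V ⊕ (X × Fin 4) ⊕ Hole) // p.1 ≠ p.2},
        at' p.1.1 ∩ at' p.1.2 := by
      rintro z ⟨h1, h2⟩
      obtain ⟨a, e1, h1⟩ := (mem_reg _ _).1 h1
      obtain ⟨b, e2, h2⟩ := (mem_reg _ _).1 h2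
      refine mem_iUnion.2 ⟨⟨(a, b), ?_⟩, h1, h2⟩
      rintro h
      simp only at h
      exact hrs (by rw [← e1, ← e2, h])
    refine subset_empty_iff.1 ((interior_mono h1).trans ?_)
    rw [interior_iUnion_empty _ (fun p => (hatc _).inter (hatc _)) (fun p => hatint _ _ p.2)]
  · ext z
    simp only [mem_iUnion, mem_reg]
    constructor
    · rintro ⟨r, a, _, h⟩; exact hatbox a h
    · intro hz
      rw [← U_BoxC hNpos] at hz
      obtain ⟨c, hc, hz⟩ := mem_U.1 hz
      by_cases hcP : ∃ h, c ∈ P h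
      · obtain ⟨h, hcP⟩ := hcP
        have hzU : z ∈ U (P h) := mem_U.2 ⟨c, hcP, hz⟩
        rcases h with v | x
        · exact ⟨_, .inl v, rfl, hzU⟩
        · rw [← (hS x).cover] at hzU
          obtain ⟨k, hk⟩ := mem_iUnion.1 hzU
          exact ⟨_, .inr (.inl (x, k)), rfl, hk⟩
      · push Not at hcP
        exact ⟨_, .inr (.inr ⟨c, hc, hcP⟩), rfl, hz⟩
  · intro z
    apply hle
    by_cases hzi : ∃ x, z ∈ interior (U (P (.inr x)))
    · obtain ⟨x, hx⟩ := hzi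
      have : {a | z ∈ at' a} ⊆ range (fun k : Fin 4 => (.inr (.inl (x, k)) : V ⊕ (X × Fin 4) ⊕ Hole)) := by
        rintro (v | ⟨y, k⟩ | q) h
        · exact absurd hx (hnI _ _ (by simp) z h)
        · by_cases hxy : x = y
          · subst hxy; exact ⟨k, rfl⟩
          · exact absurd hx (hnI _ (.inr y) (by simpa using hxy) z (hSD _ _ h))
        · refine absurd hx (not_mem_interior_left (dsk_Q q) ?_ h)
          rw [← U_singleton]
          exact interior_U_inter (disjoint_singleton_right.2 (q.2.2 _))
      refine (ncard_le_ncard this (toFinite _)).trans ?_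
      rw [← image_univ]
      refine (ncard_image_le (toFinite _)).trans ?_
      simp [ncard_univ]
    · push Not at hzi
      have := Fintype.ofFinite V
      have := Fintype.ofFinite X
      have := Fintype.ofFinite Hole
      have hm : ∃ m, (∀ x, z ∈ U (P (.inr x)) → {k | z ∈ S x k}.ncard ≤ m) ∧ 1 ≤ m ∧ (cz z).card * m ≤ 4 := by
        by_cases hintr : z.1 ∈ range ((↑) : ℤ → ℝ) ∧ z.2 ∈ range ((↑) : ℤ → ℝ)
        · refine ⟨1, ?_, le_rfl, by linarith [card_cz z]⟩
          intro x hx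
          refine (hS x).one z hx (hzi x) ?_
          have hb := interior_subset (hPint _ hx)
          rw [mem_Box] at hb
          obtain ⟨⟨n, hn⟩, m, hm⟩ := hintr
          refine ⟨(n, m), ⟨⟨?_, ?_⟩, ?_, ?_⟩, Prod.ext hn hm⟩
          · rw [← hn] at hb; exact_mod_cast hb.1.1
          · rw [← hn] at hb; exact_mod_cast hb.1.2
          · rw [← hm] at hb; exact_mod_cast hb.2.1
          · rw [← hm] at hb; exact_mod_cast hb.2.2
        · exact ⟨2, fun x hx => (hS x).two z hx (hzi x), by norm_num, by linarith [card_cz' hintr]⟩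
      obtain ⟨m, hm, h1m, hm4⟩ := hm
      have hsub : {a | z ∈ at' a} ⊆
          ((cz z).biUnion fun c => Finset.univ.filter fun a => z ∈ at' a ∧ c ∈ body a : Finset _) := by
        intro a ha
        obtain ⟨c, hc, hz⟩ := mem_U.1 (hatbody a ha)
        simp only [Finset.coe_biUnion, mem_iUnion, Finset.coe_filter, Finset.mem_univ, true_and,
          mem_ofPred_eq, exists_prop]
        exact ⟨c, mem_cz hz, ha, hc⟩
      refine (ncard_le_ncard hsub (Finset.finite_toSet _)).trans ?_
      rw [ncard_coe_finset]
      refine (Finset.card_biUnion_le_card_mul _ _ m ?_).trans hm4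
      intro c _
      by_cases hex : ∃ x k, z ∈ S x k ∧ c ∈ P (.inr x)
      · obtain ⟨x, k, hk, hc⟩ := hex
        have hs : (Finset.univ.filter fun a => z ∈ at' a ∧ c ∈ body a) ⊆
            (Finset.univ.filter fun k => z ∈ S x k).image
              (fun k : Fin 4 => (.inr (.inl (x, k)) : V ⊕ (X × Fin 4) ⊕ Hole)) := by
          intro a ha
          simp only [Finset.mem_filter, Finset.mem_univ, true_and] at ha
          simp only [Finset.mem_image, Finset.mem_filter, Finset.mem_univ, true_and]
          by_cases hax : (.inr (.inl (x, k)) : V ⊕ (X × Fin 4) ⊕ Hole) = a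
          · exact ⟨k, hk, hax⟩
          rcases hbodyd _ a hax with h | ⟨x', k', l', _, e1, e2⟩
          · exact absurd ha.2 (disjoint_left.1 h hc)
          · simp only [Sum.inr.injEq, Sum.inl.injEq, Prod.mk.injEq] at e1
            obtain ⟨rfl, rfl⟩ := e1
            subst e2
            exact ⟨l', ha.1, rfl⟩
        refine (Finset.card_le_card hs).trans (Finset.card_image_le.trans ?_)
        have := hm x (hSD _ _ hk)
        rwa [ncard_eq_toFinset_card', Set.toFinset_ofPred] at this
      · refine le_trans (Finset.card_le_one.2 ?_) h1m
        intro a ha b hb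
        simp only [Finset.mem_filter, Finset.mem_univ, true_and] at ha hb
        by_contra hab
        rcases hbodyd a b hab with h | ⟨x', k', l', _, e1, e2⟩
        · exact disjoint_left.1 h ha.2 hb.2
        · subst e1; exact hex ⟨x', k', ha.1, ha.2⟩
  · intro z hz hzi
    apply hle
    have hsub : ∀ a, z ∈ at' a → ∃ q : Hole, a = .inr (.inr q) := by
      rintro (v | ⟨y, k⟩ | q) h
      · exact absurd (hPint _ h) hzi
      · exact absurd (hPint _ (hSD _ _ h)) hzi
      · exact ⟨q, rfl⟩
    refine le_trans ?_ (bdry_cells hz hzi)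
    refine ncard_le_ncard_of_injOn (fun a => match a with
      | .inr (.inr q) => (q : ℤ × ℤ)
      | _ => 0) ?_ ?_ (hboxf.subset fun c hc => hc.1)
    · intro a ha
      obtain ⟨q, rfl⟩ := hsub a ha
      exact ⟨q.2.1, ha⟩
    · intro a ha b hb h
      obtain ⟨q, rfl⟩ := hsub a ha
      obtain ⟨q', rfl⟩ := hsub b hb
      simp only at h
      rw [Subtype.ext h]
  · intro u v huv
    constructor
    · rintro ⟨z, g1, g2⟩
      obtain ⟨a, e1, h1⟩ := (mem_reg _ _).1 g1
      obtain ⟨b, e2, h2⟩ := (mem_reg _ _).1 g2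
      clear g1 g2
      have hRel : ∀ h h', h ≠ h' → z ∈ U (P h) → z ∈ U (P h') → Rel B nb h h' := by
        intro h h' hne m1 m2
        by_contra hr
        exact (eq_empty_iff_forall_notMem.1 (hP.not h h' hne hr)) z ⟨m1, m2⟩
      rcases a with w | ⟨x, k⟩ | q <;> rcases b with w' | ⟨y, l⟩ | q' <;>
        simp only [hown, Sum.inl.injEq, reduceCtorEq] at e1 e2
      · subst e1 e2
        left; exact hRel (.inl w) (.inl w') (by simpa using huv) h1 h2
      · subst e1
        obtain ⟨k, hk⟩ := hRel (.inl w) (.inr y) (by simp) h1 (hSD _ _ h2)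
        exact Or.inr ⟨y, k, l, hk, e2⟩
      · subst e2
        obtain ⟨l, hl⟩ := hRel (.inl w') (.inr x) (by simp) h2 (hSD _ _ h1)
        exact Or.inr ⟨x, k, l, e1, hl⟩
      · by_cases hxy : x = y
        · subst hxy; exact Or.inr ⟨x, k, l, e1, e2⟩
        · exact (hSS x y hxy _ _ z h1 h2).elim
    · rintro (h | ⟨x, k, l, rfl, rfl⟩)
      · obtain ⟨q, d, _, e⟩ := hP.con (.inl u) (.inl v) h
        obtain ⟨z, hz⟩ := side_nonempty q d
        rw [← e] at hz
        exact ⟨z, (mem_reg _ _).2 ⟨.inl u, rfl, hz.1⟩, (mem_reg _ _).2 ⟨.inl v, rfl, hz.2⟩⟩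
      · obtain ⟨z, hz⟩ := (hS x).common
        rw [mem_iInter] at hz
        exact ⟨z, (mem_reg _ _).2 ⟨.inr (.inl (x, k)), rfl, hz k⟩,
          (mem_reg _ _).2 ⟨.inr (.inl (x, l)), rfl, hz l⟩⟩

end Plan

namespace Plan
open Filter Topology

/-- Inverse stereographic projection, possibly reflected. -/
def hv (σ : ℝ) (w : ℂ) : EuclideanSpace ℝ (Fin 3) :=
  !₂[2 * w.re / (1 + Complex.normSq w), 2 * w.im / (1 + Complex.normSq w),
    σ * ((1 - Complex.normSq w) / (1 + Complex.normSq w))]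

lemma nsq_pos (w : ℂ) : 0 < 1 + Complex.normSq w := by linarith [Complex.normSq_nonneg w]

lemma hv_norm {σ : ℝ} (hσ : σ ^ 2 = 1) (w : ℂ) : ‖hv σ w‖ = 1 := by
  rw [EuclideanSpace.norm_eq, Real.sqrt_eq_one, Fin.sum_univ_three]
  have := nsq_pos w
  simp only [hv, Real.norm_eq_abs, sq_abs]
  simp only [PiLp.toLp_apply, Matrix.cons_val_zero, Matrix.cons_val_one, Matrix.cons_val]
  rw [mul_pow, hσ]
  field_simp
  rw [Complex.normSq_apply]
  ring

lemma hv_cont (σ : ℝ) : Continuous (hv σ) := by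
  unfold hv
  refine (PiLp.continuous_toLp 2 _).comp ?_
  refine continuous_pi fun i => ?_
  have hn : Continuous fun w : ℂ => 1 + Complex.normSq w := continuous_const.add Complex.continuous_normSq
  have h0 : ∀ w : ℂ, 1 + Complex.normSq w ≠ 0 := fun w => (nsq_pos w).ne'
  fin_cases i
  · exact (continuous_const.mul Complex.continuous_re).div hn h0
  · exact (continuous_const.mul Complex.continuous_im).div hn h0
  · exact continuous_const.mul ((continuous_const.sub Complex.continuous_normSq).div hn h0)

/-- The upper chart. -/
def up (w : ℂ) : SpherePt := ⟨hv 1 w, by rw [mem_sphere_zero_iff_norm]; exact hv_norm (by norm_num) w⟩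

/-- The lower chart. -/
def low (w : ℂ) : SpherePt := ⟨hv (-1) w, by rw [mem_sphere_zero_iff_norm]; exact hv_norm (by norm_num) w⟩

lemma up_cont : Continuous up := (hv_cont 1).subtype_mk _

lemma low_cont : Continuous low := (hv_cont (-1)).subtype_mk _

lemma hv_inj {σ : ℝ} (hσ : σ ≠ 0) : Function.Injective (hv σ) := by
  intro w w' h
  have p := nsq_pos w
  have p' := nsq_pos w'
  have h0 := congrArg (fun v : EuclideanSpace ℝ (Fin 3) => v 0) h
  have h1 := congrArg (fun v : EuclideanSpace ℝ (Fin 3) => v 1) h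
  have h2 := congrArg (fun v : EuclideanSpace ℝ (Fin 3) => v 2) h
  simp only [hv, PiLp.toLp_apply, Matrix.cons_val_zero, Matrix.cons_val_one, Matrix.cons_val] at h0 h1 h2
  have h2 := mul_left_cancel₀ hσ h2
  rw [div_eq_div_iff p.ne' p'.ne'] at h2
  have hn : Complex.normSq w = Complex.normSq w' := by linarith
  rw [hn] at h0 h1
  rw [div_left_inj' p'.ne'] at h0 h1
  apply Complex.ext <;> linarith

lemma up_inj : Function.Injective up := fun w w' h => hv_inj one_ne_zero (Subtype.ext_iff.1 h)

lemma low_inj : Function.Injective low :=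
  fun w w' h => hv_inj (neg_ne_zero.2 one_ne_zero) (Subtype.ext_iff.1 h)

/-- Height of a point of the sphere. -/
def ht (p : SpherePt) : ℝ := (p : EuclideanSpace ℝ (Fin 3)) 2

lemma ht_up (w : ℂ) : ht (up w) = (1 - Complex.normSq w) / (1 + Complex.normSq w) := by
  simp [ht, up, hv]

lemma ht_low (w : ℂ) : ht (low w) = -((1 - Complex.normSq w) / (1 + Complex.normSq w)) := by
  simp [ht, low, hv]

lemma nsq_le {w : ℂ} (h : ‖w‖ ≤ 1) : Complex.normSq w ≤ 1 := by
  rw [Complex.normSq_eq_norm_sq]; nlinarith [norm_nonneg w]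

lemma ht_up_nonneg {w : ℂ} (h : ‖w‖ ≤ 1) : 0 ≤ ht (up w) := by
  rw [ht_up]; exact div_nonneg (by linarith [nsq_le h]) (nsq_pos w).le

lemma ht_low_nonpos {w : ℂ} (h : ‖w‖ ≤ 1) : ht (low w) ≤ 0 := by
  rw [ht_low, neg_nonpos]; exact div_nonneg (by linarith [nsq_le h]) (nsq_pos w).le

lemma norm_of_ht {w : ℂ} (h : ht (up w) = 0) : ‖w‖ = 1 := by
  rw [ht_up, div_eq_zero_iff] at h
  have h1 : Complex.normSq w = 1 := by
    rcases h with h | h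
    · linarith
    · linarith [nsq_pos w]
  rw [Complex.normSq_eq_norm_sq] at h1
  nlinarith [norm_nonneg w]

lemma sphere_cases (p : SpherePt) : (∃ w : ℂ, ‖w‖ ≤ 1 ∧ up w = p) ∨ ∃ w : ℂ, ‖w‖ ≤ 1 ∧ low w = p := by
  have hp : ‖(p : EuclideanSpace ℝ (Fin 3))‖ = 1 := mem_sphere_zero_iff_norm.1 p.2
  rw [EuclideanSpace.norm_eq, Real.sqrt_eq_one, Fin.sum_univ_three] at hp
  simp only [Real.norm_eq_abs, sq_abs] at hp
  set a := (p : EuclideanSpace ℝ (Fin 3)) 0 with ha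
  set b := (p : EuclideanSpace ℝ (Fin 3)) 1 with hb
  set c := (p : EuclideanSpace ℝ (Fin 3)) 2 with hc
  have key : ∀ σ : ℝ, σ ^ 2 = 1 → 0 ≤ σ * c → ∃ w : ℂ, ‖w‖ ≤ 1 ∧ hv σ w = p := by
    intro σ hσ h0
    set s := 1 + σ * c with hs
    have hs1 : 0 < s := by linarith
    have hsc : (σ * c) ^ 2 = c ^ 2 := by rw [mul_pow, hσ, one_mul]
    have hns : Complex.normSq ⟨a / s, b / s⟩ = (1 - σ * c) / s := by
      rw [Complex.normSq_mk]
      field_simp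
      nlinarith
    have hns' : 1 + Complex.normSq ⟨a / s, b / s⟩ = 2 / s := by
      rw [hns]; field_simp; rw [hs]; ring
    refine ⟨⟨a / s, b / s⟩, ?_, ?_⟩
    · rw [← sq_le_one_iff₀ (norm_nonneg _), ← Complex.normSq_eq_norm_sq, hns, div_le_one hs1]
      linarith
    · ext i
      fin_cases i
      · simp only [hv, hns', PiLp.toLp_apply]
        change 2 * (a / s) / (2 / s) = a
        field_simp
      · simp only [hv, hns', PiLp.toLp_apply]
        change 2 * (b / s) / (2 / s) = b
        field_simp
      · simp only [hv, PiLp.toLp_apply]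
        rw [hns']
        rw [hns]
        change σ * ((1 - (1 - σ * c) / s) / (2 / s)) = c
        have : 1 - (1 - σ * c) / s = 2 * (σ * c) / s := by field_simp; rw [hs]; ring
        rw [this]
        field_simp
        rw [hσ]; ring
  rcases le_total 0 c with h | h
  · left
    obtain ⟨w, h1, h2⟩ := key 1 (by norm_num) (by linarith)
    exact ⟨w, h1, Subtype.ext h2⟩
  · right
    obtain ⟨w, h1, h2⟩ := key (-1) (by norm_num) (by linarith)
    exact ⟨w, h1, Subtype.ext h2⟩

lemma dsk_DD : Dsk DD := ⟨id, continuousOn_id, injOn_id _, by simp⟩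

theorem to_sphere {V C : Type} [Finite V] [Finite C] {touch : V → V → Prop} {W : Set (ℝ × ℝ)}
    {reg : V ⊕ C → Set (ℝ × ℝ)} (h : Arr touch W reg) (G : SimpleGraph V)
    (hG : ∀ u v, G.Adj u v ↔ u ≠ v ∧ touch u v) : IsKMapGraph G 4 := by
  obtain ⟨f, hf⟩ := h.box
  obtain ⟨g, hgc, hg1, hg2⟩ := hf.inv
  have hsub : ∀ r, reg r ⊆ W := fun r => (subset_iUnion reg r).trans h.cover.subset
  set Φ : ℝ × ℝ → SpherePt := fun z => up (g z) with hΦ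
  have hΦc : ContinuousOn Φ W := up_cont.comp_continuousOn hgc
  have hΦi : InjOn Φ W := by
    intro y hy y' hy' e
    have := up_inj e
    rw [← (hg2 y hy).2, ← (hg2 y' hy').2, this]
  have hht : ∀ z ∈ W, 0 ≤ ht (Φ z) := fun z hz => ht_up_nonneg (mem_DD.1 (hg2 z hz).1)
  set region : (V ⊕ C) ⊕ Unit → Set SpherePt := Sum.elim (fun r => Φ '' reg r) (fun _ => low '' DD) with hregion
  have hlow : ∀ p ∈ low '' DD, ht p ≤ 0 := by
    rintro _ ⟨w, hw, rfl⟩; exact ht_low_nonpos (mem_DD.1 hw)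
  have hmem : ∀ z ∈ W, ∀ r, Φ z ∈ Φ '' reg r ↔ z ∈ reg r := by
    intro z hz r
    constructor
    · rintro ⟨y, hy, e⟩; rwa [← hΦi (hsub r hy) hz e]
    · intro h; exact ⟨z, h, rfl⟩
  have heq : ∀ r, interior (Φ '' reg r ∩ low '' DD) = ∅ := by
    intro r
    have h1 : Φ '' reg r ∩ low '' DD ⊆ up '' Metric.sphere (0:ℂ) 1 := by
      rintro _ ⟨⟨z, hz, rfl⟩, h2⟩
      refine ⟨g z, ?_, rfl⟩
      rw [mem_sphere_zero_iff_norm]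
      exact norm_of_ht (le_antisymm (hlow _ h2) (hht z (hsub r hz)))
    refine subset_empty_iff.1 ((interior_mono h1).trans ?_)
    rw [interior_image_empty (isCompact_sphere _ _) up_cont.continuousOn up_inj.injOn
      (interior_sphere _ one_ne_zero)]
  let M : SphereMap ((V ⊕ C) ⊕ Unit) :=
    { region := region
      country := fun c => ∃ v : V, c = .inl (.inl v)
      disk := by
        rintro (r | _)
        · rw [isClosedDisk_iff]
          exact (h.dsk r).map (hΦc.mono (hsub r)) (hΦi.mono (hsub r))
        · rw [isClosedDisk_iff]
          exact dsk_DD.map low_cont.continuousOn low_inj.injOn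
      int_disjoint := by
        rintro (r | _) (s | _) hne
        · rw [← interior_inter]
          simp only [hregion, Sum.elim_inl]
          rw [← hΦi.image_inter (hsub r) (hsub s)]
          have hs : reg r ∩ reg s ⊆ W := inter_subset_left.trans (hsub r)
          exact interior_image_empty ((h.dsk r).compact.inter (h.dsk s).compact) (hΦc.mono hs) (hΦi.mono hs)
            (h.int r s (by simpa using hne))
        · rw [← interior_inter]; exact heq r
        · rw [← interior_inter, inter_comm]; exact heq s
        · exact absurd rfl hne
      cover := by
        rw [eq_univ_iff_forall]
        intro p
        rcases sphere_cases p with ⟨w, hw, rfl⟩ | ⟨w, hw, rfl⟩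
        · have hfW : f w ∈ W := hf.mem hw
          have : Φ (f w) = up w := by simp only [hΦ, hg1 w (mem_DD.2 hw)]
          rw [← h.cover] at hfW
          obtain ⟨r, hr⟩ := mem_iUnion.1 hfW
          exact mem_iUnion.2 ⟨.inl r, f w, hr, this⟩
        · exact mem_iUnion.2 ⟨.inr (), w, mem_DD.2 hw, rfl⟩ }
  have hMr : ∀ c, M.region c = region c := fun _ => rfl
  refine ⟨_, inferInstance, M, ?_, ?_⟩
  · intro p
    by_cases hpW : p ∈ Φ '' W
    · obtain ⟨z, hz, rfl⟩ := hpW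
      by_cases ho : Φ z ∈ low '' DD
      · have hn : ‖g z‖ = 1 := norm_of_ht (le_antisymm (hlow _ ho) (hht z hz))
        have hzi : z ∉ interior W := by
          have := hf.sphere hn
          rwa [(hg2 z hz).2] at this
        have hs : {c | Φ z ∈ M.region c} ⊆ insert (.inr ()) (Sum.inl '' {r | z ∈ reg r}) := by
          rintro (r | _) hc
          · right; exact ⟨r, (hmem z hz r).1 hc, rfl⟩
          · left; rfl
        refine (ncard_le_ncard hs (toFinite _)).trans ((ncard_insert_le _ _).trans ?_)
        have := ncard_image_le (f := (Sum.inl : V ⊕ C → (V ⊕ C) ⊕ Unit)) (toFinite {r | z ∈ reg r})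
        have := h.three z hz hzi
        omega
      · have hs : {c | Φ z ∈ M.region c} ⊆ Sum.inl '' {r | z ∈ reg r} := by
          rintro (r | _) hc
          · exact ⟨r, (hmem z hz r).1 hc, rfl⟩
          · exact absurd hc ho
        exact (ncard_le_ncard hs (toFinite _)).trans ((ncard_image_le (toFinite _)).trans (h.four z))
    · have hs : {c | p ∈ M.region c} ⊆ {.inr ()} := by
        rintro (r | _) hc
        · exact absurd (image_mono (hsub r) hc) hpW
        · rfl
      refine (ncard_le_ncard hs (toFinite _)).trans ?_
      rw [ncard_singleton]; norm_num
  · refine ⟨Equiv.ofBijective (fun v => ⟨.inl (.inl v), v, rfl⟩) ⟨?_, ?_⟩, ?_⟩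
    · intro u v e; simpa using e
    · rintro ⟨c, v, rfl⟩; exact ⟨v, rfl⟩
    · intro u v
      rw [hG]
      refine and_congr_right fun hne => ?_
      rw [← h.touch_iff u v hne]
      change _ ↔ (Φ '' reg (.inl u) ∩ Φ '' reg (.inl v)).Nonempty
      rw [← hΦi.image_inter (hsub _) (hsub _), image_nonempty]

theorem build {V X : Type} [Finite V] [Finite X] (G : SimpleGraph V) (B : V → V → Prop) (nb : X → Fin 4 → V)
    (hnb : ∀ x, Function.Injective (nb x)) (T : V ⊕ X → Set (ℤ × ℤ)) (hT : ∀ h, Conn (T h))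
    (hTd : ∀ h h', h ≠ h' → Disjoint (T h) (T h'))
    (hBs : ∀ u v, B u v → B v u) (hBi : ∀ u v, B u v → u ≠ v)
    (hB : ∀ u v, B u v → ∃ c ∈ T (.inl u), ∃ d, Dir d ∧ c + d ∈ T (.inl v))
    (hX : ∀ x k, ∃ c ∈ T (.inr x), ∃ d, Dir d ∧ c + d ∈ T (.inl (nb x k)))
    (hG : ∀ u v, G.Adj u v ↔ u ≠ v ∧ (B u v ∨ ∃ x k l, nb x k = u ∧ nb x l = v)) : IsKMapGraph G 4 := by
  obtain ⟨P, hP⟩ := contacts (Rel B nb) T hT hTd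
    (by rintro (u | x) (v | y) h <;> first | exact hBs _ _ h | exact h)
    (by rintro (u | x) (v | y) h <;> first | exact h.elim | simp | skip
        simpa using hBi _ _ h)
    (by rintro (u | x) (v | y) h
        · exact hB u v h
        · obtain ⟨k, rfl⟩ := h
          obtain ⟨c, hc, d, hd, h1⟩ := hX y k
          exact ⟨c + d, h1, -d, hd.neg, by simpa using hc⟩
        · obtain ⟨k, rfl⟩ := h
          exact hX x k
        · exact h.elim)
  obtain ⟨C, _, W, reg, hA⟩ := arr hnb hP
  exact to_sphere hA G hG

end Plan

namespace Plan
open Filter Topology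

/-- A grid step inside a set of cells. -/
def Step (T : Set (ℤ × ℤ)) (p q : ℤ × ℤ) : Prop := p ∈ T ∧ q ∈ T ∧ Dir (q - p)

/-- Reachability inside a set of cells. -/
def Path (T : Set (ℤ × ℤ)) : ℤ × ℤ → ℤ × ℤ → Prop := Relation.ReflTransGen (Step T)

lemma Step.symm {T : Set (ℤ × ℤ)} {p q : ℤ × ℤ} (h : Step T p q) : Step T q p :=
  ⟨h.2.1, h.1, by have := h.2.2.neg; rwa [neg_sub] at this⟩

lemma Path.symm {T : Set (ℤ × ℤ)} {p q : ℤ × ℤ} (h : Path T p q) : Path T q p := by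
  induction h with
  | refl => exact Relation.ReflTransGen.refl
  | tail _ hs ih => exact Relation.ReflTransGen.head hs.symm ih

lemma Path.mono {T T' : Set (ℤ × ℤ)} (h : T ⊆ T') {p q : ℤ × ℤ} (hp : Path T p q) : Path T' p q :=
  Relation.ReflTransGen.mono (fun _ _ hs => ⟨h hs.1, h hs.2.1, hs.2.2⟩) _ _ hp

lemma Path.exit {T S : Set (ℤ × ℤ)} {p q : ℤ × ℤ} (h : Path T p q) (hp : p ∈ S) (hq : q ∉ S) :
    ∃ a b, Step T a b ∧ a ∈ S ∧ b ∉ S := by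
  induction h with
  | refl => exact absurd hp hq
  | @tail b c _ hs ih =>
    by_cases hb : b ∈ S
    · exact ⟨b, c, hs, hb, hq⟩
    · exact ih hb

/-- Path-connected sets of cells. -/
def PC (T : Set (ℤ × ℤ)) : Prop := ∀ a ∈ T, ∀ b ∈ T, Path T a b

lemma PC.of_star {T : Set (ℤ × ℤ)} (a : ℤ × ℤ) (h : ∀ b ∈ T, Path T a b) : PC T :=
  fun b hb c hc => (h b hb).symm.trans (h c hc)

lemma PC.conn {T : Set (ℤ × ℤ)} (h : PC T) (hf : T.Finite) (hn : T.Nonempty) : Conn T := by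
  obtain ⟨a, ha⟩ := hn
  have hfs : {S | Conn S ∧ S ⊆ T}.Finite := hf.finite_subsets.subset fun S hS => hS.2
  obtain ⟨S, hS, hmax⟩ := hfs.exists_maximal ⟨{a}, Conn.single a, by simpa using ha⟩
  by_cases hST : T ⊆ S
  · rw [Subset.antisymm hST hS.2]; exact hS.1
  · obtain ⟨b, hb, hbS⟩ := not_subset.1 hST
    obtain ⟨s, hs⟩ := hS.1.nonempty
    obtain ⟨p, q, hpq, hp, hq⟩ := (h s (hS.2 hs) b hb).exit hs hbS
    have e : p + (q - p) = q := by abel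
    have hc : Conn (insert q S) := by
      have := Conn.add (d := q - p) hS.1 hp hpq.2.2 (by rwa [e])
      rwa [e] at this
    exact absurd (hmax ⟨hc, insert_subset hpq.2.1 hS.2⟩ (subset_insert _ _) (mem_insert _ _)) hq

/-- Cells near a set. -/
def nr (K : Set (ℝ × ℝ)) : Set (ℤ × ℤ) := {c | (Q c ∩ K).Nonempty}

/-- A cell containing the point. -/
def flc (z : ℝ × ℝ) : ℤ × ℤ := (⌊z.1⌋, ⌊z.2⌋)

lemma mem_flc (z : ℝ × ℝ) : z ∈ Q (flc z) :=
  mem_Q.2 ⟨⟨Int.floor_le _, (Int.lt_floor_add_one _).le⟩, Int.floor_le _, (Int.lt_floor_add_one _).le⟩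

lemma flc_mem {K : Set (ℝ × ℝ)} {z : ℝ × ℝ} (h : z ∈ K) : flc z ∈ nr K := ⟨z, mem_flc z, h⟩

lemma nr_finite {K : Set (ℝ × ℝ)} (hK : IsCompact K) : (nr K).Finite := by
  obtain ⟨r, hr⟩ := hK.isBounded.subset_closedBall 0
  refine ((finite_Icc (-⌈r⌉ - 1) ⌈r⌉).prod (finite_Icc (-⌈r⌉ - 1) ⌈r⌉)).subset ?_
  rintro c ⟨z, hz, hzK⟩
  have h1 := hr hzK
  rw [mem_closedBall_zero_iff, Prod.norm_def, max_le_iff, Real.norm_eq_abs, Real.norm_eq_abs, abs_le, abs_le] at h1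
  rw [mem_Q] at hz
  have h2 := Int.le_ceil r
  refine ⟨⟨?_, ?_⟩, ?_, ?_⟩ <;> rw [← @Int.cast_le ℝ] <;> push_cast <;> linarith [h1.1.1, h1.1.2, h1.2.1, h1.2.2, hz.1.1, hz.1.2, hz.2.1, hz.2.2]

lemma nr_PC {K : Set (ℝ × ℝ)} (hK : IsCompact K) (hp : IsPreconnected K) : PC (nr K) := by
  intro a ha b hb
  by_contra hab
  set R := {c ∈ nr K | Path (nr K) a c} with hR
  have hfin := nr_finite hK
  have hsub : K ⊆ U R ∪ U (nr K \ R) := by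
    intro z hz
    rw [← U_union]
    refine mem_U.2 ⟨flc z, ?_, mem_flc z⟩
    by_cases h : flc z ∈ R
    · exact Or.inl h
    · exact Or.inr ⟨flc_mem hz, h⟩
  have h1 := isPreconnected_closed_iff.1 hp (U R) (U (nr K \ R))
    (isCompact_U (hfin.subset fun c hc => hc.1)).isClosed (isCompact_U (hfin.subset fun c hc => hc.1)).isClosed hsub
    (by obtain ⟨z, hz, hzK⟩ := ha
        exact ⟨z, hzK, mem_U.2 ⟨a, ⟨⟨z, hz, hzK⟩, Relation.ReflTransGen.refl⟩, hz⟩⟩)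
    (by obtain ⟨z, hz, hzK⟩ := hb
        exact ⟨z, hzK, mem_U.2 ⟨b, ⟨⟨z, hz, hzK⟩, fun h => hab h.2⟩, hz⟩⟩)
  obtain ⟨z, hzK, hz1, hz2⟩ := h1
  obtain ⟨c, hc, hzc⟩ := mem_U.1 hz1
  obtain ⟨c', hc', hzc'⟩ := mem_U.1 hz2
  have hcl := close_of_meet hzc hzc'
  set m : ℤ × ℤ := (c.1, c'.2) with hm
  have hzm : z ∈ Q m := by
    rw [mem_Q] at *
    exact ⟨hzc.1, hzc'.2⟩
  have hmK : m ∈ nr K := ⟨z, hzm, hzK⟩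
  have s1 : Path (nr K) c m := by
    by_cases e : c = m
    · rw [← e]; exact Relation.ReflTransGen.refl
    · refine Relation.ReflTransGen.single ⟨hc.1, hmK, ?_⟩
      have e2 : c.2 ≠ c'.2 := fun h => e (Prod.ext rfl h)
      have : m - c = (0, c'.2 - c.2) := by ext <;> simp [hm]
      rw [this]
      rcases lt_or_gt_of_ne e2 with h | h
      · right; right; left; ext <;> simp; omega
      · right; right; right; ext <;> simp; omega
  have s2 : Path (nr K) m c' := by
    by_cases e : m = c'
    · rw [← e]; exact Relation.ReflTransGen.refl
    · refine Relation.ReflTransGen.single ⟨hmK, hc'.1, ?_⟩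
      have e2 : c.1 ≠ c'.1 := fun h => e (Prod.ext h rfl)
      have : c' - m = (c'.1 - c.1, 0) := by ext <;> simp [hm]
      rw [this]
      rcases lt_or_gt_of_ne e2 with h | h
      · left; ext <;> simp; omega
      · right; left; ext <;> simp; omega
  exact hc'.2 ⟨hc'.1, (hc.2.trans s1).trans s2⟩

/-- Cells near a set, at scale `n`. -/
def nn (n : ℕ) (K : Set (ℝ × ℝ)) : Set (ℤ × ℤ) := nr ((fun z => (n : ℝ) • z) '' K)

lemma nn_finite (n : ℕ) {K : Set (ℝ × ℝ)} (hK : IsCompact K) : (nn n K).Finite :=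
  nr_finite (hK.image (continuous_const_smul _))

lemma nn_PC (n : ℕ) {K : Set (ℝ × ℝ)} (hK : IsCompact K) (hp : IsPreconnected K) : PC (nn n K) :=
  nr_PC (hK.image (continuous_const_smul _)) (hp.image _ (continuous_const_smul _).continuousOn)

lemma nn_mem (n : ℕ) {K : Set (ℝ × ℝ)} {z : ℝ × ℝ} (h : z ∈ K) : flc ((n : ℝ) • z) ∈ nn n K :=
  flc_mem ⟨z, h, rfl⟩

lemma nn_disj {K K' : Set (ℝ × ℝ)} (hK : IsCompact K) (hK' : IsCompact K') (h : Disjoint K K') :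
    ∀ᶠ n : ℕ in atTop, Disjoint (nn n K) (nn n K') := by
  obtain ⟨r, hr, hd⟩ := Metric.exists_pos_forall_lt_edist hK hK'.isClosed h
  have hr' : (0:ℝ) < r := hr
  obtain ⟨m, hm⟩ := exists_nat_gt (1 / (r:ℝ))
  filter_upwards [eventually_ge_atTop m] with n hn
  rw [disjoint_left]
  rintro c ⟨_, hz, z, hzK, rfl⟩ ⟨_, hz', z', hzK', rfl⟩
  have h1 := hd z hzK z' hzK'
  rw [mem_Q] at hz hz'
  simp only [Prod.smul_fst, Prod.smul_snd, smul_eq_mul] at hz hz'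
  have hnm : (m : ℝ) ≤ n := by exact_mod_cast hn
  have hn0 : 0 < (n : ℝ) := (by positivity : 0 < 1 / (r:ℝ)).trans (hm.trans_le hnm)
  have hnr : 1 < n * (r : ℝ) := by
    have := hm.trans_le hnm
    rwa [div_lt_iff₀ hr'] at this
  have h2 : (r : ℝ) < dist z z' := by
    rw [edist_dist, ← ENNReal.ofReal_coe_nnreal, ENNReal.ofReal_lt_ofReal_iff_of_nonneg (NNReal.coe_nonneg r)] at h1
    exact h1
  have h3 : dist z z' ≤ 1 / n := by
    rw [Prod.dist_eq, max_le_iff, Real.dist_eq, Real.dist_eq, abs_le, abs_le]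
    have a1 : ∀ a b t : ℝ, t ≤ n * a → n * b ≤ t + 1 → -(1 / n : ℝ) ≤ a - b := by
      intro a b t p q
      have : (b - a) * n ≤ 1 := by nlinarith
      have := (le_div_iff₀ hn0).2 this
      linarith
    refine ⟨⟨a1 _ _ _ hz.1.1 hz'.1.2, ?_⟩, a1 _ _ _ hz.2.1 hz'.2.2, ?_⟩
    · linarith [a1 _ _ _ hz'.1.1 hz.1.2]
    · linarith [a1 _ _ _ hz'.2.1 hz.2.2]
  have h4 := h2.trans_le h3
  rw [lt_div_iff₀ hn0] at h4
  linarith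

end Plan

namespace Plan
open Filter Topology

lemma discs {V Y J : Type} [Finite V] [Finite Y] [Finite J] (S : V → Set (ℝ × ℝ))
    (hSc : ∀ v, IsCompact (S v)) (hSp : ∀ v, IsPreconnected (S v)) (hSn : ∀ v, (S v).Nonempty)
    (hSd : ∀ v w, v ≠ w → Disjoint (S v) (S w)) (src : J → V) (tgt : J → Y)
    (htgt : Function.Surjective tgt) (M : J → Set (ℝ × ℝ)) (hMc : ∀ j, IsCompact (M j))
    (hMp : ∀ j, IsPreconnected (M j)) (m : Y → ℝ × ℝ) (hm : ∀ j, m (tgt j) ∈ M j)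
    (hMS : ∀ j, (M j ∩ S (src j)).Nonempty) (hMd : ∀ j w, w ≠ src j → Disjoint (M j) (S w))
    (hMM : ∀ i j, tgt i ≠ tgt j → Disjoint (M i) (M j)) (hmS : ∀ y v, m y ∉ S v) :
    ∃ T : V ⊕ Y → Set (ℤ × ℤ), (∀ h, (T h).Finite) ∧ (∀ h, (T h).Nonempty) ∧ (∀ h, PC (T h)) ∧
      (∀ h h', h ≠ h' → Disjoint (T h) (T h')) ∧
      ∀ j, ∃ c ∈ T (.inr (tgt j)), ∃ d, Dir d ∧ c + d ∈ T (.inl (src j)) := by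
  have e1 : ∀ᶠ n : ℕ in atTop, ∀ v w, v ≠ w → Disjoint (nn n (S v)) (nn n (S w)) := by
    refine eventually_all.2 fun v => eventually_all.2 fun w => ?_
    by_cases h : v = w
    · simp [h]
    · filter_upwards [nn_disj (hSc v) (hSc w) (hSd v w h)] with n hn _ using hn
  have e2 : ∀ᶠ n : ℕ in atTop, ∀ j w, w ≠ src j → Disjoint (nn n (M j)) (nn n (S w)) := by
    refine eventually_all.2 fun j => eventually_all.2 fun w => ?_
    by_cases h : w = src j
    · simp [h]
    · filter_upwards [nn_disj (hMc j) (hSc w) (hMd j w h)] with n hn _ using hn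
  have e3 : ∀ᶠ n : ℕ in atTop, ∀ i j, tgt i ≠ tgt j → Disjoint (nn n (M i)) (nn n (M j)) := by
    refine eventually_all.2 fun i => eventually_all.2 fun j => ?_
    by_cases h : tgt i = tgt j
    · simp [h]
    · filter_upwards [nn_disj (hMc i) (hMc j) (hMM i j h)] with n hn _ using hn
  have e4 : ∀ᶠ n : ℕ in atTop, ∀ y w, Disjoint (nn n {m y}) (nn n (S w)) :=
    eventually_all.2 fun y => eventually_all.2 fun w =>
      nn_disj isCompact_singleton (hSc w) (by simpa using hmS y w)
  obtain ⟨n, h1, h2, h3, h4⟩ := (e1.and (e2.and (e3.and e4))).exists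
  set F : Y → Set (ℤ × ℤ) := fun y => {c | (∃ j, tgt j = y ∧ c ∈ nn n (M j)) ∧ ∀ v, c ∉ nn n (S v)} with hF
  set o : Y → ℤ × ℤ := fun y => flc ((n : ℝ) • m y) with ho
  have hoF : ∀ y, o y ∈ F y := by
    intro y
    obtain ⟨j, rfl⟩ := htgt y
    exact ⟨⟨j, rfl, nn_mem n (hm j)⟩, fun v => disjoint_left.1 (h4 _ v) (nn_mem n rfl)⟩
  set R : Y → Set (ℤ × ℤ) := fun y => {c | c ∈ F y ∧ Path (F y) (o y) c} with hR
  have hoR : ∀ y, o y ∈ R y := fun y => ⟨hoF y, Relation.ReflTransGen.refl⟩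
  have hRF : ∀ y y', y ≠ y' → Disjoint (R y) (R y') := by
    intro y y' hy
    rw [disjoint_left]
    rintro c ⟨⟨⟨j, rfl, hj⟩, -⟩, -⟩ ⟨⟨⟨i, rfl, hi⟩, -⟩, -⟩
    exact disjoint_left.1 (h3 j i hy) hj hi
  have hRS : ∀ y v, Disjoint (R y) (nn n (S v)) := fun y v => disjoint_left.2 fun c hc => hc.1.2 v
  refine ⟨Sum.elim (fun v => nn n (S v)) R, ?_, ?_, ?_, ?_, ?_⟩
  · rintro (v | y)
    · exact nn_finite n (hSc v)
    · refine (finite_iUnion fun j => nn_finite n (hMc j)).subset ?_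
      rintro c ⟨⟨⟨j, -, hj⟩, -⟩, -⟩
      exact mem_iUnion.2 ⟨j, hj⟩
  · rintro (v | y)
    · obtain ⟨z, hz⟩ := hSn v
      exact ⟨_, nn_mem n hz⟩
    · exact ⟨_, hoR y⟩
  · rintro (v | y)
    · exact nn_PC n (hSc v) (hSp v)
    · refine PC.of_star (o y) ?_
      rintro b ⟨-, hb⟩
      have : b ∈ R y ∧ Path (R y) (o y) b := by
        induction hb with
        | refl => exact ⟨hoR y, Relation.ReflTransGen.refl⟩
        | @tail b c _ hs ih =>
          have hc : c ∈ R y := ⟨hs.2.1, ih.1.2.tail hs⟩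
          exact ⟨hc, ih.2.tail ⟨ih.1, hc, hs.2.2⟩⟩
      exact this.2
  · rintro (v | y) (v' | y') h
    · exact h1 v v' fun e => h (by rw [e])
    · exact (hRS y' v).symm
    · exact hRS y v'
    · exact hRF y y' fun e => h (by rw [e])
  · intro j
    obtain ⟨z, hzM, hzS⟩ := hMS j
    have hp := nn_PC n (hMc j) (hMp j) _ (nn_mem n (hm j)) _ (nn_mem n hzM)
    obtain ⟨a, b, hs, ha, hb⟩ := hp.exit (S := R (tgt j)) (hoR _)
      fun h => disjoint_left.1 (hRS _ (src j)) h (nn_mem n hzS)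
    refine ⟨a, ha, b - a, hs.2.2, ?_⟩
    have e : a + (b - a) = b := by abel
    rw [e]
    show b ∈ nn n (S (src j))
    by_contra hbs
    refine hb ?_
    have hbF : b ∈ F (tgt j) := by
      refine ⟨⟨j, rfl, hs.2.1⟩, fun v hv => ?_⟩
      by_cases hv' : v = src j
      · rw [hv'] at hv; exact hbs hv
      · exact disjoint_left.1 (h2 j v hv') hs.2.1 hv
    exact ⟨hbF, ha.2.tail ⟨ha.1, hbF, hs.2.2⟩⟩

/-- Version where some of the cells of `Y` are merged into their owners. -/
lemma discs_merge {V Y : Type} [Finite V] [Finite Y] (T : V ⊕ Y → Set (ℤ × ℤ))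
    (h1 : ∀ h, (T h).Finite) (h2 : ∀ h, (T h).Nonempty) (h3 : ∀ h, PC (T h))
    (h4 : ∀ h h', h ≠ h' → Disjoint (T h) (T h')) (P : Y → Prop) (ow : Y → V)
    (how : ∀ y, ¬ P y → ∃ c ∈ T (.inr y), ∃ d, Dir d ∧ c + d ∈ T (.inl (ow y))) :
    ∃ T' : V ⊕ {y // P y} → Set (ℤ × ℤ), (∀ h, Conn (T' h)) ∧
      (∀ h h', h ≠ h' → Disjoint (T' h) (T' h')) ∧
      (∀ v, T (.inl v) ⊆ T' (.inl v)) ∧ (∀ y, T' (.inr y) = T (.inr y)) ∧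
      ∀ y, ¬ P y → T (.inr y) ⊆ T' (.inl (ow y)) := by
  set A : V → Set (ℤ × ℤ) := fun v => {c | c ∈ T (.inl v) ∨ ∃ y, ¬ P y ∧ ow y = v ∧ c ∈ T (.inr y)} with hA
  have hsub : ∀ v, T (.inl v) ⊆ A v := fun v c hc => Or.inl hc
  have hsub' : ∀ y, ¬ P y → T (.inr y) ⊆ A (ow y) := fun y hy c hc => Or.inr ⟨y, hy, rfl, hc⟩
  have hd : ∀ {h h' c}, c ∈ T h → c ∈ T h' → h = h' := by
    intro h h' c hc hc'
    by_contra hn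
    exact disjoint_left.1 (h4 h h' hn) hc hc'
  refine ⟨Sum.elim A fun y => T (.inr y.1), ?_, ?_, hsub, fun y => rfl, hsub'⟩
  · rintro (v | y)
    · obtain ⟨a, ha⟩ := h2 (.inl v)
      refine PC.conn (PC.of_star a ?_) ?_ ⟨a, hsub v ha⟩
      · rintro b (hb | ⟨y, hy, rfl, hb⟩)
        · exact (h3 _ a ha b hb).mono (hsub v)
        · obtain ⟨c, hc, d, hd', hcd⟩ := how y hy
          have p1 := (h3 _ a ha _ hcd).mono (hsub _)
          have p2 := (h3 _ c hc b hb).mono (hsub' y hy)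
          have s : Step (A (ow y)) c (c + d) := ⟨hsub' y hy hc, hsub _ hcd, by simpa using hd'⟩
          exact (p1.tail s.symm).trans p2
      · refine (finite_iUnion h1).subset ?_
        rintro b (hb | ⟨y, hy, rfl, hb⟩)
        · exact mem_iUnion.2 ⟨_, hb⟩
        · exact mem_iUnion.2 ⟨_, hb⟩
    · exact (h3 _).conn (h1 _) (h2 _)
  · rintro (v | y) (v' | y') h <;> rw [disjoint_left]
    · rintro c (hc | ⟨y, hy, rfl, hc⟩) (hc' | ⟨y', hy', rfl, hc'⟩)
      · exact h (by simpa using hd hc hc')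
      · simpa using hd hc hc'
      · simpa using hd hc hc'
      · have := hd hc hc'
        rw [Sum.inr.injEq] at this
        exact h (by rw [this])
    · rintro c (hc | ⟨y, hy, rfl, hc⟩) hc'
      · simpa using hd hc hc'
      · have := hd hc hc'
        rw [Sum.inr.injEq] at this
        exact hy (this ▸ y'.2)
    · rintro c hc' (hc | ⟨y', hy, rfl, hc⟩)
      · simpa using hd hc hc'
      · have := hd hc hc'
        rw [Sum.inr.injEq] at this
        exact hy (this ▸ y.2)
    · intro c hc hc'
      have := hd hc hc'
      rw [Sum.inr.injEq] at this
      exact h (by rw [Subtype.ext this])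

end Plan

namespace Plan
open Filter Topology

lemma halves {V Y J : Type} [Finite V] [Finite Y] [Finite J] (pos : V → ℝ × ℝ)
    (hpos : Function.Injective pos) (γ : J → ℝ → ℝ × ℝ) (src : J → V) (tgt : J → Y)
    (htgt : Function.Surjective tgt) (m : Y → ℝ × ℝ)
    (hγ : ∀ j, ContinuousOn (γ j) (Icc 0 1)) (h0 : ∀ j, γ j 0 = pos (src j))
    (h1 : ∀ j, γ j 1 = m (tgt j))
    (hb : ∀ i j, ∀ t ∈ Icc (0:ℝ) 1, ∀ s ∈ Icc (0:ℝ) 1, γ i t = γ j s →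
      (t = 0 ∧ s = 0 ∧ src i = src j) ∨ (t = 1 ∧ s = 1 ∧ tgt i = tgt j) ∨ (i = j ∧ t = s))
    (hc : ∀ v j, ∀ t ∈ Icc (0:ℝ) 1, pos v = γ j t → t = 0 ∧ v = src j) :
    ∃ T : V ⊕ Y → Set (ℤ × ℤ), (∀ h, (T h).Finite) ∧ (∀ h, (T h).Nonempty) ∧ (∀ h, PC (T h)) ∧
      (∀ h h', h ≠ h' → Disjoint (T h) (T h')) ∧
      ∀ j, ∃ c ∈ T (.inr (tgt j)), ∃ d, Dir d ∧ c + d ∈ T (.inl (src j)) := by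
  have i1 : Icc (0:ℝ) (1/2) ⊆ Icc 0 1 := Icc_subset_Icc le_rfl (by norm_num)
  have i2 : Icc (1/2:ℝ) 1 ⊆ Icc 0 1 := Icc_subset_Icc (by norm_num) le_rfl
  have m0 : (0:ℝ) ∈ Icc (0:ℝ) (1/2) := by constructor <;> norm_num
  have m1 : (1:ℝ) ∈ Icc (1/2:ℝ) 1 := by constructor <;> norm_num
  have mh : (1/2:ℝ) ∈ Icc (0:ℝ) (1/2) := by constructor <;> norm_num
  have mh' : (1/2:ℝ) ∈ Icc (1/2:ℝ) 1 := by constructor <;> norm_num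
  refine discs (fun v => {pos v} ∪ ⋃ j : {j // src j = v}, γ j.1 '' Icc 0 (1/2)) ?_ ?_ ?_ ?_ src tgt htgt
    (fun j => γ j '' Icc (1/2) 1) ?_ ?_ m ?_ ?_ ?_ ?_ ?_
  · intro v
    exact isCompact_singleton.union (isCompact_iUnion fun j => isCompact_Icc.image_of_continuousOn ((hγ _).mono i1))
  · intro v
    refine isPreconnected_of_forall (pos v) ?_
    rintro z (hz | hz)
    · exact ⟨{pos v}, subset_union_left, rfl, hz, isPreconnected_singleton⟩
    · obtain ⟨⟨j, hj⟩, hz⟩ := mem_iUnion.1 hz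
      refine ⟨γ j '' Icc 0 (1/2), fun w hw => Or.inr (mem_iUnion.2 ⟨⟨j, hj⟩, hw⟩), ⟨0, m0, by rw [h0, hj]⟩, hz,
        isPreconnected_Icc.image _ ((hγ _).mono i1)⟩
  · intro v
    exact ⟨pos v, Or.inl rfl⟩
  · intro v w hvw
    rw [disjoint_left]
    rintro z (hz | hz) (hz' | hz')
    · rw [mem_singleton_iff] at hz hz'
      exact hvw (hpos (hz.symm.trans hz'))
    · obtain ⟨⟨j, hj⟩, t, ht, rfl⟩ := mem_iUnion.1 hz'
      rw [mem_singleton_iff] at hz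
      exact hvw ((hc v j t (i1 ht) hz.symm).2.trans hj)
    · obtain ⟨⟨j, hj⟩, t, ht, rfl⟩ := mem_iUnion.1 hz
      rw [mem_singleton_iff] at hz'
      exact hvw ((hc w j t (i1 ht) hz'.symm).2.trans hj).symm
    · obtain ⟨⟨j, hj⟩, t, ht, rfl⟩ := mem_iUnion.1 hz
      obtain ⟨⟨i, hi⟩, s, hs, hst⟩ := mem_iUnion.1 hz'
      simp only at hi hj hst
      rcases hb i j s (i1 hs) t (i1 ht) hst with h | h | h
      · exact hvw (by rw [← hi, ← hj, h.2.2])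
      · linarith [hs.2, h.1]
      · exact hvw (by rw [← hi, ← hj, h.1])
  · intro j
    exact isCompact_Icc.image_of_continuousOn ((hγ _).mono i2)
  · intro j
    exact isPreconnected_Icc.image _ ((hγ _).mono i2)
  · intro j
    exact ⟨1, m1, h1 j⟩
  · intro j
    exact ⟨γ j (1/2), ⟨_, mh', rfl⟩, Or.inr (mem_iUnion.2 ⟨⟨j, rfl⟩, _, mh, rfl⟩)⟩
  · intro j w hw
    rw [disjoint_left]
    rintro z ⟨t, ht, rfl⟩ (hz' | hz')
    · rw [mem_singleton_iff] at hz'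
      exact hw (hc w j t (i2 ht) hz'.symm).2
    · obtain ⟨⟨i, hi⟩, s, hs, hst⟩ := mem_iUnion.1 hz'
      simp only at hi hst
      rcases hb i j s (i1 hs) t (i2 ht) hst with h | h | h
      · linarith [ht.1, h.2.1]
      · linarith [hs.2, h.1]
      · exact hw (by rw [← hi, h.1])
  · intro i j hij
    rw [disjoint_left]
    rintro z ⟨t, ht, rfl⟩ ⟨s, hs, hst⟩
    rcases hb j i s (i2 hs) t (i2 ht) hst with h | h | h
    · linarith [ht.1, h.2.1]
    · exact hij h.2.2.symm
    · exact hij (by rw [h.1])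
  · intro y v hy
    obtain ⟨j, rfl⟩ := htgt y
    rw [← h1] at hy
    rcases hy with hy | hy
    · have := (hc v j 1 (i2 m1) hy.symm).1
      norm_num at this
    · obtain ⟨⟨i, hi⟩, s, hs, hst⟩ := mem_iUnion.1 hy
      simp only at hst
      rcases hb i j s (i1 hs) 1 (i2 m1) hst with h | h | h
      · linarith [h.2.1]
      · linarith [hs.2, h.1]
      · linarith [hs.2, h.2]

/-- Reparametrisation of the two halves of an arc. -/
def prm (τ : ℝ) (b : Bool) (t : ℝ) : ℝ := if b then 1 - (1 - τ) * t else τ * t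

lemma prm_mem {τ : ℝ} (h : τ ∈ Ioo (0:ℝ) 1) (b : Bool) {t : ℝ} (ht : t ∈ Icc (0:ℝ) 1) :
    prm τ b t ∈ Icc (0:ℝ) 1 := by
  obtain ⟨h1, h2⟩ := h
  obtain ⟨h3, h4⟩ := ht
  cases b <;> simp only [prm] <;> constructor <;> simp <;> nlinarith

lemma prm_mem' {τ : ℝ} (h : τ ∈ Ioo (0:ℝ) 1) (b : Bool) {t : ℝ} (ht : t ∈ Icc (0:ℝ) 1) (h0 : t ≠ 0) :
    prm τ b t ∈ Ioo (0:ℝ) 1 := by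
  obtain ⟨h1, h2⟩ := h
  obtain ⟨h3, h4⟩ := ht
  have h5 : 0 < t := lt_of_le_of_ne h3 h0.symm
  cases b <;> simp only [prm] <;> constructor <;> simp <;> nlinarith

lemma prm_eq {τ : ℝ} (h : τ ∈ Ioo (0:ℝ) 1) (b : Bool) {t : ℝ} (e : prm τ b t = τ) : t = 1 := by
  obtain ⟨h1, h2⟩ := h
  cases b <;> simp only [prm] at e <;> simp at e
  · exact mul_left_cancel₀ h1.ne' (by linarith : τ * t = τ * 1)
  · have : (1 - τ) * t = (1 - τ) * 1 := by linarith
    exact mul_left_cancel₀ (by linarith) this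

lemma prm_inj {τ : ℝ} (h : τ ∈ Ioo (0:ℝ) 1) (b c : Bool) {t s : ℝ} (ht : t ∈ Icc (0:ℝ) 1)
    (hs : s ∈ Icc (0:ℝ) 1) (e : prm τ b t = prm τ c s) : (t = 1 ∧ s = 1) ∨ (b = c ∧ t = s) := by
  obtain ⟨h1, h2⟩ := h
  obtain ⟨h3, h4⟩ := ht
  obtain ⟨h5, h6⟩ := hs
  cases b <;> cases c <;> simp only [prm] at e <;> simp at e
  · right; exact ⟨rfl, e.resolve_right h1.ne'⟩
  · left; constructor <;> nlinarith
  · left; constructor <;> nlinarith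
  · right; refine ⟨rfl, e.resolve_right (by linarith)⟩

lemma prm_cont (τ : ℝ) (b : Bool) : Continuous (prm τ b) := by
  cases b <;> unfold prm <;> simp <;> fun_prop

lemma prm_zero (τ : ℝ) (b : Bool) : prm τ b 0 = if b then 1 else 0 := by simp [prm]

lemma prm_one (τ : ℝ) (b : Bool) : prm τ b 1 = τ := by cases b <;> simp [prm]

theorem forward {V : Type} [Fintype V] (G : SimpleGraph V) (D : G.Drawing) (h1 : D.IsOnePlanarD)
    (h2 : IsCrossingAugmentedD D) : IsKMapGraph G 4 := by
  choose u v huv hu hv using D.arc_ends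
  have hτ : ∀ e, ∃ τ ∈ Ioo (0:ℝ) 1, ∀ f, f ≠ e → ∀ t ∈ Ioo (0:ℝ) 1, ∀ s ∈ Ioo (0:ℝ) 1,
      D.arc e t = D.arc f s → t = τ := by
    intro e
    by_cases hx : ∃ f, f ≠ e ∧ ∃ t ∈ Ioo (0:ℝ) 1, ∃ s ∈ Ioo (0:ℝ) 1, D.arc e t = D.arc f s
    · obtain ⟨f, hf, t, ht, s, hs, hts⟩ := hx
      refine ⟨t, ht, fun f' hf' t' ht' s' hs' hts' => ?_⟩
      have := h1 e (x := (f, D.arc e t)) ⟨hf, ⟨t, ht, rfl⟩, s, hs, hts.symm⟩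
        (y := (f', D.arc e t')) ⟨hf', ⟨t', ht', rfl⟩, s', hs', hts'.symm⟩
      exact (D.arc_inj e (Ioo_subset_Icc_self ht) (Ioo_subset_Icc_self ht') (congrArg Prod.snd this)).symm
    · exact ⟨1/2, by constructor <;> norm_num, fun f hf t ht s hs hts =>
        (hx ⟨f, hf, t, ht, s, hs, hts⟩).elim⟩
  choose τ hτI hτ using hτ
  set q : G.edgeSet → Plane := fun e => D.arc e (τ e) with hq
  have hqI : ∀ e, q e ∈ D.inter e := fun e => ⟨τ e, hτI e, rfl⟩
  have hcr : ∀ e f, q e = q f → (D.inter e ∩ D.inter f).Nonempty := fun e f h =>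
    ⟨q e, hqI e, h ▸ hqI f⟩
  have hthree : ∀ e f g, f ≠ e → g ≠ e → q f = q e → q g = q e → f = g := by
    intro e f g hf hg h h'
    exact congrArg Prod.fst (h1 e (x := (f, q e)) ⟨hf, hqI e, h ▸ hqI f⟩ (y := (g, q e)) ⟨hg, hqI e, h' ▸ hqI g⟩)
  have hne : ∀ e, u e ≠ v e := by
    intro e
    have := e.2
    rw [huv e, SimpleGraph.mem_edgeSet] at this
    exact this.ne
  have hadj : ∀ e, G.Adj (u e) (v e) := by
    intro e
    have := e.2
    rwa [huv e, SimpleGraph.mem_edgeSet] at this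
  have hmemu : ∀ e : G.edgeSet, u e ∈ (e : Sym2 V) := fun e => by rw [huv e]; simp
  have hmemv : ∀ e : G.edgeSet, v e ∈ (e : Sym2 V) := fun e => by rw [huv e]; simp
  let J := G.edgeSet × Bool
  let Y := range q
  let src : J → V := fun j => if j.2 then v j.1 else u j.1
  let tgt : J → Y := fun j => ⟨q j.1, mem_range_self _⟩
  let γ : J → ℝ → ℝ × ℝ := fun j t => D.arc j.1 (prm (τ j.1) j.2 t)
  have hg0 : ∀ j, γ j 0 = D.pos (src j) := by
    rintro ⟨e, b⟩
    cases b
    · simp [γ, src, prm_zero, hu]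
    · simp [γ, src, prm_zero, hv]
  have hc : ∀ w j, ∀ t ∈ Icc (0:ℝ) 1, D.pos w = γ j t → t = 0 ∧ w = src j := by
    intro w j t ht h
    have ht0 : t = 0 := by
      by_contra h0
      exact D.arc_avoid j.1 w ⟨_, prm_mem' (hτI j.1) j.2 ht h0, h.symm⟩
    refine ⟨ht0, ?_⟩
    rw [ht0, hg0] at h
    exact D.pos_inj h
  have hb : ∀ i j, ∀ t ∈ Icc (0:ℝ) 1, ∀ s ∈ Icc (0:ℝ) 1, γ i t = γ j s →
      (t = 0 ∧ s = 0 ∧ src i = src j) ∨ (t = 1 ∧ s = 1 ∧ tgt i = tgt j) ∨ (i = j ∧ t = s) := by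
    intro i j t ht s hs h
    by_cases ht0 : t = 0
    · rw [ht0, hg0] at h
      obtain ⟨a, b⟩ := hc _ _ _ hs h
      exact Or.inl ⟨ht0, a, b⟩
    by_cases hs0 : s = 0
    · rw [hs0, hg0] at h
      obtain ⟨a, b⟩ := hc _ _ _ ht h.symm
      exact Or.inl ⟨a, hs0, b.symm⟩
    have hpi := prm_mem' (hτI i.1) i.2 ht ht0
    have hpj := prm_mem' (hτI j.1) j.2 hs hs0
    right
    by_cases hij : i.1 = j.1
    · obtain ⟨e, b⟩ := i
      obtain ⟨f, c⟩ := j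
      simp only at hij
      subst hij
      have := D.arc_inj e (Ioo_subset_Icc_self hpi) (Ioo_subset_Icc_self hpj) h
      rcases prm_inj (hτI e) b c ht hs this with h' | h'
      · exact Or.inl ⟨h'.1, h'.2, rfl⟩
      · exact Or.inr ⟨by rw [h'.1], h'.2⟩
    · left
      have a1 := hτ i.1 j.1 (Ne.symm hij) _ hpi _ hpj h
      have a2 := hτ j.1 i.1 hij _ hpj _ hpi h.symm
      refine ⟨prm_eq (hτI _) _ a1, prm_eq (hτI _) _ a2, Subtype.ext ?_⟩
      show D.arc i.1 (τ i.1) = D.arc j.1 (τ j.1)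
      rw [← a1, ← a2]
      exact h
  obtain ⟨T, t1, t2, t3, t4, t5⟩ := halves (V := V) (Y := Y) (J := J) D.pos D.pos_inj γ src tgt
    (by rintro ⟨_, e, rfl⟩; exact ⟨(e, false), rfl⟩) Subtype.val
    (fun j => (D.arc_cont j.1).comp (prm_cont _ _).continuousOn fun t ht => prm_mem (hτI _) _ ht) hg0
    (fun j => by simp [γ, prm_one, tgt, hq]) hb hc
  let P : Y → Prop := fun y => ∃ e f, e ≠ f ∧ q e = y ∧ q f = y
  have hex : ∀ y : Y, ∃ e, q e = y := fun y => y.2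
  choose E0 hE0 using hex
  have hE0' : ∀ e, ¬ P (tgt (e, false)) → E0 (tgt (e, false)) = e := by
    intro e he
    by_contra h
    exact he ⟨_, _, h, hE0 _, rfl⟩
  obtain ⟨T', s1, s2, s3, s4, s5⟩ := discs_merge T t1 t2 t3 t4 P (fun y => u (E0 y)) (by
    intro y hy
    have := t5 (E0 y, false)
    have e : tgt (E0 y, false) = y := Subtype.ext (hE0 y)
    rw [e] at this
    exact this)
  have hXe : ∀ x : {y // P y}, ∃ e f, e ≠ f ∧ q e = x.1 ∧ q f = x.1 := fun x => x.2
  choose e f hef he hf using hXe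
  have hnoinc : ∀ x w, w ∈ (e x : Sym2 V) → w ∈ (f x : Sym2 V) → False := fun x w ha hb' =>
    D.no_incident_cross (e x) (f x) (hef x) (hcr _ _ ((he x).trans (hf x).symm)) w ⟨ha, hb'⟩
  let nb : {y // P y} → Fin 4 → V := fun x => ![u (e x), v (e x), u (f x), v (f x)]
  have n1 : ∀ x, u (e x) ≠ u (f x) := fun x h => hnoinc x _ (hmemu _) (h ▸ hmemu _)
  have n2 : ∀ x, u (e x) ≠ v (f x) := fun x h => hnoinc x _ (hmemu _) (h ▸ hmemv _)
  have n3 : ∀ x, v (e x) ≠ u (f x) := fun x h => hnoinc x _ (hmemv _) (h ▸ hmemu _)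
  have n4 : ∀ x, v (e x) ≠ v (f x) := fun x h => hnoinc x _ (hmemv _) (h ▸ hmemv _)
  have hnb : ∀ x, Function.Injective (nb x) := by
    intro x k l
    fin_cases k <;> fin_cases l <;> simp [nb, n1, n2, n3, n4, hne, (n1 _).symm, (n2 _).symm, (n3 _).symm, (n4 _).symm, (hne _).symm]
  have hcross : ∀ x, ∀ a ∈ (e x : Sym2 V), ∀ c ∈ (f x : Sym2 V), G.Adj a c := by
    intro x a ha c hc'
    obtain ⟨b, hb'⟩ := Sym2.mem_iff_exists.1 ha
    obtain ⟨d, hd⟩ := Sym2.mem_iff_exists.1 hc'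
    exact h2 (e x) (f x) (hef x) (hcr _ _ ((he x).trans (hf x).symm)) a b c d hb' hd
  have hadjX : ∀ (x : {y // P y}) (j : J), tgt j = x.1 →
      ∃ c ∈ T' (.inr x), ∃ d, Dir d ∧ c + d ∈ T' (.inl (src j)) := by
    intro x j hj
    obtain ⟨c, hc', d, hd, hcd⟩ := t5 j
    refine ⟨c, ?_, d, hd, s3 _ hcd⟩
    rw [s4, ← hj]; exact hc'
  have hBuv : ∀ e, ¬ P (tgt (e, false)) → ∃ c ∈ T' (.inl (u e)), ∃ d, Dir d ∧ c + d ∈ T' (.inl (v e)) := by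
    intro e he'
    obtain ⟨c, hc', d, hd, hcd⟩ := t5 (e, true)
    refine ⟨c, ?_, d, hd, s3 _ hcd⟩
    have := s5 _ he' hc'
    rwa [hE0' e he'] at this
  refine build G (fun a b => ∃ e, ¬ P (tgt (e, false)) ∧ ((a = u e ∧ b = v e) ∨ (a = v e ∧ b = u e)))
    nb hnb T' s1 s2 ?_ ?_ ?_ ?_ ?_
  · rintro a b ⟨e, he', h | h⟩
    · exact ⟨e, he', Or.inr ⟨h.2, h.1⟩⟩
    · exact ⟨e, he', Or.inl ⟨h.2, h.1⟩⟩
  · rintro a b ⟨e, he', ⟨rfl, rfl⟩ | ⟨rfl, rfl⟩⟩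
    · exact hne e
    · exact (hne e).symm
  · rintro a b ⟨e, he', ⟨rfl, rfl⟩ | ⟨rfl, rfl⟩⟩
    · exact hBuv e he'
    · obtain ⟨c, hc', d, hd, hcd⟩ := hBuv e he'
      exact ⟨c + d, hcd, -d, hd.neg, by simpa using hc'⟩
  · intro x k
    fin_cases k
    · exact hadjX x (e x, false) (Subtype.ext (he x))
    · exact hadjX x (e x, true) (Subtype.ext (he x))
    · exact hadjX x (f x, false) (Subtype.ext (hf x))
    · exact hadjX x (f x, true) (Subtype.ext (hf x))
  · intro a b
    constructor
    · intro h
      refine ⟨h.ne, ?_⟩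
      let g : G.edgeSet := ⟨s(a, b), h⟩
      have hg : (a = u g ∧ b = v g) ∨ (a = v g ∧ b = u g) := by
        have := huv g
        simpa [g] using this
      by_cases hP : P (tgt (g, false))
      · right
        let x : {y // P y} := ⟨_, hP⟩
        have hgx : g = e x ∨ g = f x := by
          by_contra hcon
          push Not at hcon
          exact hcon.2 (hthree (e x) g (f x) hcon.1 (hef x).symm (he x).symm ((hf x).trans (he x).symm))
        rcases hgx with hgx | hgx <;> rw [hgx] at hg <;> rcases hg with ⟨ha, hb'⟩ | ⟨ha, hb'⟩
        · exact ⟨x, 0, 1, ha.symm, hb'.symm⟩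
        · exact ⟨x, 1, 0, ha.symm, hb'.symm⟩
        · exact ⟨x, 2, 3, ha.symm, hb'.symm⟩
        · exact ⟨x, 3, 2, ha.symm, hb'.symm⟩
      · exact Or.inl ⟨g, hP, hg⟩
    · rintro ⟨hab, ⟨e, he', ⟨rfl, rfl⟩ | ⟨rfl, rfl⟩⟩ | ⟨x, k, l, rfl, rfl⟩⟩
      · exact hadj e
      · exact (hadj e).symm
      · have c1 := hcross x _ (hmemu _) _ (hmemu _)
        have c2 := hcross x _ (hmemu _) _ (hmemv _)
        have c3 := hcross x _ (hmemv _) _ (hmemu _)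
        have c4 := hcross x _ (hmemv _) _ (hmemv _)
        have c5 := hadj (e x)
        have c6 := hadj (f x)
        fin_cases k <;> fin_cases l <;> first
          | exact absurd rfl hab
          | exact c1 | exact c2 | exact c3 | exact c4 | exact c5 | exact c6
          | exact c1.symm | exact c2.symm | exact c3.symm | exact c4.symm | exact c5.symm | exact c6.symm

end Plan

/-- A 1-planar graph admits a crossing-augmented 1-planar
embedding if and only if it is a 4-map graph. -/
theorem crossing_augmented_iff_four_map {V : Type} [Fintype V] (G : SimpleGraph V)
    (hG : G.IsOnePlanar) :
    (∃ D : G.Drawing, D.IsOnePlanarD ∧ IsCrossingAugmentedD D) ↔ IsKMapGraph G 4 := by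
  exact ⟨fun ⟨D, h1, h2⟩ => Plan.forward G D h1 h2, Plan.reverse G⟩
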